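/- Fix an integer p ≥ 2 and c ∈ (0,1/2), and let γ_n, β_n, α_n, θ_n, a_n, c_n, k_n(t) be as in the standing setup. Define ν_n^t(u,∞) = k_n(t)·𝒫(Σ_{j=1}^{θ_n} e^{β_n H_n(J_n(j))} e_{n,j} > c_n u^{β_n/γ_n} | H_n). Then for every u > 0, t > 0 and ε > 0, lim_{n→∞} ℙ(|ν_n^t(u,∞) − 2p·t·u^{-1}| > ε) = 0, i.e. ν_n^t(u,∞) converges to 2pt/u in ℙ-probability with respect to the environment. -/

import Mathlib

open MeasureTheory ProbabilityTheory Filter Real Finset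

/-- Configuration space: the hypercube `Σ_n = {−1,1}^n`, encoded as `Fin n → Bool`,
with the Hamming distance as graph distance. -/
abbrev V (n : ℕ) := Fin n → Bool

/-- Overlap `R_n(x,x') = 1 − 2·dist(x,x')/n`. -/
noncomputable def overlap (n : ℕ) (x y : V n) : ℝ := 1 - 2 * (hammingDist x y : ℝ) / n

/-- `γ_n = n^{-c}`. -/
noncomputable def γseq (c : ℝ) (n : ℕ) : ℝ := (n : ℝ) ^ (-c)

/-- Block length `θ_n = 3n²`. -/
def θseq (n : ℕ) : ℕ := 3 * n ^ 2

/-- Jump scale `a_n = √(2πn)·γ_n⁻¹·e^{γ_n²n/2}`. -/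
noncomputable def aseq (c : ℝ) (n : ℕ) : ℝ :=
  Real.sqrt (2 * π * n) * (γseq c n)⁻¹ * Real.exp ((γseq c n) ^ 2 * n / 2)

/-- Time scale `c_n = e^{γ_nβ_n n}`. -/
noncomputable def cseq (c : ℝ) (β : ℕ → ℝ) (n : ℕ) : ℝ := Real.exp (γseq c n * β n * n)

/-- `k_n(t) = ⌊⌊a_n t⌋/θ_n⌋`. -/
noncomputable def kseq (c : ℝ) (n : ℕ) (t : ℝ) : ℕ := ⌊aseq c n * t⌋₊ / θseq n

/-- `X` is a centered Gaussian random vector with covariance `Δ`: every linear combination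
of its coordinates is a centered real Gaussian with the corresponding variance. -/
def IsCenteredGaussianVector {Ω : Type*} [MeasurableSpace Ω] (P : Measure Ω)
    {I : Type*} [Fintype I] (X : I → Ω → ℝ) (Δ : I → I → ℝ) : Prop :=
  ∀ c : I → ℝ, Measure.map (fun ω => ∑ i, c i * X i ω) P =
    gaussianReal 0 (Real.toNNReal (∑ i, ∑ j, c i * c j * Δ i j))

/-- Joint law of the dynamics: `J n` is the simple random walk on `Σ_n` started from the
uniform distribution, `(e n j)` are i.i.d. mean-one exponentials, and the walk and the
exponentials are independent; all of this is encoded through the joint finite-dimensional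
distributions. -/
def WalkExpLaw {Ω' : Type*} [MeasurableSpace Ω'] (Pw : Measure Ω')
    (J : (n : ℕ) → ℕ → Ω' → V n) (e : ℕ → ℕ → Ω' → ℝ) : Prop :=
  ∀ (n m : ℕ) (xs : Fin (m + 1) → V n) (ys : Fin (m + 1) → ℝ), (∀ k, 0 ≤ ys k) →
    Pw {ω' | (∀ k : Fin (m + 1), J n k ω' = xs k) ∧ (∀ k : Fin (m + 1), ys k < e n k ω')} =
      ENNReal.ofReal (((2 : ℝ) ^ n)⁻¹ *
        ∏ k : Fin m, (if hammingDist (xs k.castSucc) (xs k.succ) = 1 then (n : ℝ)⁻¹ else 0)) *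
      ENNReal.ofReal (Real.exp (-∑ k, ys k))

/-- `ν_n^t(u,∞) = k_n(t)·𝒫(Σ_{j=1}^{θ_n} e^{β_n h(J_n(j))} e_{n,j} > c_n u^{β_n/γ_n})`,
for a fixed realization `h` of the environment. -/
noncomputable def nuSum {Ω' : Type*} [MeasurableSpace Ω'] (Pw : Measure Ω')
    (J : (n : ℕ) → ℕ → Ω' → V n) (e : ℕ → ℕ → Ω' → ℝ)
    (c : ℝ) (β : ℕ → ℝ) (n : ℕ) (t u : ℝ) (h : V n → ℝ) : ℝ :=
  (kseq c n t : ℝ) *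
    (Pw {ω' | cseq c β n * u ^ (β n / γseq c n) <
      ∑ j ∈ Icc 1 (θseq n), Real.exp (β n * h (J n j ω')) * e n j ω'}).toReal



/-! ### Part A : the stationary walk as a finite average -/

def flipV {n : ℕ} (c : Fin n) (x : V n) : V n := Function.update x c (!x c)

def consP {n : ℕ} (y : V n) (p : ℕ → V n) : ℕ → V n
  | 0 => y
  | i + 1 => p i

def bpath {n : ℕ} : (N : ℕ) → (Fin N → Fin n) → V n → ℕ → V n
  | 0, _, x => fun _ => x
  | N + 1, κ, x => consP (flipV (κ 0) (bpath N (Fin.tail κ) x 0)) (bpath N (Fin.tail κ) x)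

noncomputable def Ew (n N : ℕ) (F : (ℕ → V n) → ℝ) : ℝ :=
  (∑ κ : Fin N → Fin n, ∑ x : V n, F (bpath N κ x)) / ((n : ℝ) ^ N * 2 ^ n)

def IsW {n : ℕ} (p : ℕ → V n) : Prop := ∀ i, hammingDist (p i) (p (i + 1)) ≤ 1

lemma flipV_flipV {n : ℕ} (c : Fin n) (x : V n) : flipV c (flipV c x) = x := by
  unfold flipV
  ext i
  by_cases h : i = c
  · subst h; simp
  · simp [Function.update_of_ne h]

lemma flipV_ne {n : ℕ} (c d : Fin n) (x : V n) (h : d ≠ c) : flipV c x d = x d := by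
  simp [flipV, Function.update_of_ne h]

lemma flipV_same {n : ℕ} (c : Fin n) (x : V n) : flipV c x c = !x c := by
  simp [flipV]

def flipEquiv {n : ℕ} (c : Fin n) : V n ≃ V n :=
  ⟨flipV c, flipV c, flipV_flipV c, flipV_flipV c⟩

lemma hd_flip_eq {n : ℕ} (c : Fin n) (x y : V n) (h : x c = y c) :
    hammingDist (flipV c x) y = hammingDist x y + 1 := by
  unfold hammingDist
  have : (univ.filter fun i => flipV c x i ≠ y i) = insert c (univ.filter fun i => x i ≠ y i) := by
    ext i
    by_cases hi : i = c
    · subst hi; simp [flipV_same, h]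
    · simp [flipV_ne c i x hi, hi]
  rw [this, card_insert_of_notMem (by simp [h])]

lemma hd_flip_ne {n : ℕ} (c : Fin n) (x y : V n) (h : x c ≠ y c) :
    hammingDist x y = hammingDist (flipV c x) y + 1 := by
  have := hd_flip_eq c (flipV c x) y (by
    rw [flipV_same]; revert h; cases x c <;> cases y c <;> simp)
  rwa [flipV_flipV] at this

lemma hd_flip_self {n : ℕ} (c : Fin n) (x : V n) : hammingDist (flipV c x) x = 1 := by
  rw [hd_flip_eq c x x rfl]; simp

lemma hd_le {n : ℕ} (x y : V n) : hammingDist x y ≤ n := by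
  simpa using hammingDist_le_card_fintype (x := x) (y := y)

lemma isW_bpath {n : ℕ} (N : ℕ) (κ : Fin N → Fin n) (x : V n) : IsW (bpath N κ x) := by
  induction N with
  | zero => intro i; simp [bpath]
  | succ N ih =>
    intro i
    cases i with
    | zero => simp only [bpath, consP]; exact (hd_flip_self _ _).le
    | succ i => simp only [bpath, consP]; exact ih _ i

lemma IsW.hd {n : ℕ} {p : ℕ → V n} (h : IsW p) (i j : ℕ) :
    hammingDist (p i) (p (i + j)) ≤ j := by
  induction j with
  | zero => simp
  | succ j ih =>
    calc _ ≤ hammingDist (p i) (p (i + j)) + hammingDist (p (i + j)) (p (i + j + 1)) :=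
          hammingDist_triangle _ _ _
      _ ≤ _ := by have := h (i + j); omega

section Ew
variable {n N : ℕ}

lemma Ew_mono (F G : (ℕ → V n) → ℝ) (h : ∀ p, IsW p → F p ≤ G p) : Ew n N F ≤ Ew n N G := by
  unfold Ew
  gcongr with κ _ x _
  exact h _ (isW_bpath _ _ _)

lemma Ew_congr (F G : (ℕ → V n) → ℝ) (h : ∀ p, IsW p → F p = G p) : Ew n N F = Ew n N G :=
  le_antisymm (Ew_mono _ _ fun p hp => (h p hp).le) (Ew_mono _ _ fun p hp => (h p hp).ge)

lemma Ew_add (F G : (ℕ → V n) → ℝ) : Ew n N (fun p => F p + G p) = Ew n N F + Ew n N G := by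
  simp [Ew, sum_add_distrib, add_div]

lemma Ew_sub (F G : (ℕ → V n) → ℝ) : Ew n N (fun p => F p - G p) = Ew n N F - Ew n N G := by
  simp [Ew, sum_sub_distrib, sub_div]

lemma Ew_mul_left (a : ℝ) (F : (ℕ → V n) → ℝ) : Ew n N (fun p => a * F p) = a * Ew n N F := by
  unfold Ew
  rw [← mul_div_assoc]
  simp only [Finset.mul_sum]

lemma Ew_mul_right (a : ℝ) (F : (ℕ → V n) → ℝ) : Ew n N (fun p => F p * a) = Ew n N F * a := by
  simp_rw [mul_comm _ a]; exact Ew_mul_left a F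

lemma Ew_sum {ι : Type*} (s : Finset ι) (F : ι → (ℕ → V n) → ℝ) :
    Ew n N (fun p => ∑ i ∈ s, F i p) = ∑ i ∈ s, Ew n N (F i) := by
  classical
  induction s using Finset.induction_on with
  | empty => simp [Ew]
  | insert a s ha ih => simp only [sum_insert ha]; rw [Ew_add, ih]

lemma Ew_const (hn : n ≠ 0) (a : ℝ) : Ew n N (fun _ => a) = a := by
  have : (n : ℝ) ≠ 0 := by exact_mod_cast hn
  simp [Ew]
  field_simp

lemma Ew_nonneg (F : (ℕ → V n) → ℝ) (h : ∀ p, IsW p → 0 ≤ F p) : 0 ≤ Ew n N F := by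
  unfold Ew
  exact div_nonneg (sum_nonneg fun κ _ => sum_nonneg fun x _ => h _ (isW_bpath _ _ _)) (by positivity)

lemma Ew_abs_le (F : (ℕ → V n) → ℝ) : |Ew n N F| ≤ Ew n N (fun p => |F p|) := by
  rw [abs_le]
  constructor
  · have := Ew_mono (n := n) (N := N) (fun p => (-1) * |F p|) F
      (fun p _ => by have := neg_abs_le (F p); linarith)
    rw [Ew_mul_left] at this; linarith
  · exact Ew_mono _ _ fun p _ => le_abs_self _

lemma Ew_succ (F : (ℕ → V n) → ℝ) :
    Ew n (N + 1) F = (∑ c : Fin n, Ew n N (fun p => F (consP (flipV c (p 0)) p))) / n := by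
  unfold Ew
  rw [← (Fin.consEquiv (fun _ => Fin n)).sum_comp, Fintype.sum_prod_type]
  simp only [bpath]
  rw [← sum_div, div_div]
  congr 1
  rw [pow_succ]; ring

/-- dependence on the first coordinates only -/
def DepLe (N : ℕ) (F : (ℕ → V n) → ℝ) : Prop :=
  ∀ p q : ℕ → V n, (∀ i ≤ N, p i = q i) → F p = F q

def shiftP (a : ℕ) (p : ℕ → V n) : ℕ → V n := fun i => p (i + a)

lemma Ew_shift_one (hn : n ≠ 0) (F : (ℕ → V n) → ℝ) :
    Ew n (N + 1) (fun p => F (shiftP 1 p)) = Ew n N F := by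
  rw [Ew_succ]
  have : (n : ℝ) ≠ 0 := by exact_mod_cast hn
  have h : ∀ (c : Fin n) (p : ℕ → V n), shiftP 1 (consP (flipV c (p 0)) p) = p := by
    intro c p; funext i; simp [shiftP, consP]
  simp [h]
  field_simp

lemma Ew_shift (hn : n ≠ 0) (a : ℕ) (F : (ℕ → V n) → ℝ) :
    Ew n (N + a) (fun p => F (shiftP a p)) = Ew n N F := by
  induction a with
  | zero => rfl
  | succ a ih =>
    have h1 := Ew_shift_one (N := N + a) hn (fun p => F (shiftP a p))
    rw [← ih, ← h1]
    have : ∀ p : ℕ → V n, shiftP a (shiftP 1 p) = shiftP (a + 1) p := by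
      intro p; funext i; simp only [shiftP]; congr 1
    simp only [this]; rfl

lemma Ew_zero_coord (hn : n ≠ 0) (F : V n → ℝ) :
    Ew n N (fun p => F (p 0)) = (∑ x, F x) / 2 ^ n := by
  have hn' : (n : ℝ) ≠ 0 := by exact_mod_cast hn
  induction N generalizing F with
  | zero => simp [Ew, bpath]
  | succ N ih =>
    rw [Ew_succ]
    simp only [consP]
    have : ∀ c : Fin n, Ew n N (fun p => F (flipV c (p 0))) = (∑ x, F x) / 2 ^ n := by
      intro c
      rw [ih (fun x => F (flipV c x))]
      congr 1
      exact (flipEquiv c).sum_comp F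
    simp [this]
    field_simp

lemma Ew_init_one (hn : n ≠ 0) (F : (ℕ → V n) → ℝ) (hF : DepLe N F) :
    Ew n (N + 1) F = Ew n N F := by
  induction N generalizing F with
  | zero =>
    have : F = fun p => (fun x => F (fun _ => x)) (p 0) := by
      funext p; exact hF _ _ (by intro i hi; simp at hi; simp [hi])
    rw [this]
    exact (Ew_zero_coord hn (fun x => F fun _ => x)).trans
      (Ew_zero_coord hn (fun x => F fun _ => x)).symm
  | succ N ih =>
    rw [Ew_succ, Ew_succ (N := N)]
    congr 1
    refine sum_congr rfl fun c _ => ih _ ?_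
    intro p q hpq
    apply hF
    intro i hi
    cases i with
    | zero => simp [consP, hpq 0 (by omega)]
    | succ i => simp [consP, hpq i (by omega)]

lemma Ew_init (hn : n ≠ 0) (F : (ℕ → V n) → ℝ) (k : ℕ) (hF : DepLe N F) :
    Ew n (N + k) F = Ew n N F := by
  induction k with
  | zero => rfl
  | succ k ih =>
    rw [← ih, ← add_assoc, Ew_init_one hn]
    intro p q h; exact hF p q fun i hi => h i (by omega)

/-- Stationarity. -/
lemma Ew_stat (hn : n ≠ 0) (F : (ℕ → V n) → ℝ) (m a N : ℕ) (h : a + m ≤ N) (hF : DepLe m F) :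
    Ew n N (fun p => F (shiftP a p)) = Ew n m F := by
  obtain ⟨k, rfl⟩ := Nat.exists_eq_add_of_le h
  rw [show a + m + k = (m + k) + a by ring, Ew_shift hn, Ew_init hn _ _ hF]

end Ew


/-! ### Part B : Gaussian vectors -/

structure GV {Ω : Type*} [MeasurableSpace Ω] (P : Measure Ω) {I : Type*} [Fintype I]
    (X : I → Ω → ℝ) (Δ : I → I → ℝ) : Prop where
  meas : ∀ i, Measurable (X i)
  law : HasGaussianLaw (fun ω i => X i ω) P
  mean : ∀ i, ∫ ω, X i ω ∂P = 0
  cov : ∀ i j, ∫ ω, X i ω * X j ω ∂P = Δ i j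

section GV
variable {Ω : Type*} [MeasurableSpace Ω] {P : Measure Ω} [IsProbabilityMeasure P]
  {I J K : Type*} [Fintype I] [Fintype J] [Fintype K] {X : I → Ω → ℝ} {Δ : I → I → ℝ}


lemma GV.congr {Δ' : I → I → ℝ} (h : GV P X Δ) (h' : ∀ i j, Δ i j = Δ' i j) : GV P X Δ' :=
  ⟨h.meas, h.law, h.mean, fun i j => (h.cov i j).trans (h' i j)⟩


lemma GV.memLp (h : GV P X Δ) (i : I) : MemLp (X i) 2 P := by
  exact (HasGaussianLaw.eval (X := X) h.law i).memLp_two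


lemma GV.intX (h : GV P X Δ) (i : I) : Integrable (X i) P :=
  (h.memLp i).integrable (by norm_num)


lemma GV.intMul (h : GV P X Δ) (i j : I) : Integrable (fun ω => X i ω * X j ω) P :=
  (h.memLp i).integrable_mul (h.memLp j)

lemma GV.lin (h : GV P X Δ) (M : J → I → ℝ) :
    GV P (fun j ω => ∑ i, M j i * X i ω) (fun j j' => ∑ i, ∑ i', M j i * M j' i' * Δ i i') where
  meas j := Finset.measurable_sum _ fun i _ => (h.meas i).const_mul _
  law := by
    have := h.law.map_fun (LinearMap.toContinuousLinearMap (Matrix.mulVecLin (Matrix.of M)))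
    refine this.congr (ae_of_all _ fun ω => ?_)
    funext j
    simp [Matrix.mulVec, dotProduct]
  mean j := by
    rw [integral_finsetSum _ fun i _ => (h.intX i).const_mul _]
    simp [integral_const_mul, h.mean]
  cov j j' := by
    have hi : ∀ i i', Integrable (fun ω => M j i * X i ω * (M j' i' * X i' ω)) P := by
      intro i i'
      have := (h.intMul i i').const_mul (M j i * M j' i')
      refine this.congr (ae_of_all _ fun ω => ?_)
      simp; ring
    simp_rw [Finset.sum_mul_sum]
    rw [integral_finsetSum _ fun i _ => integrable_finsetSum _ fun i' _ => hi i i']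
    refine sum_congr rfl fun i _ => ?_
    rw [integral_finsetSum _ fun i' _ => hi i i']
    refine sum_congr rfl fun i' _ => ?_
    rw [← h.cov i i', ← integral_const_mul]
    congr 1; funext ω; ring

lemma GV.reindex (h : GV P X Δ) (f : J → I) : GV P (fun j => X (f j)) (fun j j' => Δ (f j) (f j')) where
  meas j := h.meas _
  law := by
    have := h.law.map_fun (ContinuousLinearMap.pi fun j : J =>
      ContinuousLinearMap.proj (R := ℝ) (φ := fun _ : I => ℝ) (f j))
    exact this
  mean j := h.mean _
  cov j j' := h.cov _ _


lemma GV.map_eq (h : GV P X Δ) (i : I) :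
    P.map (X i) = gaussianReal 0 (Real.toNNReal (Δ i i)) := by
  have h1 := (HasGaussianLaw.eval (X := X) h.law i).map_eq_gaussianReal
  rw [h1, h.mean i, variance_of_integral_eq_zero (h.meas i).aemeasurable (h.mean i), ← h.cov i i]
  congr 2; congr 1; funext ω; exact sq _

lemma GV.diag_nonneg (h : GV P X Δ) (i : I) : 0 ≤ Δ i i := by
  rw [← h.cov i i]; exact integral_nonneg fun ω => mul_self_nonneg _

lemma GV.int_exp (h : GV P X Δ) (i : I) (s : ℝ) : Integrable (fun ω => exp (s * X i ω)) P := by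
  have := integrable_exp_mul_gaussianReal (μ := 0) (v := Real.toNNReal (Δ i i)) s
  rw [← h.map_eq i] at this
  exact this.comp_measurable (h.meas i)

lemma GV.exp_eq (h : GV P X Δ) (i : I) (s : ℝ) :
    ∫ ω, exp (s * X i ω) ∂P = exp (s ^ 2 * Δ i i / 2) := by
  have := mgf_gaussianReal (h.map_eq i) s
  rw [mgf] at this
  rw [this, Real.coe_toNNReal _ (h.diag_nonneg i)]
  congr 1; ring

/-- exponential of a linear combination -/
lemma GV.int_exp_lin (h : GV P X Δ) (a : I → ℝ) :
    Integrable (fun ω => exp (∑ i, a i * X i ω)) P := by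
  have := (h.lin (fun _ : Unit => a)).int_exp () 1
  simpa using this

lemma GV.exp_lin (h : GV P X Δ) (a : I → ℝ) :
    ∫ ω, exp (∑ i, a i * X i ω) ∂P = exp ((∑ i, ∑ j, a i * a j * Δ i j) / 2) := by
  have := (h.lin (fun _ : Unit => a)).exp_eq () 1
  simpa using this


lemma GV.indep {Y : J → Ω → ℝ} {Z : K → Ω → ℝ} {Δ' : J ⊕ K → J ⊕ K → ℝ}
    (h : GV P (Sum.elim Y Z) Δ') (h0 : ∀ j k, Δ' (Sum.inl j) (Sum.inr k) = 0) :
    IndepFun (fun ω j => Y j ω) (fun ω k => Z k ω) P := by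
  refine HasGaussianLaw.indepFun_of_covariance_eval (X := Y) (Y := Z) ?_ ?_
  · have := h.law.map_fun (ContinuousLinearMap.prod
      (ContinuousLinearMap.pi fun j : J =>
        ContinuousLinearMap.proj (R := ℝ) (φ := fun _ : J ⊕ K => ℝ) (Sum.inl j))
      (ContinuousLinearMap.pi fun k : K =>
        ContinuousLinearMap.proj (R := ℝ) (φ := fun _ : J ⊕ K => ℝ) (Sum.inr k)))
    exact this
  · intro j k
    have h1 := h.memLp (Sum.inl j)
    have h2 := h.memLp (Sum.inr k)
    simp only [Sum.elim_inl, Sum.elim_inr] at h1 h2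
    rw [covariance_eq_sub h1 h2]
    have e1 := h.mean (Sum.inl j)
    have e3 := h.cov (Sum.inl j) (Sum.inr k)
    simp only [Sum.elim_inl, Sum.elim_inr] at e1 e3
    simp only [e1, zero_mul, sub_zero]
    rw [h0] at e3
    exact e3

/-- from the frozen notion -/
lemma GV.of_cgv (hm : ∀ i, Measurable (X i)) (h : IsCenteredGaussianVector P X Δ)
    (hs : ∀ i j, Δ i j = Δ j i) (hpos : ∀ c : I → ℝ, 0 ≤ ∑ i, ∑ j, c i * c j * Δ i j) :
    GV P X Δ := by
  classical
  have hlaw : HasGaussianLaw (fun ω i => X i ω) P := by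
    constructor
    refine isGaussian_of_map_eq_gaussianReal fun L => ⟨0, Real.toNNReal (∑ i, ∑ j, L (Pi.single i 1) * L (Pi.single j 1) * Δ i j), ?_⟩
    · rw [Measure.map_map (by fun_prop) (measurable_pi_lambda _ hm)]
      have : (⇑L ∘ fun ω i => X i ω) = fun ω => ∑ i, L (Pi.single i 1) * X i ω := by
        funext ω
        simp only [Function.comp]
        conv_lhs => rw [← Finset.univ_sum_single (fun i => X i ω)]
        rw [map_sum]
        refine sum_congr rfl fun i _ => ?_
        have : (Pi.single i (X i ω) : I → ℝ) = (X i ω) • Pi.single i 1 := by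
          rw [← Pi.single_smul]; simp
        rw [this, map_smul]; simp [mul_comm]
      rw [this]
      exact h _
  have hL2 : ∀ i, MemLp (X i) 2 P := fun i => (HasGaussianLaw.eval (X := X) hlaw i).memLp_two
  have hsum : ∀ c : I → ℝ, Measurable (fun ω => ∑ i, c i * X i ω) := fun c =>
    Finset.measurable_sum _ fun i _ => (hm i).const_mul _
  have hmean : ∀ c : I → ℝ, ∫ ω, ∑ i, c i * X i ω ∂P = 0 := by
    intro c
    have := integral_map (μ := P) (hsum c).aemeasurable (f := fun x : ℝ => x) (by fun_prop)
    rw [← this, h c, integral_id_gaussianReal]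
  have hmean' : ∀ i, ∫ ω, X i ω ∂P = 0 := by
    intro i
    have := hmean (Pi.single i 1)
    simpa [Pi.single_apply] using this
  have hvar : ∀ c : I → ℝ, ∫ ω, (∑ i, c i * X i ω) ^ 2 ∂P = ∑ i, ∑ j, c i * c j * Δ i j := by
    intro c
    have h1 : Var[fun ω => ∑ i, c i * X i ω; P] = ∑ i, ∑ j, c i * c j * Δ i j := by
      have := variance_map (μ := P) (X := fun x : ℝ => x) (Y := fun ω => ∑ i, c i * X i ω) (by fun_prop)
        (hsum c).aemeasurable
      rw [h c, variance_fun_id_gaussianReal, Real.coe_toNNReal _ (hpos c)] at this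
      rw [this]; rfl
    rw [← h1, variance_of_integral_eq_zero (hsum c).aemeasurable (hmean c)]
  refine ⟨hm, hlaw, hmean', fun i j => ?_⟩
  have hInt : ∀ i j, Integrable (fun ω => X i ω * X j ω) P := fun i j => (hL2 i).integrable_mul (hL2 j)
  have e1 : ∀ i, ∫ ω, X i ω * X i ω ∂P = Δ i i := by
    intro i
    have := hvar (Pi.single i 1)
    simpa [Pi.single_apply, sq] using this
  have e2 := hvar (Pi.single i 1 + Pi.single j 1)
  have e3 : ∀ ω, ∑ k, (Pi.single i 1 + Pi.single j 1 : I → ℝ) k * X k ω = X i ω + X j ω := by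
    intro ω; simp [Pi.single_apply, add_mul, sum_add_distrib]
  simp only [e3] at e2
  have e4 : ∑ k, ∑ l, (Pi.single i 1 + Pi.single j 1 : I → ℝ) k * (Pi.single i 1 + Pi.single j 1 : I → ℝ) l * Δ k l
      = Δ i i + Δ i j + Δ j i + Δ j j := by
    simp [Pi.single_apply, add_mul, mul_add, sum_add_distrib, Finset.sum_ite_eq]
    ring
  rw [e4] at e2
  have e5 : ∫ ω, (X i ω + X j ω) ^ 2 ∂P = ∫ ω, X i ω * X i ω ∂P + 2 * ∫ ω, X i ω * X j ω ∂P
      + ∫ ω, X j ω * X j ω ∂P := by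
    have hh : Integrable (fun ω => X i ω * X i ω + 2 * (X i ω * X j ω)) P :=
      (hInt i i).add ((hInt i j).const_mul 2)
    rw [← integral_const_mul, ← integral_add (hInt i i) ((hInt i j).const_mul 2),
      ← integral_add hh (hInt j j)]
    congr 1; funext ω; ring
  rw [e5, e1, e1, hs j i] at e2
  linarith

end GV


/-! ### Part B2 : the overlap and the Hamiltonian -/

def sg {n : ℕ} (x : V n) (c : Fin n) : ℝ := if x c then 1 else -1

lemma sg_sq {n : ℕ} (x : V n) (c : Fin n) : sg x c * sg x c = 1 := by
  unfold sg; split_ifs <;> norm_num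

lemma overlap_eq {n : ℕ} (hn : n ≠ 0) (x y : V n) :
    overlap n x y = (∑ c, sg x c * sg y c) / n := by
  have hn' : (n : ℝ) ≠ 0 := by exact_mod_cast hn
  have h1 : (hammingDist x y : ℝ) = ∑ c, (if x c ≠ y c then (1 : ℝ) else 0) := by
    unfold hammingDist
    rw [Finset.card_filter]
    push_cast
    rfl
  have h2 : ∀ c, sg x c * sg y c = 1 - 2 * (if x c ≠ y c then (1 : ℝ) else 0) := by
    intro c; unfold sg; cases x c <;> cases y c <;> norm_num
  unfold overlap
  rw [h1]
  simp_rw [h2, sum_sub_distrib, ← mul_sum]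
  simp
  field_simp

lemma overlap_comm {n : ℕ} (x y : V n) : overlap n x y = overlap n y x := by
  unfold overlap; rw [hammingDist_comm]

lemma overlap_self {n : ℕ} (x : V n) : overlap n x x = 1 := by
  simp [overlap]

lemma overlap_le_one {n : ℕ} (x y : V n) : overlap n x y ≤ 1 := by
  unfold overlap
  have : 0 ≤ 2 * (hammingDist x y : ℝ) / n := by positivity
  linarith

lemma neg_one_le_overlap {n : ℕ} (x y : V n) : -1 ≤ overlap n x y := by
  unfold overlap
  have h : (hammingDist x y : ℝ) ≤ n := by exact_mod_cast hd_le x y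
  have : 2 * (hammingDist x y : ℝ) / n ≤ 2 := div_le_of_le_mul₀ (by positivity) (by norm_num) (by linarith)
  linarith

lemma abs_overlap_le {n : ℕ} (x y : V n) : |overlap n x y| ≤ 1 :=
  abs_le.mpr ⟨neg_one_le_overlap x y, overlap_le_one x y⟩

noncomputable def rho (p n : ℕ) (x y : V n) : ℝ := overlap n x y ^ p

lemma rho_self (p n : ℕ) (x : V n) : rho p n x x = 1 := by simp [rho, overlap_self]
lemma rho_comm (p n : ℕ) (x y : V n) : rho p n x y = rho p n y x := by
  unfold rho; rw [overlap_comm]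
lemma abs_rho_le (p n : ℕ) (x y : V n) : |rho p n x y| ≤ 1 := by
  unfold rho; rw [abs_pow]; exact pow_le_one₀ (abs_nonneg _) (abs_overlap_le _ _)
lemma rho_le_one (p n : ℕ) (x y : V n) : rho p n x y ≤ 1 := (abs_le.mp (abs_rho_le p n x y)).2

lemma rho_psd {n : ℕ} (p : ℕ) (hn : n ≠ 0) (a : V n → ℝ) :
    0 ≤ ∑ x, ∑ y, a x * a y * ((n : ℝ) * overlap n x y ^ p) := by
  have h : ∀ x y : V n, a x * a y * ((n : ℝ) * overlap n x y ^ p)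
      = (n / n ^ p : ℝ) * ∑ κ : Fin p → Fin n, (a x * ∏ l, sg x (κ l)) * (a y * ∏ l, sg y (κ l)) := by
    intro x y
    have h1 : overlap n x y ^ p = (∑ κ : Fin p → Fin n, ∏ l, (sg x (κ l) * sg y (κ l))) / n ^ p := by
      rw [overlap_eq hn, div_pow]
      congr 1
      rw [← Fin.prod_const, Finset.prod_univ_sum]
      simp
    rw [h1]
    have : ∀ κ : Fin p → Fin n, (a x * ∏ l, sg x (κ l)) * (a y * ∏ l, sg y (κ l))
       = (a x * a y) * ∏ l, (sg x (κ l) * sg y (κ l)) := by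
      intro κ; rw [prod_mul_distrib]; ring
    simp_rw [this, ← mul_sum]
    ring
  simp_rw [h, ← mul_sum]
  apply mul_nonneg (by positivity)
  have : ∑ x : V n, ∑ y : V n, ∑ κ : Fin p → Fin n, (a x * ∏ l, sg x (κ l)) * (a y * ∏ l, sg y (κ l))
     = ∑ κ : Fin p → Fin n, (∑ x, a x * ∏ l, sg x (κ l)) ^ 2 := by
    simp_rw [sq, sum_mul_sum]
    rw [sum_comm (s := (univ : Finset (Fin p → Fin n)))]
    refine sum_congr rfl fun x _ => ?_
    rw [sum_comm]
  rw [this]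
  exact sum_nonneg fun κ _ => sq_nonneg _

/-- one dimensional tilting -/
lemma gauss_tilt (v : NNReal) (hv : v ≠ 0) (l : ℝ) (f : ℝ → ENNReal) (hf : Measurable f) :
    ∫⁻ s, ENNReal.ofReal (exp (l * s)) * f s ∂(gaussianReal 0 v)
      = ENNReal.ofReal (exp (l ^ 2 * v / 2)) * ∫⁻ s, f (s + l * v) ∂(gaussianReal 0 v) := by
  have h1 : ∫⁻ s, f (s + l * v) ∂(gaussianReal 0 v) = ∫⁻ s, f s ∂(gaussianReal (l * v) v) := by
    have := gaussianReal_map_add_const (μ := 0) (v := v) (l * v)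
    rw [zero_add] at this
    rw [← this, lintegral_map hf (by fun_prop)]
  rw [h1, gaussianReal_of_var_ne_zero _ hv, gaussianReal_of_var_ne_zero _ hv,
    lintegral_withDensity_eq_lintegral_mul _ (measurable_gaussianPDF _ _) (by fun_prop),
    lintegral_withDensity_eq_lintegral_mul _ (measurable_gaussianPDF _ _) (by fun_prop),
    ← lintegral_const_mul _ (by fun_prop)]
  congr 1; funext s
  simp only [Pi.mul_apply, gaussianPDF]
  rw [← mul_assoc, ← mul_assoc, ← ENNReal.ofReal_mul (gaussianPDFReal_nonneg _ _ _),
    ← ENNReal.ofReal_mul (exp_pos _).le]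
  congr 2
  have hv' : (v : ℝ) ≠ 0 := by exact_mod_cast hv
  unfold gaussianPDFReal
  rw [mul_assoc, ← exp_add, mul_left_comm, ← exp_add]
  congr 2
  field_simp
  ring

section Field
variable {Ω : Type*} [MeasurableSpace Ω] {P : Measure Ω} [IsProbabilityMeasure P]
  {n p : ℕ} {H : V n → Ω → ℝ}

/-- the conditional field given the value at `x0` -/
noncomputable def Gf (p : ℕ) {n : ℕ} (x0 : V n) (h : V n → ℝ) : V n → ℝ :=
  fun x => h x - rho p n x0 x * h x0

lemma meas_Gf (x0 : V n) : Measurable (Gf p x0) := by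
  unfold Gf; fun_prop

lemma meas_field (hm : ∀ x, Measurable (H x)) : Measurable (fun ω x => H x ω) :=
  measurable_pi_lambda _ hm

lemma dec_field (hG : GV P H (fun x y => (n : ℝ) * overlap n x y ^ p)) (x0 : V n)
    (F : ℝ → (V n → ℝ) → ENNReal) (hF : Measurable (Function.uncurry F)) :
    ∫⁻ ω, F (H x0 ω) (Gf p x0 (fun x => H x ω)) ∂P
      = ∫⁻ s, ∫⁻ ω, F s (Gf p x0 (fun x => H x ω)) ∂P ∂(gaussianReal 0 (n : NNReal)) := by
  classical
  have h1 := hG.lin (J := Unit ⊕ V n) (Sum.elim (fun _ => Pi.single x0 1)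
    (fun x => Pi.single x 1 - rho p n x0 x • Pi.single x0 1))
  have e : (fun (j : Unit ⊕ V n) ω => ∑ i, (Sum.elim (fun _ => Pi.single x0 1)
    (fun x => Pi.single x 1 - rho p n x0 x • Pi.single x0 1) : Unit ⊕ V n → V n → ℝ) j i * H i ω) =
    Sum.elim (fun _ : Unit => H x0) (fun x ω => Gf p x0 (fun x => H x ω) x) := by
    funext j ω
    rcases j with j | x
    · simp [Pi.single_apply]
    · simp [Gf, Pi.single_apply, sub_mul, sum_sub_distrib]
  rw [e] at h1
  have hind := h1.indep (fun j k => by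
    simp only [Sum.elim_inl, Sum.elim_inr, Pi.sub_apply, Pi.smul_apply, smul_eq_mul, Pi.single_apply]
    simp [mul_sub, sub_mul, sum_sub_distrib, overlap_self, rho]
    ring)
  have hm0 : Measurable (fun ω (_ : Unit) => H x0 ω) := measurable_pi_lambda _ fun _ => hG.meas x0
  have hm1 : Measurable (fun ω => Gf p x0 (fun x => H x ω)) :=
    (meas_Gf x0).comp (meas_field hG.meas)
  have hind2 : IndepFun (H x0) (fun ω => Gf p x0 (fun x => H x ω)) P :=
    hind.comp (φ := fun f : Unit → ℝ => f ()) (ψ := fun g => g) (by fun_prop) (by fun_prop)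
  have hmap := (indepFun_iff_map_prod_eq_prod_map_map (hG.meas x0).aemeasurable hm1.aemeasurable).mp hind2
  have hlaw : P.map (H x0) = gaussianReal 0 (n : NNReal) := by
    rw [hG.map_eq x0]; simp [overlap_self]
  have := lintegral_map (μ := P) hF ((hG.meas x0).prodMk hm1)
  simp only [Function.uncurry] at this
  rw [← this, hmap, lintegral_prod (fun a : ℝ × (V n → ℝ) => F a.1 a.2) hF.aemeasurable, hlaw]
  congr 1; funext s
  exact lintegral_map (f := fun y => F s y)
    (hF.comp ((measurable_const (a := s)).prodMk measurable_id)) hm1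

lemma girsanov_l (hn : n ≠ 0) (hG : GV P H (fun x y => (n : ℝ) * overlap n x y ^ p)) (x0 : V n)
    (l : ℝ) (F : (V n → ℝ) → ENNReal) (hF : Measurable F) :
    ∫⁻ ω, ENNReal.ofReal (exp (l * H x0 ω)) * F (fun x => H x ω) ∂P
      = ENNReal.ofReal (exp (l ^ 2 * n / 2)) *
        ∫⁻ ω, F (fun x => H x ω + l * n * rho p n x0 x) ∂P := by
  have hm1 : Measurable (fun ω => Gf p x0 (fun x => H x ω)) :=
    (meas_Gf x0).comp (meas_field hG.meas)
  have hA : Measurable (fun q : ℝ × (V n → ℝ) => F (fun x => rho p n x0 x * q.1 + q.2 x)) := by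
    apply hF.comp; fun_prop
  have h1 := dec_field hG x0 (fun s g => ENNReal.ofReal (exp (l * s)) * F (fun x => rho p n x0 x * s + g x))
    (by
      apply Measurable.mul (by fun_prop) hA)
  have h2 := dec_field hG x0 (fun s g => F (fun x => rho p n x0 x * (s + l * n) + g x))
    (by
      have : Measurable (fun q : ℝ × (V n → ℝ) => (q.1 + l * n, q.2)) := by fun_prop
      exact hA.comp this)
  have e1 : ∀ ω, (fun x => rho p n x0 x * H x0 ω + Gf p x0 (fun x => H x ω) x) = fun x => H x ω := by
    intro ω; funext x; simp [Gf]
  have e2 : ∀ ω, (fun x => rho p n x0 x * (H x0 ω + l * n) + Gf p x0 (fun x => H x ω) x)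
      = fun x => H x ω + l * n * rho p n x0 x := by
    intro ω; funext x; simp [Gf]; ring
  simp only [e1, e2] at h1 h2
  rw [h1, h2]
  have hin : Measurable (fun s => ∫⁻ ω, F (fun x => rho p n x0 x * s + Gf p x0 (fun x => H x ω) x) ∂P) := by
    apply Measurable.lintegral_prod_right'
      (f := fun q : ℝ × Ω => F (fun x => rho p n x0 x * q.1 + Gf p x0 (fun x => H x q.2) x))
    exact hA.comp (measurable_fst.prodMk (hm1.comp measurable_snd))
  have h3 := gauss_tilt (n : NNReal) (by exact_mod_cast hn) l _ hin
  simp only [NNReal.coe_natCast] at h3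
  rw [← h3]
  congr 1; funext s
  rw [lintegral_const_mul]
  exact hA.comp (measurable_const.prodMk hm1)

lemma girsanov (hn : n ≠ 0) (hG : GV P H (fun x y => (n : ℝ) * overlap n x y ^ p)) (x0 : V n)
    (l : ℝ) (f : (V n → ℝ) → ℝ) (hf : Measurable f) (hf0 : ∀ h, 0 ≤ f h) :
    ∫ ω, exp (l * H x0 ω) * f (fun x => H x ω) ∂P
      = exp (l ^ 2 * n / 2) * ∫ ω, f (fun x => H x ω + l * n * rho p n x0 x) ∂P := by
  have hmf := meas_field hG.meas
  rw [integral_eq_lintegral_of_nonneg_ae (ae_of_all _ fun ω => by have := hf0 (fun x => H x ω); positivity),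
    integral_eq_lintegral_of_nonneg_ae (ae_of_all _ fun ω => hf0 _)]
  · have := girsanov_l hn hG x0 l (fun h => ENNReal.ofReal (f h)) (by fun_prop)
    simp_rw [ENNReal.ofReal_mul (exp_pos _).le]
    rw [this, ENNReal.toReal_mul, ENNReal.toReal_ofReal (exp_pos _).le]
  · have : Measurable (fun ω => fun x => H x ω + l * n * rho p n x0 x) :=
      measurable_pi_lambda _ fun x => (hG.meas x).add_const _
    exact (hf.comp this).aestronglyMeasurable
  · have := hG.meas x0
    exact (Measurable.mul (by fun_prop) (hf.comp hmf)).aestronglyMeasurable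

end Field


/-! ### Part C : maxima and the Laplace functional -/

noncomputable def mx : ℕ → (ℕ → ℝ) → ℝ
  | 0, f => f 0
  | k + 1, f => max (f 0) (mx k (fun i => f (i + 1)))

lemma mx_spec (k : ℕ) (f : ℕ → ℝ) : (∀ i ≤ k, f i ≤ mx k f) ∧ ∃ i ≤ k, mx k f = f i := by
  induction k generalizing f with
  | zero => exact ⟨fun i hi => by simp at hi; simp [mx, hi], 0, le_rfl, rfl⟩
  | succ k ih =>
    obtain ⟨h1, j, hj, h2⟩ := ih (fun i => f (i + 1))
    constructor
    · intro i hi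
      cases i with
      | zero => exact le_max_left _ _
      | succ i => exact (h1 i (by omega)).trans (le_max_right _ _)
    · rcases max_choice (f 0) (mx k (fun i => f (i + 1))) with h | h
      · exact ⟨0, by omega, h⟩
      · exact ⟨j + 1, by omega, by simp only [mx]; rw [h, h2]⟩

lemma le_mx {k i : ℕ} (f : ℕ → ℝ) (h : i ≤ k) : f i ≤ mx k f := (mx_spec k f).1 i h

lemma mx_ex (k : ℕ) (f : ℕ → ℝ) : ∃ i ≤ k, mx k f = f i := (mx_spec k f).2

lemma mx_le {k : ℕ} {f : ℕ → ℝ} {a : ℝ} (h : ∀ i ≤ k, f i ≤ a) : mx k f ≤ a := by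
  obtain ⟨i, hi, h2⟩ := mx_ex k f
  rw [h2]; exact h i hi

lemma lt_mx_iff {k : ℕ} {f : ℕ → ℝ} {a : ℝ} : a < mx k f ↔ ∃ i ≤ k, a < f i := by
  constructor
  · intro h
    obtain ⟨i, hi, h2⟩ := mx_ex k f
    exact ⟨i, hi, h2 ▸ h⟩
  · rintro ⟨i, hi, h⟩; exact h.trans_le (le_mx f hi)

lemma mx_congr {k : ℕ} {f g : ℕ → ℝ} (h : ∀ i ≤ k, f i = g i) : mx k f = mx k g :=
  le_antisymm (mx_le fun i hi => by rw [h i hi]; exact le_mx g hi)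
    (mx_le fun i hi => by rw [← h i hi]; exact le_mx f hi)

lemma mx_add_const (k : ℕ) (f : ℕ → ℝ) (a : ℝ) : mx k (fun i => f i + a) = mx k f + a := by
  apply le_antisymm
  · exact mx_le fun i hi => by have := le_mx f hi; linarith
  · obtain ⟨i, hi, h2⟩ := mx_ex k f
    rw [h2]; exact le_mx (fun i => f i + a) hi

lemma mx_le_add {k : ℕ} {f g : ℕ → ℝ} {e : ℝ} (h : ∀ i ≤ k, f i ≤ g i + e) : mx k f ≤ mx k g + e :=
  mx_le fun i hi => (h i hi).trans (by have := le_mx g hi; linarith)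

lemma mx_abs_sub {k : ℕ} {f g : ℕ → ℝ} {e : ℝ} (h : ∀ i ≤ k, |f i - g i| ≤ e) :
    |mx k f - mx k g| ≤ e := by
  rw [abs_le]
  constructor
  · have := mx_le_add (k := k) (f := g) (g := f) (e := e) fun i hi => by
      have := (abs_le.mp (h i hi)).1; linarith
    linarith
  · have := mx_le_add (k := k) (f := f) (g := g) (e := e) fun i hi => by
      have := (abs_le.mp (h i hi)).2; linarith
    linarith

lemma abs_mx_le (k : ℕ) (f : ℕ → ℝ) : |mx k f| ≤ ∑ i ∈ range (k + 1), |f i| := by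
  obtain ⟨i, hi, h2⟩ := mx_ex k f
  rw [h2]
  exact single_le_sum (f := fun i => |f i|) (fun _ _ => abs_nonneg _) (by simp; omega)

lemma exp_mx_le (k : ℕ) (f : ℕ → ℝ) (l : ℝ) :
    exp (l * mx k f) ≤ ∑ i ∈ range (k + 1), exp (l * f i) := by
  obtain ⟨i, hi, h2⟩ := mx_ex k f
  rw [h2]
  exact single_le_sum (f := fun i => exp (l * f i)) (fun _ _ => (exp_pos _).le) (by simp; omega)

lemma measurable_mx {α : Type*} [MeasurableSpace α] (k : ℕ) (f : ℕ → α → ℝ) (hf : ∀ i, Measurable (f i)) :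
    Measurable (fun a => mx k (fun i => f i a)) := by
  induction k generalizing f with
  | zero => exact hf 0
  | succ k ih => exact (hf 0).max (ih (fun i => f (i + 1)) fun i => hf _)

/-! polynomial estimate -/

lemma pow_sub_pow_le_one {x y : ℝ} (hx : |x| ≤ 1) (hy : |y| ≤ 1) (p : ℕ) :
    |x ^ p - y ^ p| ≤ p * |x - y| := by
  induction p with
  | zero => simp
  | succ p ih =>
    have : x ^ (p + 1) - y ^ (p + 1) = x * (x ^ p - y ^ p) + y ^ p * (x - y) := by ring
    rw [this]
    have hyp : |y ^ p| ≤ 1 := by rw [abs_pow]; exact pow_le_one₀ (abs_nonneg _) hy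
    calc _ ≤ |x * (x ^ p - y ^ p)| + |y ^ p * (x - y)| := abs_add_le _ _
      _ = |x| * |x ^ p - y ^ p| + |y ^ p| * |x - y| := by rw [abs_mul, abs_mul]
      _ ≤ 1 * (p * |x - y|) + 1 * |x - y| := by gcongr
      _ = _ := by push_cast; ring

lemma second_diff {x h : ℝ} (hx : |x| ≤ 1) (h0 : 0 ≤ h) (h2 : |x - h| ≤ 1) (h3 : |1 - h| ≤ 1) (p : ℕ) :
    |1 - x ^ p - (1 - h) ^ p + (x - h) ^ p| ≤ p ^ 2 * (h * (1 - x)) := by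
  have hx1 : 0 ≤ 1 - x := by have := (abs_le.mp hx).2; linarith
  induction p with
  | zero => simp
  | succ p ih =>
    -- D_{p+1} = (1-h) D_p + ...
    have : 1 - x ^ (p + 1) - (1 - h) ^ (p + 1) + (x - h) ^ (p + 1)
      = x * (1 - x ^ p - (1 - h) ^ p + (x - h) ^ p) + (1 - x) * (1 - (1 - h) ^ p)
        + h * ((1 - h) ^ p - (x - h) ^ p) := by ring
    rw [this]
    have e1 : |1 - (1 - h) ^ p| ≤ p * h := by
      have := pow_sub_pow_le_one (x := 1) (y := 1 - h) (by simp) h3 p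
      simpa [abs_of_nonneg h0] using this
    have e2 : |(1 - h) ^ p - (x - h) ^ p| ≤ p * (1 - x) := by
      have := pow_sub_pow_le_one h3 h2 p
      rwa [show 1 - h - (x - h) = 1 - x by ring, abs_of_nonneg hx1] at this
    calc _ ≤ |x * (1 - x ^ p - (1 - h) ^ p + (x - h) ^ p)| + |(1 - x) * (1 - (1 - h) ^ p)|
        + |h * ((1 - h) ^ p - (x - h) ^ p)| := abs_add_three _ _ _
      _ = |x| * |1 - x ^ p - (1 - h) ^ p + (x - h) ^ p| + (1 - x) * |1 - (1 - h) ^ p|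
        + h * |(1 - h) ^ p - (x - h) ^ p| := by
          rw [abs_mul, abs_mul, abs_mul, abs_of_nonneg hx1, abs_of_nonneg h0]
      _ ≤ 1 * (p ^ 2 * (h * (1 - x))) + (1 - x) * (p * h) + h * (p * (1 - x)) := by gcongr
      _ ≤ _ := by
        push_cast
        have : 0 ≤ h * (1 - x) := by positivity
        nlinarith

noncomputable def dn (p n : ℕ) : ℝ := n * (1 - (1 - 2 / (n : ℝ)) ^ p)

lemma overlap_of_hd {n : ℕ} (x y : V n) (d : ℕ) (h : hammingDist x y = d) :
    overlap n x y = 1 - 2 * (d : ℝ) / n := by unfold overlap; rw [h]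

/-- second difference of the covariance along a path -/
noncomputable def eps (p n : ℕ) (q : ℕ → V n) (i : ℕ) : ℝ :=
  rho p n (q 0) (q (i + 1)) - rho p n (q 0) (q 1) - rho p n (q 1) (q (i + 1)) + 1

lemma flip_change {n : ℕ} (p : ℕ → V n) (c : Fin n) (i k : ℕ) (hi : i ≤ k) (h : p i c ≠ p 0 c) :
    (1 : ℝ) ≤ ∑ j ∈ range k, if p j c ≠ p (j + 1) c then (1 : ℝ) else 0 := by
  have : ∃ j < i, p j c ≠ p (j + 1) c := by
    by_contra hcon
    push Not at hcon
    apply h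
    clear h hi
    induction i with
    | zero => rfl
    | succ i ih => rw [← hcon i (by omega)]; exact ih fun j hj => hcon j (by omega)
  obtain ⟨j, hj, hne⟩ := this
  have := single_le_sum (f := fun j => if p j c ≠ p (j + 1) c then (1 : ℝ) else 0)
    (s := range k) (fun _ _ => by positivity) (mem_range.mpr (by omega : j < k))
  simpa [hne] using this

lemma eps_bound {n p : ℕ} (hn : n ≠ 0) (q : ℕ → V n) (hq : IsW q) (c : Fin n) (k i : ℕ) (hi : i ≤ k) :
    n * |eps p n (consP (flipV c (q 0)) q) i| ≤ 4 * p ^ 2 * k / n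
      + 4 * p * ∑ j ∈ range k, if q j c ≠ q (j + 1) c then (1 : ℝ) else 0 := by
  have hn' : (0 : ℝ) < n := by positivity
  set S := ∑ j ∈ range k, if q j c ≠ q (j + 1) c then (1 : ℝ) else 0 with hS
  have hS0 : 0 ≤ S := sum_nonneg fun _ _ => by positivity
  have e0 : eps p n (consP (flipV c (q 0)) q) i = rho p n (flipV c (q 0)) (q i)
     - rho p n (flipV c (q 0)) (q 0) - rho p n (q 0) (q i) + 1 := rfl
  have e1 : overlap n (flipV c (q 0)) (q 0) = 1 - 2 / n := by
    rw [overlap_of_hd _ _ 1 (hd_flip_self _ _)]; simp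
  have hd := hq.hd 0 i
  rw [zero_add] at hd
  by_cases h : q i c = q 0 c
  · have e2 : overlap n (flipV c (q 0)) (q i) = overlap n (q 0) (q i) - 2 / n := by
      unfold overlap; rw [hd_flip_eq c _ _ h.symm]; push_cast; ring
    have := second_diff (x := overlap n (q 0) (q i)) (h := 2 / n) (abs_overlap_le _ _) (by positivity)
      (by rw [← e2]; exact abs_overlap_le _ _) (by rw [← e1]; exact abs_overlap_le _ _) p
    rw [e0]; unfold rho
    rw [e2, e1, show (overlap n (q 0) (q i) - 2 / ↑n) ^ p - (1 - 2 / ↑n) ^ p - overlap n (q 0) (q i) ^ p + 1 =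
      1 - overlap n (q 0) (q i) ^ p - (1 - 2 / ↑n) ^ p + (overlap n (q 0) (q i) - 2 / ↑n) ^ p by ring]
    have h1 : 1 - overlap n (q 0) (q i) ≤ 2 * k / n := by
      unfold overlap
      have : (hammingDist (q 0) (q i) : ℝ) ≤ k := by exact_mod_cast hd.trans hi
      have : 2 * (hammingDist (q 0) (q i) : ℝ) / n ≤ 2 * k / n := by gcongr
      linarith
    calc _ ≤ n * (p ^ 2 * (2 / n * (1 - overlap n (q 0) (q i)))) := by gcongr
      _ ≤ n * (p ^ 2 * (2 / n * (2 * k / n))) := by gcongr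
      _ = 4 * p ^ 2 * k / n := by field_simp; ring
      _ ≤ _ := by have : 0 ≤ 4 * p * S := by positivity
                  linarith
  · have h1 := flip_change q c i k hi h
    rw [← hS] at h1
    have b1 := pow_sub_pow_le_one (abs_overlap_le (flipV c (q 0)) (q i)) (abs_overlap_le (q 0) (q i)) p
    have b2 := pow_sub_pow_le_one (x := 1) (by simp) (abs_overlap_le (flipV c (q 0)) (q 0)) p
    rw [e1] at b2
    have e3 : overlap n (flipV c (q 0)) (q i) = overlap n (q 0) (q i) + 2 / n := by
      unfold overlap; rw [hd_flip_ne c (q 0) _ (fun hh => h hh.symm)]; push_cast; ring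
    rw [e3, add_sub_cancel_left] at b1
    rw [sub_sub_cancel] at b2
    rw [abs_of_pos (by positivity : (0 : ℝ) < 2 / n)] at b1 b2
    rw [e0]; unfold rho
    rw [e3, e1]
    have : |(overlap n (q 0) (q i) + 2 / ↑n) ^ p - (1 - 2 / ↑n) ^ p - overlap n (q 0) (q i) ^ p + 1|
      ≤ p * (2 / n) + p * (2 / n) := by
      refine le_trans ?_ (add_le_add b1 b2)
      refine le_trans (le_of_eq ?_) (abs_add_le _ _)
      congr 1; simp; ring
    calc _ ≤ (n : ℝ) * (p * (2 / n) + p * (2 / n)) := by gcongr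
      _ = 4 * (p : ℝ) * 1 := by field_simp; ring
      _ ≤ 4 * p * S := by gcongr
      _ ≤ _ := by have : 0 ≤ 4 * (p : ℝ) ^ 2 * k / n := by positivity
                  linarith

/-- averaging the error over the flipped coordinate -/
lemma eps_avg {n : ℕ} (p : ℕ) (hn : n ≠ 0) (hp : 1 ≤ p) (k : ℕ) :
    (∑ c : Fin n, Ew n k (fun q => 4 * p ^ 2 * k / n
      + 4 * p * ∑ j ∈ range k, if q j c ≠ q (j + 1) c then (1 : ℝ) else 0)) / n ≤ 8 * p ^ 2 * k / n := by
  have hn' : (0 : ℝ) < n := by positivity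
  rw [← Ew_sum, div_le_iff₀ hn']
  have : Ew n k (fun q => ∑ c : Fin n, ((4 * p ^ 2 * k / n
      + 4 * p * ∑ j ∈ range k, if q j c ≠ q (j + 1) c then (1 : ℝ) else 0) : ℝ)) ≤
      Ew n k (fun _ => 8 * p ^ 2 * k) := by
    apply Ew_mono
    intro q hq
    rw [sum_add_distrib, ← mul_sum, sum_comm]
    have h1 : ∀ j, ∑ c : Fin n, (if q j c ≠ q (j + 1) c then (1 : ℝ) else 0) ≤ 1 := by
      intro j
      have := hq j
      unfold hammingDist at this
      rw [Finset.card_filter] at this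
      exact_mod_cast this
    have h2 : ∑ j ∈ range k, ∑ c : Fin n, (if q j c ≠ q (j + 1) c then (1 : ℝ) else 0) ≤ k := by
      calc _ ≤ ∑ j ∈ range k, (1 : ℝ) := sum_le_sum fun j _ => h1 j
        _ = k := by simp
    have hp' : (1 : ℝ) ≤ p := by exact_mod_cast hp
    have h3 : (4 * p * k : ℝ) ≤ 4 * p ^ 2 * k := by
      have : (p : ℝ) ≤ p ^ 2 := by nlinarith
      gcongr
    have h4 : 4 * p * ∑ j ∈ range k, ∑ c : Fin n, (if q j c ≠ q (j + 1) c then (1 : ℝ) else 0) ≤ 4 * p * k := by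
      gcongr
    simp only [sum_const, card_univ, Fintype.card_fin, nsmul_eq_mul]
    have h5 : (n : ℝ) * (4 * p ^ 2 * k / n) = 4 * p ^ 2 * k := by field_simp
    rw [h5]
    linarith
  rw [Ew_const hn] at this
  calc _ ≤ _ := this
    _ = _ := by field_simp


lemma integrable_mx {Ω : Type*} [MeasurableSpace Ω] {P : Measure Ω} (k : ℕ) (f : ℕ → Ω → ℝ)
    (hf : ∀ i, Integrable (f i) P) : Integrable (fun a => mx k (fun i => f i a)) P := by
  induction k generalizing f with
  | zero => exact hf 0
  | succ k ih => exact (hf 0).sup (ih (fun i => f (i + 1)) fun i => hf _)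

noncomputable def Zf (p n : ℕ) (l : ℝ) (h : V n → ℝ) (q : ℕ → V n) (i : ℕ) : ℝ :=
  h (q i) - h (q 0) - l * n * (1 - rho p n (q 0) (q i))

noncomputable def Wf (p n : ℕ) (l : ℝ) (k : ℕ) (h : V n → ℝ) (q : ℕ → V n) : ℝ :=
  mx k (fun i => Zf p n l h q (i + 1))

section Laplace
variable {Ω : Type*} [MeasurableSpace Ω] (P : Measure Ω) [IsProbabilityMeasure P]
  {n : ℕ} (p : ℕ) (H : V n → Ω → ℝ)

noncomputable def Lam (k : ℕ) (l : ℝ) : ℝ :=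
  Ew n k (fun q => exp (-(l ^ 2 * n / 2)) * ∫ ω, exp (l * mx k (fun i => H (q i) ω)) ∂P)

noncomputable def fk (k : ℕ) (l : ℝ) : ℝ :=
  Ew n k (fun q => ∫ ω, mx k (Zf p n l (fun x => H x ω) q) ∂P)

variable {P p H}

lemma int_exp_mx (hG : GV P H (fun x y => (n : ℝ) * overlap n x y ^ p)) (k : ℕ) (l : ℝ) (q : ℕ → V n) :
    Integrable (fun ω => exp (l * mx k (fun i => H (q i) ω))) P := by
  have hI : Integrable (fun ω => ∑ i ∈ range (k + 1), exp (l * H (q i) ω)) P :=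
    integrable_finsetSum _ fun i _ => hG.int_exp (q i) l
  refine hI.mono' ?_ (ae_of_all _ fun ω => ?_)
  · have := measurable_mx k (fun i ω => H (q i) ω) (fun i => hG.meas _)
    exact (by fun_prop : Measurable fun ω => exp (l * mx k (fun i => H (q i) ω))).aestronglyMeasurable
  · rw [Real.norm_eq_abs, abs_of_pos (exp_pos _)]
    exact exp_mx_le _ _ _

lemma Zf_shift (l : ℝ) (h : V n → ℝ) (q : ℕ → V n) (i : ℕ) :
    Zf p n l h q i = (h (q i) + l * n * rho p n (q 0) (q i)) - (h (q 0) + l * n) := by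
  unfold Zf; ring

lemma lap_step (hn : n ≠ 0) (hG : GV P H (fun x y => (n : ℝ) * overlap n x y ^ p)) (k : ℕ) (l : ℝ)
    (hl : 0 ≤ l) (q : ℕ → V n) :
    ∫ ω, exp (l * mx (k + 1) (fun i => H (q i) ω)) ∂P
      - ∫ ω, exp (l * mx k (fun i => H (q (i + 1)) ω)) ∂P
      = exp (l ^ 2 * n / 2) * ∫ ω, max 0 (1 - exp (l * Wf p n l k (fun x => H x ω) q)) ∂P := by
  have h1 := girsanov hn hG (q 0) l
    (fun h => max 0 (1 - exp (l * (mx k (fun i => h (q (i + 1))) - h (q 0)))))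
    (by
      have := measurable_mx (α := V n → ℝ) k (fun i h => h (q (i + 1))) (fun i => by fun_prop)
      fun_prop)
    (fun h => le_max_left _ _)
  have e2 : ∀ ω, mx k (fun i => H (q (i + 1)) ω + l * n * rho p n (q 0) (q (i + 1)))
      - (H (q 0) ω + l * n * rho p n (q 0) (q 0)) = Wf p n l k (fun x => H x ω) q := by
    intro ω
    unfold Wf
    simp_rw [Zf_shift]
    have := mx_add_const k (fun i => H (q (i + 1)) ω + l * n * rho p n (q 0) (q (i + 1)))
      (-(H (q 0) ω + l * n))
    simp only [← sub_eq_add_neg] at this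
    rw [this, rho_self]; ring
  simp only [e2] at h1
  rw [← h1, ← integral_sub (int_exp_mx hG _ _ _) (int_exp_mx hG k l (fun i => q (i + 1)))]
  congr 1; funext ω
  simp only [mx]
  set M := mx k (fun i => H (q (i + 1)) ω)
  rw [mul_max_of_nonneg _ _ (exp_pos _).le, mul_zero, mul_sub, mul_one, ← exp_add,
    show l * H (q 0) ω + l * (M - H (q 0) ω) = l * M by ring]
  rcases le_total (H (q 0) ω) M with h | h
  · rw [max_eq_right h, max_eq_left, sub_self]
    have : exp (l * H (q 0) ω) ≤ exp (l * M) := exp_le_exp.mpr (by gcongr)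
    linarith
  · rw [max_eq_left h, max_eq_right]
    have : exp (l * M) ≤ exp (l * H (q 0) ω) := exp_le_exp.mpr (by gcongr)
    linarith

lemma Lam_succ (hn : n ≠ 0) (hG : GV P H (fun x y => (n : ℝ) * overlap n x y ^ p)) (k : ℕ) (l : ℝ)
    (hl : 0 ≤ l) :
    Lam P H (k + 1) l = Lam P H k l +
      Ew n (k + 1) (fun q => ∫ ω, max 0 (1 - exp (l * Wf p n l k (fun x => H x ω) q)) ∂P) := by
  have h1 : Lam P H k l = Ew n (k + 1) (fun q => exp (-(l ^ 2 * n / 2)) *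
      ∫ ω, exp (l * mx k (fun i => H (q (i + 1)) ω)) ∂P) := by
    unfold Lam
    rw [← Ew_shift_one (N := k) hn]
    rfl
  rw [h1, ← Ew_add]
  unfold Lam
  apply Ew_congr
  intro q _
  have := lap_step hn hG k l hl q
  have e : exp (-(l ^ 2 * n / 2)) * exp (l ^ 2 * n / 2) = 1 := by rw [← exp_add]; simp
  rw [sub_eq_iff_eq_add.mp this, mul_add, ← mul_assoc, e]; ring

lemma Lam_zero (hn : n ≠ 0) (hG : GV P H (fun x y => (n : ℝ) * overlap n x y ^ p)) (l : ℝ) :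
    Lam P H 0 l = 1 := by
  unfold Lam
  simp only [mx]
  have : ∀ q : ℕ → V n, exp (-(l ^ 2 * n / 2)) * ∫ ω, exp (l * H (q 0) ω) ∂P = 1 := by
    intro q
    rw [hG.exp_eq, overlap_self, ← exp_add]; simp
  simp only [this]
  exact Ew_const hn 1

lemma intZ (hG : GV P H (fun x y => (n : ℝ) * overlap n x y ^ p)) (l : ℝ) (q : ℕ → V n) (i : ℕ) :
    Integrable (fun ω => Zf p n l (fun x => H x ω) q i) P :=
  ((hG.intX _).sub (hG.intX _)).sub (integrable_const _)

lemma intW (hG : GV P H (fun x y => (n : ℝ) * overlap n x y ^ p)) (l : ℝ) (k : ℕ) (q : ℕ → V n) :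
    Integrable (fun ω => Wf p n l k (fun x => H x ω) q) P :=
  integrable_mx k (fun i ω => Zf p n l (fun x => H x ω) q (i + 1)) fun i => intZ hG l q _

lemma intw (hG : GV P H (fun x y => (n : ℝ) * overlap n x y ^ p)) (l : ℝ) (k : ℕ) (q : ℕ → V n) :
    Integrable (fun ω => max 0 (-Wf p n l k (fun x => H x ω) q)) P :=
  (integrable_const 0).sup (intW hG l k q).neg

lemma integral_Z (hG : GV P H (fun x y => (n : ℝ) * overlap n x y ^ p)) (l : ℝ) (q : ℕ → V n) (i : ℕ) :
    ∫ ω, Zf p n l (fun x => H x ω) q i ∂P = -(l * n * (1 - rho p n (q 0) (q i))) := by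
  unfold Zf
  have h1 : Integrable (fun ω => H (q i) ω - H (q 0) ω) P := (hG.intX _).sub (hG.intX _)
  rw [integral_sub h1 (integrable_const _), integral_sub (hG.intX _) (hG.intX _), hG.mean, hG.mean]
  simp

lemma Zf_zero (l : ℝ) (h : V n → ℝ) (q : ℕ → V n) : Zf p n l h q 0 = 0 := by
  simp [Zf, rho_self]

lemma w_eq (l : ℝ) (k : ℕ) (h : V n → ℝ) (q : ℕ → V n) :
    max 0 (-Wf p n l k h q) = mx (k + 1) (Zf p n l h q) - Wf p n l k h q := by
  simp only [mx, Zf_zero]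
  change _ = max 0 (Wf p n l k h q) - _
  rcases le_total 0 (Wf p n l k h q) with h | h
  · rw [max_eq_left (by linarith), max_eq_right h]; ring
  · rw [max_eq_right (by linarith), max_eq_left h]; ring

/-- drift identity along one path -/
lemma W_shift (hl : ∀ _ : Unit, (0 : ℝ) ≤ l) (k : ℕ) (h : V n → ℝ) (q : ℕ → V n) (B : ℝ)
    (hB : ∀ i ≤ k, n * |eps p n q i| ≤ B) :
    |Wf p n l k h q - (mx k (Zf p n l h (shiftP 1 q)) + Zf p n l h q 1)| ≤ l * B := by
  have hl := hl ()
  rw [← mx_add_const]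
  unfold Wf
  apply mx_abs_sub
  intro i hi
  have : Zf p n l h q (i + 1) - (Zf p n l h (shiftP 1 q) i + Zf p n l h q 1) = l * (n * eps p n q i) := by
    simp only [Zf, shiftP, eps]
    simp only [zero_add]
    ring
  rw [this, abs_mul, abs_mul, abs_of_nonneg hl, Nat.abs_cast]
  gcongr
  exact hB i hi

lemma avg_w (hn : n ≠ 0) (hp : 1 ≤ p) (hG : GV P H (fun x y => (n : ℝ) * overlap n x y ^ p)) (k : ℕ) (l : ℝ)
    (hl : 0 ≤ l) :
    |Ew n (k + 1) (fun q => ∫ ω, max 0 (-Wf p n l k (fun x => H x ω) q) ∂P)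
      - (fk P p H (k + 1) l - fk P p H k l + l * dn p n)| ≤ l * (8 * p ^ 2 * k / n) := by
  have hfk : fk P p H k l = Ew n (k + 1) (fun q => ∫ ω, mx k (Zf p n l (fun x => H x ω) (shiftP 1 q)) ∂P) := by
    unfold fk
    rw [← Ew_shift_one (N := k) hn]
  have hdn : l * dn p n = Ew n (k + 1) (fun q => l * n * (1 - rho p n (q 0) (q 1))) := by
    rw [Ew_succ]
    have : ∀ (c : Fin n) (q : ℕ → V n), l * n * (1 - rho p n ((consP (flipV c (q 0)) q) 0) ((consP (flipV c (q 0)) q) 1))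
       = l * dn p n := by
      intro c q
      simp only [consP, dn, rho]
      rw [overlap_of_hd _ _ 1 (hd_flip_self _ _)]
      simp; ring
    simp only [this, Ew_const hn]
    have : (n : ℝ) ≠ 0 := by exact_mod_cast hn
    simp; field_simp
  rw [hfk, hdn]
  unfold fk
  rw [← Ew_sub, ← Ew_add, ← Ew_sub]
  refine (Ew_abs_le _).trans ?_
  have hkey : ∀ (q : ℕ → V n) (B : ℝ), (∀ i ≤ k, n * |eps p n q i| ≤ B) →
     |∫ ω, max 0 (-Wf p n l k (fun x => H x ω) q) ∂P -
            (∫ ω, mx (k + 1) (Zf p n l (fun x => H x ω) q) ∂P -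
                ∫ ω, mx k (Zf p n l (fun x => H x ω) (shiftP 1 q)) ∂P +
              l * ↑n * (1 - rho p n (q 0) (q 1)))| ≤ l * B := by
    intro q B hB
    have hI1 : Integrable (fun ω => mx (k + 1) (Zf p n l (fun x => H x ω) q)) P :=
      integrable_mx (k + 1) (fun i ω => Zf p n l (fun x => H x ω) q i) fun i => intZ hG l q _
    have hI2 : Integrable (fun ω => mx k (Zf p n l (fun x => H x ω) (shiftP 1 q))) P :=
      integrable_mx k (fun i ω => Zf p n l (fun x => H x ω) (shiftP 1 q) i) fun i => intZ hG l _ _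
    have hI3 : Integrable (fun ω => mx k (Zf p n l (fun x => H x ω) (shiftP 1 q))
        + Zf p n l (fun x => H x ω) q 1) P := hI2.add (intZ hG l q 1)
    have hZ := integral_Z hG l q 1
    simp_rw [w_eq]
    rw [integral_sub hI1 (intW hG l k q), show l * n * (1 - rho p n (q 0) (q 1))
      = - ∫ ω, Zf p n l (fun x => H x ω) q 1 ∂P by rw [hZ]; ring]
    rw [show ∀ a b c d : ℝ, a - b - (a - c + -d) = -(b - (c + d)) by intros; ring, abs_neg,
      ← integral_add hI2 (intZ hG l q 1), ← integral_sub (intW hG l k q) hI3]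
    refine (abs_integral_le_integral_abs).trans ?_
    have hle : ∀ ω, |Wf p n l k (fun x => H x ω) q - (mx k (Zf p n l (fun x => H x ω) (shiftP 1 q))
        + Zf p n l (fun x => H x ω) q 1)| ≤ l * B := fun ω =>
      W_shift (fun _ => hl) k (fun x => H x ω) q B hB
    calc _ ≤ ∫ ω, l * B ∂P := by
          apply integral_mono (((intW hG l k q).sub hI3).abs) (integrable_const _)
          exact hle
      _ = l * B := by simp
  rw [Ew_succ]
  calc _ ≤ (∑ c : Fin n, Ew n k (fun q => l * (4 * p ^ 2 * k / n
      + 4 * p * ∑ j ∈ range k, if q j c ≠ q (j + 1) c then (1 : ℝ) else 0))) / n := by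
        gcongr with c _
        apply Ew_mono
        intro q hq
        exact hkey _ _ fun i hi => eps_bound hn q hq c k i hi
    _ = l * ((∑ c : Fin n, Ew n k (fun q => (4 * p ^ 2 * k / n
      + 4 * p * ∑ j ∈ range k, if q j c ≠ q (j + 1) c then (1 : ℝ) else 0))) / n) := by
        simp_rw [Ew_mul_left]; rw [← mul_sum, mul_div_assoc]
    _ ≤ _ := mul_le_mul_of_nonneg_left (eps_avg p hn hp k) hl

end Laplace


section Laplace
variable {Ω : Type*} [MeasurableSpace Ω] {P : Measure Ω} [IsProbabilityMeasure P]
  {n : ℕ} {p : ℕ} {H : V n → Ω → ℝ}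

lemma fk_zero (l : ℝ) : fk P p H 0 l = 0 := by
  unfold fk
  simp [mx, Zf_zero, Ew]

lemma fk_nonneg (hG : GV P H (fun x y => (n : ℝ) * overlap n x y ^ p)) (k : ℕ) (l : ℝ) :
    0 ≤ fk P p H k l := by
  apply Ew_nonneg
  intro q _
  apply integral_nonneg
  intro ω
  have := le_mx (k := k) (Zf p n l (fun x => H x ω) q) (Nat.zero_le k)
  rwa [Zf_zero] at this

lemma one_sub_rho_le (x y : V n) (k : ℕ) (hn : n ≠ 0) (h : hammingDist x y ≤ k) :
    n * (1 - rho p n x y) ≤ 2 * p * k := by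
  have h1 := one_add_mul_le_pow (a := overlap n x y - 1) (by linarith [neg_one_le_overlap x y]) p
  rw [add_sub_cancel] at h1
  have hn' : (0 : ℝ) < n := by positivity
  have h2 : (n : ℝ) * (1 - overlap n x y) ≤ 2 * k := by
    unfold overlap
    have : (hammingDist x y : ℝ) ≤ k := by exact_mod_cast h
    calc _ = 2 * (hammingDist x y : ℝ) := by field_simp; ring
      _ ≤ _ := by linarith
  unfold rho
  have hp0 : (0 : ℝ) ≤ p := by positivity
  nlinarith

/-- law of the increments -/
lemma exp_incr (hG : GV P H (fun x y => (n : ℝ) * overlap n x y ^ p)) (x y : V n) (s : ℝ) :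
    Integrable (fun ω => exp (s * (H x ω - H y ω))) P ∧
    ∫ ω, exp (s * (H x ω - H y ω)) ∂P = exp (s ^ 2 * (n * (1 - rho p n x y))) := by
  classical
  have e : ∀ ω, ∑ i, ((s • (Pi.single x 1 - Pi.single y 1) : V n → ℝ)) i * H i ω = s * (H x ω - H y ω) := by
    intro ω
    simp [Pi.single_apply, mul_sub, sub_mul, sum_sub_distrib]
  have h1 := hG.int_exp_lin (s • (Pi.single x 1 - Pi.single y 1))
  have h2 := hG.exp_lin (s • (Pi.single x 1 - Pi.single y 1))
  simp only [e] at h1 h2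
  refine ⟨h1, ?_⟩
  rw [h2]
  congr 1
  simp [Pi.single_apply, mul_sub, sub_mul, sum_sub_distrib, overlap_self]
  rw [overlap_comm y x]
  unfold rho
  ring

lemma fk_le (hn : n ≠ 0) (hG : GV P H (fun x y => (n : ℝ) * overlap n x y ^ p)) (k : ℕ) (l s : ℝ)
    (hl : 0 ≤ l) (hs : 0 < s) : fk P p H k l ≤ log (k + 1) / s + 2 * p * k * s := by
  unfold fk
  refine le_trans (Ew_mono _ (fun _ => log (k + 1) / s + 2 * p * k * s) fun q hq => ?_) (Ew_const hn _).le
  set A : ℝ := log (k + 1) + 2 * p * k * s ^ 2 with hA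
  have hI1 : Integrable (fun ω => mx k (Zf p n l (fun x => H x ω) q)) P :=
    integrable_mx k (fun i ω => Zf p n l (fun x => H x ω) q i) fun i => intZ hG l q _
  have hI2 : Integrable (fun ω => ∑ i ∈ range (k + 1), exp (s * (H (q i) ω - H (q 0) ω))) P :=
    integrable_finsetSum _ fun i _ => (exp_incr hG (q i) (q 0) s).1
  have hpt : ∀ ω, s * mx k (Zf p n l (fun x => H x ω) q) ≤
      (A - 1) + exp (-A) * ∑ i ∈ range (k + 1), exp (s * (H (q i) ω - H (q 0) ω)) := by
    intro ω
    have h1 : mx k (Zf p n l (fun x => H x ω) q) ≤ mx k (fun i => H (q i) ω - H (q 0) ω) := by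
      have := mx_le_add (k := k) (f := Zf p n l (fun x => H x ω) q)
        (g := fun i => H (q i) ω - H (q 0) ω) (e := 0) fun i _ => by
          have h2 := rho_le_one p n (q 0) (q i)
          have : 0 ≤ l * n * (1 - rho p n (q 0) (q i)) := by
            apply mul_nonneg (by positivity); linarith
          simp only [Zf]; linarith
      linarith
    have h2 := exp_mx_le k (fun i => H (q i) ω - H (q 0) ω) s
    set m := mx k (fun i => H (q i) ω - H (q 0) ω)
    have h3 := add_one_le_exp (s * m - A)
    have h4 : exp (s * m - A) = exp (-A) * exp (s * m) := by rw [← exp_add]; congr 1; ring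
    rw [h4] at h3
    have h5 := mul_le_mul_of_nonneg_left h2 (exp_pos (-A)).le
    have h6 := mul_le_mul_of_nonneg_left h1 hs.le
    linarith
  have hInt : s * ∫ ω, mx k (Zf p n l (fun x => H x ω) q) ∂P ≤ A := by
    rw [← integral_const_mul]
    calc _ ≤ ∫ ω, ((A - 1) + exp (-A) * ∑ i ∈ range (k + 1), exp (s * (H (q i) ω - H (q 0) ω))) ∂P :=
          integral_mono (hI1.const_mul _) ((integrable_const _).add (hI2.const_mul _)) hpt
      _ = (A - 1) + exp (-A) * ∑ i ∈ range (k + 1), exp (s ^ 2 * (n * (1 - rho p n (q i) (q 0)))) := by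
          rw [integral_add (integrable_const _) (hI2.const_mul _), integral_const_mul,
            integral_finsetSum _ fun i _ => (exp_incr hG (q i) (q 0) s).1]
          simp [(exp_incr hG _ _ s).2]
      _ ≤ (A - 1) + exp (-A) * ∑ i ∈ range (k + 1), exp (s ^ 2 * (2 * p * k)) := by
          refine add_le_add le_rfl (mul_le_mul_of_nonneg_left (sum_le_sum fun i hi =>
            exp_le_exp.mpr (mul_le_mul_of_nonneg_left ?_ (sq_nonneg s))) (exp_pos _).le)
          apply one_sub_rho_le _ _ _ hn
          rw [hammingDist_comm]
          have := hq.hd 0 i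
          rw [zero_add] at this
          have h3 := mem_range.mp hi
          omega
      _ = A := by
          have : (∑ i ∈ range (k + 1), exp (s ^ 2 * (2 * p * k))) = exp A := by
            rw [hA, exp_add, exp_log (by positivity)]
            simp; left; ring
          rw [this, ← exp_add]; simp
  have : ∫ ω, mx k (Zf p n l (fun x => H x ω) q) ∂P ≤ A / s := by
    rw [le_div_iff₀ hs]; linarith
  refine this.trans (le_of_eq ?_)
  rw [hA]; field_simp

lemma one_sub_exp_eq (l W : ℝ) (hl : 0 ≤ l) : max 0 (1 - exp (l * W)) = 1 - exp (-(l * max 0 (-W))) := by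
  rcases le_total 0 W with h | h
  · rw [max_eq_left (by linarith : -W ≤ 0), max_eq_left]
    · simp
    · have : 1 ≤ exp (l * W) := one_le_exp (by positivity)
      linarith
  · rw [max_eq_right (by linarith : 0 ≤ -W), max_eq_right]
    · congr 2; ring
    · have : exp (l * W) ≤ 1 := exp_le_one_iff.mpr (mul_nonpos_of_nonneg_of_nonpos hl h)
      linarith

lemma exp_neg_upper (x : ℝ) : 1 - exp (-x) ≤ x := by
  have := add_one_le_exp (-x); linarith

lemma exp_neg_lower (x : ℝ) (hx : 0 ≤ x) : x - x ^ 2 / 2 ≤ 1 - exp (-x) := by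
  -- e^{-x} ≤ 1 - x + x²/2
  have h := Real.quadratic_le_exp_of_nonneg hx
  have h2 : exp (-x) * exp x = 1 := by rw [← exp_add]; simp
  have h3 : 0 < 1 + x + x ^ 2 / 2 := by positivity
  have h4 : exp (-x) ≤ 1 / (1 + x + x ^ 2 / 2) := by
    rw [le_div_iff₀ h3]
    nlinarith [exp_pos (-x)]
  have h5 : 1 / (1 + x + x ^ 2 / 2) ≤ 1 - x + x ^ 2 / 2 := by
    rw [div_le_iff₀ h3]
    nlinarith [sq_nonneg (x ^ 2)]
  linarith

lemma pow_four_le_exp (z : ℝ) : z ^ 4 ≤ 24 * (exp z + exp (-z)) := by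
  have h : ∀ x : ℝ, 0 ≤ x → x ^ 4 ≤ 24 * exp x := by
    intro x hx
    have := Real.pow_div_factorial_le_exp x hx 4
    rw [show ((Nat.factorial 4 : ℕ) : ℝ) = 24 by norm_num [Nat.factorial]] at this
    linarith
  rcases le_total 0 z with hz | hz
  · have := h z hz; have := exp_pos (-z); linarith
  · have := h (-z) (by linarith); have := exp_pos z
    have e : (-z) ^ 4 = z ^ 4 := by ring
    linarith

lemma meas_W (hG : GV P H (fun x y => (n : ℝ) * overlap n x y ^ p)) (l : ℝ) (k : ℕ) (q : ℕ → V n) :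
    Measurable (fun ω => Wf p n l k (fun x => H x ω) q) :=
  measurable_mx k (fun i ω => Zf p n l (fun x => H x ω) q (i + 1)) fun i =>
    ((hG.meas _).sub (hG.meas _)).sub_const _

lemma int_bd (hG : GV P H (fun x y => (n : ℝ) * overlap n x y ^ p)) (l : ℝ) (k : ℕ) (q : ℕ → V n) :
    Integrable (fun ω => max 0 (1 - exp (l * Wf p n l k (fun x => H x ω) q))) P := by
  have hm := meas_W hG l k q
  refine (integrable_const (1 : ℝ)).mono' ((measurable_const.max (measurable_const.sub
    ((hm.const_mul l).exp))).aestronglyMeasurable) (ae_of_all _ fun ω => ?_)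
  rw [Real.norm_eq_abs, abs_of_nonneg (le_max_left _ _)]
  apply max_le (by norm_num)
  have := exp_pos (l * Wf p n l k (fun x => H x ω) q)
  linarith

lemma Z_four (hn : n ≠ 0) (hG : GV P H (fun x y => (n : ℝ) * overlap n x y ^ p)) (l : ℝ) (hl : 0 ≤ l)
    (hl1 : l ≤ 1) (q : ℕ → V n) (hq : IsW q) :
    Integrable (fun ω => (Zf p n l (fun x => H x ω) q 1) ^ 4) P ∧
    ∫ ω, (Zf p n l (fun x => H x ω) q 1) ^ 4 ∂P ≤ 48 * exp (4 * p) := by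
  set D := l * n * (1 - rho p n (q 0) (q 1)) with hD
  have hd : n * (1 - rho p n (q 0) (q 1)) ≤ 2 * p := by
    have := one_sub_rho_le (p := p) (q 0) (q 1) 1 hn (hq 0)
    simpa using this
  have hd0 : 0 ≤ n * (1 - rho p n (q 0) (q 1)) :=
    mul_nonneg (by positivity) (by linarith [rho_le_one p n (q 0) (q 1)])
  have hD0 : 0 ≤ D := by rw [hD, mul_assoc]; positivity
  have hD1 : D ≤ 2 * p := by
    rw [hD, mul_assoc]
    nlinarith
  obtain ⟨i1, e1⟩ := exp_incr hG (q 1) (q 0) 1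
  obtain ⟨i2, e2⟩ := exp_incr hG (q 1) (q 0) (-1)
  have hI : Integrable (fun ω => 24 * (exp (-D) * exp (1 * (H (q 1) ω - H (q 0) ω))
      + exp D * exp (-1 * (H (q 1) ω - H (q 0) ω)))) P :=
    ((i1.const_mul _).add (i2.const_mul _)).const_mul _
  have hle : ∀ ω, (Zf p n l (fun x => H x ω) q 1) ^ 4 ≤ 24 * (exp (-D) * exp (1 * (H (q 1) ω - H (q 0) ω))
      + exp D * exp (-1 * (H (q 1) ω - H (q 0) ω))) := by
    intro ω
    refine (pow_four_le_exp _).trans (le_of_eq ?_)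
    rw [← exp_add, ← exp_add]
    unfold Zf
    rw [← hD]
    congr 3 <;> ring
  have hnn : ∀ ω, 0 ≤ (Zf p n l (fun x => H x ω) q 1) ^ 4 := fun ω => by positivity
  have hmeas : Measurable (fun ω => (Zf p n l (fun x => H x ω) q 1) ^ 4) :=
    (((hG.meas _).sub (hG.meas _)).sub_const _).pow_const _
  have hI0 : Integrable (fun ω => (Zf p n l (fun x => H x ω) q 1) ^ 4) P := by
    refine hI.mono' hmeas.aestronglyMeasurable (ae_of_all _ fun ω => ?_)
    rw [Real.norm_eq_abs, abs_of_nonneg (hnn ω)]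
    exact hle ω
  refine ⟨hI0, ?_⟩
  calc _ ≤ _ := integral_mono hI0 hI hle
    _ = 24 * (exp (-D) * exp (1 ^ 2 * (n * (1 - rho p n (q 1) (q 0))))
      + exp D * exp ((-1) ^ 2 * (n * (1 - rho p n (q 1) (q 0))))) := by
        rw [integral_const_mul, integral_add (i1.const_mul _) (i2.const_mul _), integral_const_mul,
          integral_const_mul, e1, e2]
    _ ≤ 24 * (exp (4 * p) + exp (4 * p)) := by
        rw [← exp_add, ← exp_add, rho_comm p n (q 1) (q 0)]
        have hp0 : (0 : ℝ) ≤ p := by positivity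
        have a1 : exp (-D + 1 ^ 2 * (n * (1 - rho p n (q 0) (q 1)))) ≤ exp (4 * p) :=
          exp_le_exp.mpr (by linarith)
        have a2 : exp (D + (-1) ^ 2 * (n * (1 - rho p n (q 0) (q 1)))) ≤ exp (4 * p) :=
          exp_le_exp.mpr (by linarith)
        linarith
    _ = _ := by ring

lemma path_upper (hG : GV P H (fun x y => (n : ℝ) * overlap n x y ^ p)) (l : ℝ) (hl : 0 ≤ l) (k : ℕ)
    (q : ℕ → V n) :
    ∫ ω, max 0 (1 - exp (l * Wf p n l k (fun x => H x ω) q)) ∂P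
      ≤ l * ∫ ω, max 0 (-Wf p n l k (fun x => H x ω) q) ∂P := by
  rw [← integral_const_mul]
  refine integral_mono (int_bd hG l k q) ((intw hG l k q).const_mul _) fun ω => ?_
  simp only
  rw [one_sub_exp_eq _ _ hl]
  exact exp_neg_upper _

lemma path_lower (hn : n ≠ 0) (hG : GV P H (fun x y => (n : ℝ) * overlap n x y ^ p)) (l : ℝ) (hl : 0 ≤ l)
    (hl1 : l ≤ 1) (T : ℝ) (hT : 0 < T) (k : ℕ) (q : ℕ → V n) (hq : IsW q) :
    (l - l ^ 2 * T / 2) * ∫ ω, max 0 (-Wf p n l k (fun x => H x ω) q) ∂P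
      - l ^ 2 / (2 * T ^ 2) * (48 * exp (4 * p))
      ≤ ∫ ω, max 0 (1 - exp (l * Wf p n l k (fun x => H x ω) q)) ∂P := by
  obtain ⟨hI, hb⟩ := Z_four hn hG l hl hl1 q hq
  have h1 : (l - l ^ 2 * T / 2) * ∫ ω, max 0 (-Wf p n l k (fun x => H x ω) q) ∂P
     - l ^ 2 / (2 * T ^ 2) * ∫ ω, (Zf p n l (fun x => H x ω) q 1) ^ 4 ∂P
     ≤ ∫ ω, max 0 (1 - exp (l * Wf p n l k (fun x => H x ω) q)) ∂P := by
    rw [← integral_const_mul, ← integral_const_mul, ← integral_sub ((intw hG l k q).const_mul _) (hI.const_mul _)]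
    refine integral_mono (((intw hG l k q).const_mul _).sub (hI.const_mul _)) (int_bd hG l k q) fun ω => ?_
    simp only [Pi.sub_apply]
    rw [one_sub_exp_eq _ _ hl]
    set W := Wf p n l k (fun x => H x ω) q with hW
    set Z := Zf p n l (fun x => H x ω) q 1 with hZ
    set w := max 0 (-W) with hw
    have hw0 : 0 ≤ w := le_max_left _ _
    have hwZ : w ≤ |Z| := by
      apply max_le (abs_nonneg _)
      have : Z ≤ W := le_mx (k := k) (fun i => Zf p n l (fun x => H x ω) q (i + 1)) (Nat.zero_le k)
      have := neg_abs_le Z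
      linarith
    have hw4 : w ^ 4 ≤ Z ^ 4 := by
      calc w ^ 4 ≤ |Z| ^ 4 := by gcongr
        _ = Z ^ 4 := by rw [← abs_pow, abs_of_nonneg (by positivity)]
    have hw2 : w ^ 2 ≤ T * w + Z ^ 4 / T ^ 2 := by
      rcases le_total w T with h | h
      · have : 0 ≤ Z ^ 4 / T ^ 2 := by positivity
        nlinarith
      · have : w ^ 2 ≤ Z ^ 4 / T ^ 2 := by
          rw [le_div_iff₀ (by positivity)]
          have : T ^ 2 ≤ w ^ 2 := by gcongr
          nlinarith [sq_nonneg w]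
        have := mul_nonneg hT.le hw0
        linarith
    have h3 := exp_neg_lower (l * w) (by positivity)
    refine le_trans ?_ h3
    have h4 : l ^ 2 / 2 * w ^ 2 ≤ l ^ 2 / 2 * (T * w + Z ^ 4 / T ^ 2) := by gcongr
    have h5 : l ^ 2 / (2 * T ^ 2) * Z ^ 4 = l ^ 2 / 2 * (Z ^ 4 / T ^ 2) := by field_simp
    rw [h5]
    nlinarith
  have h2 : l ^ 2 / (2 * T ^ 2) * ∫ ω, (Zf p n l (fun x => H x ω) q 1) ^ 4 ∂P
    ≤ l ^ 2 / (2 * T ^ 2) * (48 * exp (4 * p)) := by gcongr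
  linarith

lemma Lam_upper' (hn : n ≠ 0) (hp : 1 ≤ p) (hG : GV P H (fun x y => (n : ℝ) * overlap n x y ^ p)) (l : ℝ)
    (hl : 0 ≤ l) (K k : ℕ) (hk : k ≤ K) :
    Lam P H k l ≤ 1 + l * (fk P p H k l + k * (l * dn p n) + k * (l * (8 * p ^ 2 * K / n))) := by
  induction k with
  | zero => rw [Lam_zero hn hG, fk_zero]; simp
  | succ k ih =>
    have ih := ih (by omega)
    rw [Lam_succ hn hG k l hl]
    have h1 : Ew n (k + 1) (fun q => ∫ ω, max 0 (1 - exp (l * Wf p n l k (fun x => H x ω) q)) ∂P)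
      ≤ l * Ew n (k + 1) (fun q => ∫ ω, max 0 (-Wf p n l k (fun x => H x ω) q) ∂P) := by
      rw [← Ew_mul_left]
      exact Ew_mono _ _ fun q _ => path_upper hG l hl k q
    have h2 := (abs_le.mp (avg_w hn hp hG k l hl)).2
    have h3 : l * (8 * p ^ 2 * k / n) ≤ l * (8 * p ^ 2 * K / n) := by
      have : (k : ℝ) ≤ K := by exact_mod_cast (by omega : k ≤ K)
      gcongr
    have h4 : Ew n (k + 1) (fun q => ∫ ω, max 0 (-Wf p n l k (fun x => H x ω) q) ∂P) ≤
       fk P p H (k + 1) l - fk P p H k l + l * dn p n + l * (8 * p ^ 2 * K / n) := by linarith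
    have h5 := mul_le_mul_of_nonneg_left h4 hl
    push_cast
    linarith

lemma Lam_lower' (hn : n ≠ 0) (hp : 1 ≤ p) (hG : GV P H (fun x y => (n : ℝ) * overlap n x y ^ p)) (l : ℝ)
    (hl : 0 ≤ l) (hl1 : l ≤ 1) (T : ℝ) (hT : 0 < T) (hlT : l * T ≤ 2) (K k : ℕ) (hk : k ≤ K) :
    1 + (l - l ^ 2 * T / 2) * (fk P p H k l + k * (l * dn p n) - k * (l * (8 * p ^ 2 * K / n)))
      - k * (l ^ 2 / (2 * T ^ 2) * (48 * exp (4 * p))) ≤ Lam P H k l := by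
  have ha : 0 ≤ l - l ^ 2 * T / 2 := by nlinarith
  induction k with
  | zero => rw [Lam_zero hn hG, fk_zero]; simp
  | succ k ih =>
    have ih := ih (by omega)
    rw [Lam_succ hn hG k l hl]
    have h1 : (l - l ^ 2 * T / 2) * Ew n (k + 1) (fun q => ∫ ω, max 0 (-Wf p n l k (fun x => H x ω) q) ∂P)
       - l ^ 2 / (2 * T ^ 2) * (48 * exp (4 * p)) ≤
       Ew n (k + 1) (fun q => ∫ ω, max 0 (1 - exp (l * Wf p n l k (fun x => H x ω) q)) ∂P) := by
      have e : l ^ 2 / (2 * T ^ 2) * (48 * exp (4 * p)) = Ew n (k + 1) (fun _ => l ^ 2 / (2 * T ^ 2) * (48 * exp (4 * p))) :=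
        (Ew_const hn _).symm
      rw [← Ew_mul_left, e, ← Ew_sub]
      exact Ew_mono _ _ fun q hq => path_lower hn hG l hl hl1 T hT k q hq
    have h2 := (abs_le.mp (avg_w hn hp hG k l hl)).1
    have h3 : l * (8 * p ^ 2 * k / n) ≤ l * (8 * p ^ 2 * K / n) := by
      have : (k : ℝ) ≤ K := by exact_mod_cast (by omega : k ≤ K)
      gcongr
    have h4 : fk P p H (k + 1) l - fk P p H k l + l * dn p n - l * (8 * p ^ 2 * K / n) ≤
      Ew n (k + 1) (fun q => ∫ ω, max 0 (-Wf p n l k (fun x => H x ω) q) ∂P) := by linarith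
    have h5 := mul_le_mul_of_nonneg_left h4 ha
    push_cast
    linarith

lemma Lam_upper (hn : n ≠ 0) (hp : 1 ≤ p) (hG : GV P H (fun x y => (n : ℝ) * overlap n x y ^ p)) (l s : ℝ)
    (hl : 0 ≤ l) (hs : 0 < s) (k : ℕ) :
    Lam P H k l ≤ 1 + l * (log (k + 1) / s + 2 * p * k * s) + l ^ 2 * k * (dn p n + 8 * p ^ 2 * k / n) := by
  have h1 := Lam_upper' hn hp hG l hl k k le_rfl
  have h2 := mul_le_mul_of_nonneg_left (fk_le hn hG k l s hl hs) hl
  linarith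

lemma Lam_lower (hn : n ≠ 0) (hp : 1 ≤ p) (hG : GV P H (fun x y => (n : ℝ) * overlap n x y ^ p)) (l : ℝ)
    (hl : 0 ≤ l) (hl1 : l ≤ 1) (T : ℝ) (hT : 0 < T) (hlT : l * T ≤ 2) (k : ℕ) :
    (1 - l * T / 2) * (l ^ 2 * k * (dn p n - 8 * p ^ 2 * k / n))
      - k * (l ^ 2 / (2 * T ^ 2) * (48 * exp (4 * p))) ≤ Lam P H k l := by
  have h1 := Lam_lower' hn hp hG l hl hl1 T hT hlT k k le_rfl
  have ha : 0 ≤ l - l ^ 2 * T / 2 := by nlinarith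
  have h2 := mul_nonneg ha (fk_nonneg hG k l)
  linarith

end Laplace


/-! ### Part D : Gaussian tails -/

noncomputable def tl (n : ℕ) (L : ℝ) : ℝ := (gaussianReal 0 (n : NNReal)).real (Set.Ioi L)

lemma tl_eq {n : ℕ} (hn : n ≠ 0) (L : ℝ) :
    tl n L = (√(2 * π * n))⁻¹ * ∫ x in Set.Ioi L, exp (-x ^ 2 / (2 * n)) := by
  have hv : (n : NNReal) ≠ 0 := by exact_mod_cast hn
  unfold tl
  rw [measureReal_def, gaussianReal_apply_eq_integral _ hv, ENNReal.toReal_ofReal]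
  · rw [← integral_const_mul]; simp [gaussianPDFReal]
  · exact integral_nonneg fun x => gaussianPDFReal_nonneg _ _ _

lemma tend_exp_neg_sq {n : ℝ} (hn : 0 < n) : Tendsto (fun x : ℝ => exp (-x ^ 2 / (2 * n))) atTop (nhds 0) := by
  refine tendsto_exp_atBot.comp ?_
  have h : Tendsto (fun x : ℝ => x ^ 2 * (1 / (2 * n))) atTop atTop :=
    (tendsto_pow_atTop (by norm_num)).atTop_mul_const (by positivity)
  refine (tendsto_neg_atTop_atBot.comp h).congr fun x => ?_
  simp only [Function.comp]; ring

lemma int_gauss_Ioi {n : ℝ} (hn : 0 < n) (L : ℝ) :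
    IntegrableOn (fun x : ℝ => exp (-x ^ 2 / (2 * n))) (Set.Ioi L) := by
  have := integrable_exp_neg_mul_sq (b := 1 / (2 * n)) (by positivity)
  refine (this.congr (ae_of_all _ fun x => ?_)).integrableOn
  congr 1; ring

lemma hasDeriv_g {n : ℝ} (hn : 0 < n) (x : ℝ) :
    HasDerivAt (fun x : ℝ => exp (-x ^ 2 / (2 * n))) (exp (-x ^ 2 / (2 * n)) * (-x / n)) x := by
  have h1 : HasDerivAt (fun x : ℝ => -x ^ 2 / (2 * n)) (-x / n) x := by
    have := ((hasDerivAt_pow 2 x).neg).div_const (2 * n)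
    refine HasDerivAt.congr_deriv this ?_
    push_cast
    rw [div_eq_div_iff (by positivity) hn.ne']
    ring
  exact h1.exp

lemma mills_upper {n : ℝ} (hn : 0 < n) {L : ℝ} (hL : 0 < L) :
    ∫ x in Set.Ioi L, exp (-x ^ 2 / (2 * n)) ≤ n / L * exp (-L ^ 2 / (2 * n)) := by
  have hd : ∀ x ∈ Set.Ici L, HasDerivAt (fun x : ℝ => n / L * exp (-x ^ 2 / (2 * n)))
      (n / L * (exp (-x ^ 2 / (2 * n)) * (-x / n))) x := fun x _ => (hasDeriv_g hn x).const_mul _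
  have hneg : ∀ x ∈ Set.Ioi L, n / L * (exp (-x ^ 2 / (2 * n)) * (-x / n)) ≤ 0 := by
    intro x hx
    have hx0 : 0 < x := hL.trans hx
    have : 0 ≤ n / L * (exp (-x ^ 2 / (2 * n)) * (x / n)) := by positivity
    have e : n / L * (exp (-x ^ 2 / (2 * n)) * (-x / n)) = -(n / L * (exp (-x ^ 2 / (2 * n)) * (x / n))) := by ring
    linarith
  have ht : Tendsto (fun x : ℝ => n / L * exp (-x ^ 2 / (2 * n))) atTop (nhds 0) := by
    simpa using (tend_exp_neg_sq hn).const_mul (n / L)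
  have h1 := integral_Ioi_of_hasDerivAt_of_nonpos' hd hneg ht
  have h2 := integrableOn_Ioi_deriv_of_nonpos' hd hneg ht
  have h3 : ∫ x in Set.Ioi L, exp (-x ^ 2 / (2 * n)) ≤ ∫ x in Set.Ioi L, -(n / L * (exp (-x ^ 2 / (2 * n)) * (-x / n))) := by
    refine setIntegral_mono_on (int_gauss_Ioi hn L) h2.neg measurableSet_Ioi fun x hx => ?_
    have hx' : 1 ≤ x / L := by rw [le_div_iff₀ hL]; simpa using hx.le
    have e : -(n / L * (exp (-x ^ 2 / (2 * n)) * (-x / n))) = exp (-x ^ 2 / (2 * n)) * (x / L) := by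
      field_simp
    rw [e]
    exact le_mul_of_one_le_right (exp_pos _).le hx'
  rw [integral_neg, h1] at h3
  linarith

lemma mills_lower {n : ℝ} (hn : 0 < n) {L : ℝ} (hL : 0 < L) (hLn : 2 * n ≤ L ^ 2) :
    n / L * (1 - n / L ^ 2) * exp (-L ^ 2 / (2 * n)) ≤ ∫ x in Set.Ioi L, exp (-x ^ 2 / (2 * n)) := by
  set f : ℝ → ℝ := fun x => n * (x⁻¹ - n * (x ^ 3)⁻¹) * exp (-x ^ 2 / (2 * n)) with hf
  set f' : ℝ → ℝ := fun x => -(1 - 3 * n ^ 2 / x ^ 4) * exp (-x ^ 2 / (2 * n)) with hf'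
  have hd : ∀ x ∈ Set.Ici L, HasDerivAt f (f' x) x := by
    intro x hx
    have hx0 : 0 < x := hL.trans_le hx
    have hx3 : x ^ 3 ≠ 0 := by positivity
    have a := (((hasDerivAt_inv hx0.ne').sub (((hasDerivAt_pow 3 x).inv hx3).const_mul n)).const_mul n).mul (hasDeriv_g hn x)
    refine HasDerivAt.congr_deriv a ?_
    simp only [hf', Pi.sub_apply, Pi.inv_apply, Nat.cast_ofNat, Nat.add_one_sub_one]
    field_simp
    norm_num
    ring
  have hneg : ∀ x ∈ Set.Ioi L, f' x ≤ 0 := by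
    intro x hx
    have hx0 : 0 < x := hL.trans hx
    have hx2 : L ^ 2 ≤ x ^ 2 := by have : L < x := hx; gcongr
    have : 3 * n ^ 2 / x ^ 4 ≤ 1 := by
      rw [div_le_one (by positivity)]; nlinarith [sq_nonneg n, sq_nonneg (x ^ 2)]
    have := mul_nonneg (sub_nonneg.2 this) (exp_pos (-x ^ 2 / (2 * n))).le
    simp only [hf']; linarith
  have ht : Tendsto f atTop (nhds 0) := by
    have h1 : Tendsto (fun x : ℝ => x⁻¹) atTop (nhds 0) := tendsto_inv_atTop_zero
    have h2 : Tendsto (fun x : ℝ => (x ^ 3)⁻¹) atTop (nhds 0) :=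
      tendsto_inv_atTop_zero.comp (tendsto_pow_atTop (by norm_num))
    simpa using ((h1.sub (h2.const_mul n)).const_mul n).mul (tend_exp_neg_sq hn)
  have h1 := integral_Ioi_of_hasDerivAt_of_nonpos' hd hneg ht
  have h2 := integrableOn_Ioi_deriv_of_nonpos' hd hneg ht
  have h3 : ∫ x in Set.Ioi L, -f' x ≤ ∫ x in Set.Ioi L, exp (-x ^ 2 / (2 * n)) := by
    refine setIntegral_mono_on h2.neg (int_gauss_Ioi hn L) measurableSet_Ioi fun x hx => ?_
    have hx0 : 0 < x := hL.trans hx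
    have : 0 ≤ 3 * n ^ 2 / x ^ 4 * exp (-x ^ 2 / (2 * n)) := by positivity
    simp only [hf']; linarith
  rw [integral_neg, h1] at h3
  have e : f L = n / L * (1 - n / L ^ 2) * exp (-L ^ 2 / (2 * n)) := by
    simp only [hf]; field_simp
  linarith

lemma tl_upper {n : ℕ} (hn : n ≠ 0) {L : ℝ} (hL : 0 < L) :
    tl n L ≤ (√(2 * π * n))⁻¹ * (n / L * exp (-L ^ 2 / (2 * n))) := by
  rw [tl_eq hn]
  have : (0 : ℝ) < n := by positivity
  gcongr
  exact mills_upper this hL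

lemma tl_lower {n : ℕ} (hn : n ≠ 0) {L : ℝ} (hL : 0 < L) (hLn : 2 * n ≤ L ^ 2) :
    (√(2 * π * n))⁻¹ * (n / L * (1 - n / L ^ 2) * exp (-L ^ 2 / (2 * n))) ≤ tl n L := by
  rw [tl_eq hn]
  have : (0 : ℝ) < n := by positivity
  gcongr
  exact mills_lower this hL hLn


section Dens
variable {Ω : Type*} [MeasurableSpace Ω] {P : Measure Ω} [IsProbabilityMeasure P]
  {n : ℕ} {p : ℕ} {H : V n → Ω → ℝ}

/-- event that index `j` is the first maximiser, in terms of the conditional field -/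
def fmax (p : ℕ) {n : ℕ} (m : ℕ) (q : ℕ → V n) (j : ℕ) (s : ℝ) (g : V n → ℝ) : Prop :=
  (∀ i < j, g (q i) < (1 - rho p n (q j) (q i)) * s) ∧
  (∀ i ≤ m, g (q i) ≤ (1 - rho p n (q j) (q i)) * s)

lemma fmax_mono (m : ℕ) (q : ℕ → V n) (j : ℕ) {s s' : ℝ} (h : s ≤ s') (g : V n → ℝ)
    (hf : fmax p m q j s g) : fmax p m q j s' g := by
  have key : ∀ i, (1 - rho p n (q j) (q i)) * s ≤ (1 - rho p n (q j) (q i)) * s' := fun i =>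
    mul_le_mul_of_nonneg_left h (by have := rho_le_one p n (q j) (q i); linarith)
  exact ⟨fun i hi => (hf.1 i hi).trans_le (key i), fun i hi => (hf.2 i hi).trans (key i)⟩

lemma fmax_iff (m : ℕ) (q : ℕ → V n) (j : ℕ) (h : V n → ℝ) :
    fmax p m q j (h (q j)) (Gf p (q j) h) ↔
      (∀ i < j, h (q i) < h (q j)) ∧ (∀ i ≤ m, h (q i) ≤ h (q j)) := by
  unfold fmax Gf
  constructor
  · rintro ⟨a, b⟩
    exact ⟨fun i hi => by have := a i hi; linarith, fun i hi => by have := b i hi; linarith⟩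
  · rintro ⟨a, b⟩
    exact ⟨fun i hi => by have := a i hi; linarith, fun i hi => by have := b i hi; linarith⟩

lemma measSet_fmax (m : ℕ) (q : ℕ → V n) (j : ℕ) :
    MeasurableSet {z : ℝ × (V n → ℝ) | fmax p m q j z.1 z.2} := by
  have e : {z : ℝ × (V n → ℝ) | fmax p m q j z.1 z.2} =
      (⋂ i ∈ Set.Iio j, {z | z.2 (q i) < (1 - rho p n (q j) (q i)) * z.1}) ∩
      (⋂ i ∈ Set.Iic m, {z | z.2 (q i) ≤ (1 - rho p n (q j) (q i)) * z.1}) := by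
    ext z; simp [fmax]
  rw [e]
  refine MeasurableSet.inter ?_ ?_
  · exact MeasurableSet.biInter (Set.to_countable _) fun i _ => measurableSet_lt (by fun_prop) (by fun_prop)
  · exact MeasurableSet.biInter (Set.to_countable _) fun i _ => measurableSet_le (by fun_prop) (by fun_prop)

variable (P p H) in
/-- density of the maximum along the path, relative to the Gaussian law -/
noncomputable def dq (m : ℕ) (q : ℕ → V n) (s : ℝ) : ℝ :=
  ∑ j ∈ range (m + 1), P.real {ω | fmax p m q j s (Gf p (q j) (fun x => H x ω))}

lemma dq_mono (m : ℕ) (q : ℕ → V n) : Monotone (dq P p H m q) := by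
  intro s s' h
  unfold dq
  refine sum_le_sum fun j _ => measureReal_mono (fun ω => ?_) (measure_ne_top _ _)
  exact fmax_mono m q j h _

lemma dq_nonneg (m : ℕ) (q : ℕ → V n) (s : ℝ) : 0 ≤ dq P p H m q s :=
  sum_nonneg fun _ _ => measureReal_nonneg

lemma dq_le (m : ℕ) (q : ℕ → V n) (s : ℝ) : dq P p H m q s ≤ m + 1 := by
  unfold dq
  calc _ ≤ ∑ j ∈ range (m + 1), (1 : ℝ) := sum_le_sum fun j _ => measureReal_le_one
    _ = _ := by simp

lemma first_max (m : ℕ) (f : ℕ → ℝ) :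
    ∃! j, j ∈ range (m + 1) ∧ (∀ i < j, f i < f j) ∧ (∀ i ≤ m, f i ≤ f j) := by
  classical
  have hex : ∃ j, j ≤ m ∧ f j = mx m f := by
    obtain ⟨i, hi, h⟩ := mx_ex m f; exact ⟨i, hi, h.symm⟩
  set j := Nat.find hex with hj
  have hs := Nat.find_spec hex
  refine ⟨j, ⟨by simp; omega, ?_, ?_⟩, ?_⟩
  · intro i hi
    have := Nat.find_min hex hi
    have hle := le_mx f (show i ≤ m by omega)
    rw [hs.2]
    refine lt_of_le_of_ne hle fun h => this ⟨by omega, h⟩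
  · intro i hi; rw [hs.2]; exact le_mx f hi
  · rintro k ⟨hk, h1, h2⟩
    simp at hk
    have hk2 : f k = mx m f := le_antisymm (le_mx f (by omega)) (mx_le h2)
    have hle : j ≤ k := Nat.find_min' hex ⟨by omega, hk2⟩
    rcases hle.lt_or_eq with h | h
    · have := h1 j h
      rw [hs.2, hk2] at this
      exact absurd this (lt_irrefl _)
    · exact h.symm

lemma dens_l (hG : GV P H (fun x y => (n : ℝ) * overlap n x y ^ p)) (m : ℕ) (q : ℕ → V n)
    (F : ℝ → ENNReal) (hF : Measurable F) :
    ∫⁻ ω, F (mx m (fun i => H (q i) ω)) ∂P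
      = ∫⁻ s, F s * ENNReal.ofReal (dq P p H m q s) ∂(gaussianReal 0 (n : NNReal)) := by
  classical
  have hFj : ∀ j, Measurable (Function.uncurry fun (s : ℝ) (g : V n → ℝ) =>
      F s * (if fmax p m q j s g then 1 else 0)) := by
    intro j
    refine (hF.comp measurable_fst).mul ?_
    exact Measurable.ite (measSet_fmax m q j) measurable_const measurable_const
  have h1 : ∀ ω, F (mx m (fun i => H (q i) ω)) = ∑ j ∈ range (m + 1),
      F (H (q j) ω) * (if fmax p m q j (H (q j) ω) (Gf p (q j) (fun x => H x ω)) then 1 else 0) := by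
    intro ω
    obtain ⟨j, ⟨hj, h1, h2⟩, hu⟩ := first_max m (fun i => H (q i) ω)
    rw [sum_eq_single_of_mem j hj]
    · rw [if_pos ((fmax_iff m q j (fun x => H x ω)).2 ⟨h1, h2⟩), mul_one]
      congr 1
      simp at hj
      exact le_antisymm (mx_le h2) (le_mx (fun i => H (q i) ω) (by omega))
    · intro k hk hkj
      rw [if_neg, mul_zero]
      intro h
      have := (fmax_iff m q k (fun x => H x ω)).1 h
      exact hkj (hu k ⟨hk, this⟩)
  have hmf := meas_field hG.meas
  simp_rw [h1]
  rw [lintegral_finsetSum]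
  · have h2 : ∀ j, ∫⁻ ω, F (H (q j) ω) * (if fmax p m q j (H (q j) ω) (Gf p (q j) (fun x => H x ω)) then 1 else 0) ∂P
        = ∫⁻ s, F s * ENNReal.ofReal (P.real {ω | fmax p m q j s (Gf p (q j) (fun x => H x ω))}) ∂(gaussianReal 0 (n : NNReal)) := by
      intro j
      rw [dec_field hG (q j) _ (hFj j)]
      congr 1; ext s
      rw [lintegral_const_mul]
      · congr 1
        have hms : MeasurableSet {ω | fmax p m q j s (Gf p (q j) (fun x => H x ω))} :=
          (measSet_fmax (p := p) m q j).preimage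
            ((measurable_const (a := s)).prodMk ((meas_Gf (q j)).comp hmf))
        rw [measureReal_def, ENNReal.ofReal_toReal (measure_ne_top _ _), ← lintegral_indicator_one hms]
        congr 1
      · refine Measurable.ite ((measSet_fmax (p := p) m q j).preimage
            ((measurable_const (a := s)).prodMk ((meas_Gf (q j)).comp hmf))) measurable_const measurable_const
    simp_rw [h2]
    rw [← lintegral_finsetSum']
    · congr 1; ext s
      unfold dq
      rw [ENNReal.ofReal_sum_of_nonneg (fun _ _ => measureReal_nonneg), Finset.mul_sum]
    · intro j _
      refine (hF.mul (ENNReal.measurable_ofReal.comp (Monotone.measurable ?_))).aemeasurable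
      intro s s' h
      exact measureReal_mono (fun ω => fmax_mono m q j h _) (measure_ne_top _ _)
  · intro j _
    exact (hFj j).comp ((hG.meas (q j)).prodMk ((meas_Gf (q j)).comp hmf))

lemma dens (hG : GV P H (fun x y => (n : ℝ) * overlap n x y ^ p)) (m : ℕ) (q : ℕ → V n)
    (F : ℝ → ℝ) (hF : Measurable F) (hF0 : ∀ s, 0 ≤ F s) :
    ∫ ω, F (mx m (fun i => H (q i) ω)) ∂P
      = ∫ s, F s * dq P p H m q s ∂(gaussianReal 0 (n : NNReal)) := by
  have hM := measurable_mx m (fun i ω => H (q i) ω) fun i => hG.meas _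
  have hd : Measurable (dq P p H m q) := (dq_mono m q).measurable
  rw [integral_eq_lintegral_of_nonneg_ae (ae_of_all _ fun _ => hF0 _) (hF.comp hM).aestronglyMeasurable,
    integral_eq_lintegral_of_nonneg_ae (ae_of_all _ fun s => mul_nonneg (hF0 s) (dq_nonneg m q s))
      (hF.mul hd).aestronglyMeasurable, dens_l hG m q (fun s => ENNReal.ofReal (F s)) hF.ennreal_ofReal]
  congr 2; ext s
  rw [ENNReal.ofReal_mul (hF0 s)]
end Dens


section Transfer
variable {Ω : Type*} [MeasurableSpace Ω] {P : Measure Ω} [IsProbabilityMeasure P]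
  {n : ℕ} {p : ℕ} {H : V n → Ω → ℝ}

variable (P p H) in
noncomputable def Qq (m : ℕ) (q : ℕ → V n) (L : ℝ) : ℝ := P.real {ω | L < mx m (fun i => H (q i) ω)}

variable (P p H) in
noncomputable def lq (m : ℕ) (l : ℝ) (q : ℕ → V n) : ℝ :=
  exp (-(l ^ 2 * n / 2)) * ∫ ω, exp (l * mx m (fun i => H (q i) ω)) ∂P

lemma int_mul_dq (m : ℕ) (q : ℕ → V n) (F : ℝ → ℝ) {μ : Measure ℝ} (hF : Integrable F μ) :
    Integrable (fun s => F s * dq P p H m q s) μ := by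
  refine hF.mul_bdd (c := m + 1) (dq_mono m q).measurable.aestronglyMeasurable
    (ae_of_all _ fun s => ?_)
  rw [Real.norm_eq_abs, abs_of_nonneg (dq_nonneg m q s)]; exact dq_le m q s

lemma gr_int (n : ℕ) (l : ℝ) : Integrable (fun s => exp (l * s)) (gaussianReal 0 (n : NNReal)) :=
  integrable_exp_mul_gaussianReal l

lemma gr_exp (n : ℕ) (l : ℝ) : ∫ s, exp (l * s) ∂(gaussianReal 0 (n : NNReal)) = exp (l ^ 2 * n / 2) := by
  have := mgf_gaussianReal (μ := 0) (v := (n : NNReal)) (p := gaussianReal 0 (n : NNReal)) (X := id) (by simp) l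
  simp only [mgf, id] at this
  rw [this]; congr 1; simp; ring

lemma ind_int (n : ℕ) (L : ℝ) : Integrable (fun s => (Set.Ioi L).indicator (fun _ => (1 : ℝ)) s) (gaussianReal 0 (n : NNReal)) :=
  (integrable_const (1 : ℝ)).indicator measurableSet_Ioi

lemma Qq_eq (hG : GV P H (fun x y => (n : ℝ) * overlap n x y ^ p)) (m : ℕ) (q : ℕ → V n) (L : ℝ) :
    Qq P H m q L = ∫ s, (Set.Ioi L).indicator (fun _ => (1 : ℝ)) s * dq P p H m q s ∂(gaussianReal 0 (n : NNReal)) := by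
  have hM := measurable_mx m (fun i ω => H (q i) ω) fun i => hG.meas _
  rw [← dens hG m q _ (measurable_const.indicator measurableSet_Ioi)
    (fun s => Set.indicator_nonneg (fun _ _ => zero_le_one) _)]
  unfold Qq
  rw [← integral_indicator_one (measurableSet_lt measurable_const hM)]
  congr 1

lemma lq_eq (hG : GV P H (fun x y => (n : ℝ) * overlap n x y ^ p)) (m : ℕ) (q : ℕ → V n) (l : ℝ) :
    ∫ ω, exp (l * mx m (fun i => H (q i) ω)) ∂P =
      ∫ s, exp (l * s) * dq P p H m q s ∂(gaussianReal 0 (n : NNReal)) :=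
  dens hG m q (fun s => exp (l * s)) (by fun_prop) (fun s => (exp_pos _).le)

lemma pp1 (hG : GV P H (fun x y => (n : ℝ) * overlap n x y ^ p)) (m : ℕ) (q : ℕ → V n) (L s : ℝ) :
    Qq P H m q L ≤ dq P p H m q s * tl n L + Qq P H m q s := by
  rw [Qq_eq hG m q L, Qq_eq hG m q s]
  have e : dq P p H m q s * tl n L = ∫ x, dq P p H m q s * (Set.Ioi L).indicator (fun _ => (1 : ℝ)) x ∂(gaussianReal 0 (n : NNReal)) := by
    rw [integral_const_mul]; congr 1
    unfold tl
    rw [← integral_indicator_one measurableSet_Ioi]; congr 1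
  rw [e, ← integral_add ((ind_int n L).const_mul _) (int_mul_dq m q _ (ind_int n s))]
  refine integral_mono (int_mul_dq m q _ (ind_int n L))
    (((ind_int n L).const_mul _).add (int_mul_dq m q _ (ind_int n s))) fun x => ?_
  have h0 := dq_nonneg (P := P) (p := p) (H := H) m q x
  have h1 := dq_nonneg (P := P) (p := p) (H := H) m q s
  simp only [Set.indicator_apply, Set.mem_Ioi]
  rcases le_or_gt x s with h | h
  · have := dq_mono (P := P) (p := p) (H := H) m q h
    split_ifs <;> linarith
  · rw [if_pos h]; split_ifs <;> linarith

lemma pp2 (hG : GV P H (fun x y => (n : ℝ) * overlap n x y ^ p)) (m : ℕ) (q : ℕ → V n) (L : ℝ) :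
    dq P p H m q L * tl n L ≤ Qq P H m q L := by
  rw [Qq_eq hG m q L]
  have e : dq P p H m q L * tl n L = ∫ x, dq P p H m q L * (Set.Ioi L).indicator (fun _ => (1 : ℝ)) x ∂(gaussianReal 0 (n : NNReal)) := by
    rw [integral_const_mul]; congr 1
    unfold tl
    rw [← integral_indicator_one measurableSet_Ioi]; congr 1
  rw [e]
  refine integral_mono ((ind_int n L).const_mul _) (int_mul_dq m q _ (ind_int n L)) fun x => ?_
  simp only [Set.indicator_apply, Set.mem_Ioi]
  split_ifs with h
  · have := dq_mono (P := P) (p := p) (H := H) m q h.le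
    linarith
  · simp

lemma pp3 (hn : n ≠ 0) (hG : GV P H (fun x y => (n : ℝ) * overlap n x y ^ p)) (m : ℕ) (q : ℕ → V n) (l s : ℝ)
    (hs : s ≤ l * n) :
    dq P p H m q s * (1 - exp (-((l * n - s) ^ 2 / (2 * n)))) ≤ lq P H m l q := by
  have hn0 : (0 : ℝ) < n := by positivity
  unfold lq
  rw [lq_eq hG]
  set h := (l * n - s) / n with hh
  have h0 : 0 ≤ h := div_nonneg (by linarith) hn0.le
  have i1 := gr_int n l
  have i2 := gr_int n (l - h)
  have key : dq P p H m q s * (exp (l ^ 2 * n / 2) - exp (h * s) * exp ((l - h) ^ 2 * n / 2)) ≤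
      ∫ x, exp (l * x) * dq P p H m q x ∂(gaussianReal 0 (n : NNReal)) := by
    rw [← gr_exp n l, ← gr_exp n (l - h), ← integral_const_mul (exp (h * s)), ← integral_sub i1 (i2.const_mul _),
      ← integral_const_mul]
    refine integral_mono ((i1.sub (i2.const_mul _)).const_mul _) (int_mul_dq m q _ i1) fun x => ?_
    have d0 := dq_nonneg (P := P) (p := p) (H := H) m q x
    have d1 := dq_nonneg (P := P) (p := p) (H := H) m q s
    have ex := exp_pos (l * x)
    have e1 : exp (h * s) * exp ((l - h) * x) = exp (l * x) * exp (h * (s - x)) := by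
      rw [← exp_add, ← exp_add]; congr 1; ring
    simp only []
    rw [e1]
    rcases le_or_gt s x with hx | hx
    · have := dq_mono (P := P) (p := p) (H := H) m q hx
      have h3 := exp_pos (h * (s - x))
      have : dq P p H m q s * exp (l * x) ≤ exp (l * x) * dq P p H m q x := by nlinarith
      have : 0 ≤ dq P p H m q s * (exp (l * x) * exp (h * (s - x))) := by positivity
      linarith
    · have h3 : 1 ≤ exp (h * (s - x)) := one_le_exp (mul_nonneg h0 (by linarith))
      have : exp (l * x) - exp (l * x) * exp (h * (s - x)) ≤ 0 := by nlinarith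
      have a := mul_nonpos_of_nonneg_of_nonpos d1 this
      have b : 0 ≤ exp (l * x) * dq P p H m q x := by positivity
      linarith
  have e2 : exp (h * s) * exp ((l - h) ^ 2 * n / 2) = exp (l ^ 2 * n / 2) * exp (-((l * n - s) ^ 2 / (2 * n))) := by
    rw [← exp_add, ← exp_add]; congr 1
    rw [hh]; field_simp; ring
  rw [e2] at key
  have e3 := exp_pos (-(l ^ 2 * n / 2))
  have e4 : exp (-(l ^ 2 * n / 2)) * exp (l ^ 2 * n / 2) = 1 := by rw [← exp_add]; simp
  have := mul_le_mul_of_nonneg_left key e3.le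
  refine le_trans (le_of_eq ?_) this
  linear_combination -(dq P p H m q s * (1 - exp (-((l * n - s) ^ 2 / (2 * n))))) * e4

lemma pp4 (hG : GV P H (fun x y => (n : ℝ) * overlap n x y ^ p)) (m : ℕ) (q : ℕ → V n) (l s h : ℝ)
    (h0 : 0 ≤ h) :
    lq P H m l q ≤ dq P p H m q s + exp (l * h * n + h ^ 2 * n / 2 - h * s) * lq P H m (l + h) q := by
  unfold lq
  rw [lq_eq hG, lq_eq hG]
  have i1 := gr_int n l
  have i2 := gr_int n (l + h)
  have key : ∫ x, exp (l * x) * dq P p H m q x ∂(gaussianReal 0 (n : NNReal)) ≤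
      dq P p H m q s * exp (l ^ 2 * n / 2) + exp (-(h * s)) *
        ∫ x, exp ((l + h) * x) * dq P p H m q x ∂(gaussianReal 0 (n : NNReal)) := by
    rw [← gr_exp n l, ← integral_const_mul, ← integral_const_mul, ← integral_add (i1.const_mul _) ((int_mul_dq m q _ i2).const_mul _)]
    refine integral_mono (int_mul_dq m q _ i1) ((i1.const_mul _).add ((int_mul_dq m q _ i2).const_mul _)) fun x => ?_
    have d0 := dq_nonneg (P := P) (p := p) (H := H) m q x
    have d1 := dq_nonneg (P := P) (p := p) (H := H) m q s
    have ex := exp_pos (l * x)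
    have e1 : exp (-(h * s)) * exp ((l + h) * x) = exp (l * x) * exp (h * (x - s)) := by
      rw [← exp_add, ← exp_add]; congr 1; ring
    simp only []
    rw [← mul_assoc, e1]
    rcases le_or_gt x s with hx | hx
    · have := dq_mono (P := P) (p := p) (H := H) m q hx
      have h3 := exp_pos (h * (x - s))
      have : exp (l * x) * dq P p H m q x ≤ dq P p H m q s * exp (l * x) := by nlinarith
      have : 0 ≤ exp (l * x) * exp (h * (x - s)) * dq P p H m q x := by positivity
      linarith
    · have h3 : 1 ≤ exp (h * (x - s)) := one_le_exp (mul_nonneg h0 (by linarith))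
      have a : 0 ≤ dq P p H m q s * exp (l * x) := by positivity
      have b : 0 ≤ exp (l * x) * dq P p H m q x := by positivity
      nlinarith
  set I := ∫ x, exp ((l + h) * x) * dq P p H m q x ∂(gaussianReal 0 (n : NNReal))
  have e3 := exp_pos (-(l ^ 2 * n / 2))
  have e4 : exp (-(l ^ 2 * n / 2)) * exp (l ^ 2 * n / 2) = 1 := by rw [← exp_add]; simp
  have e5 : exp (l * h * n + h ^ 2 * n / 2 - h * s) * exp (-((l + h) ^ 2 * n / 2)) = exp (-(l ^ 2 * n / 2)) * exp (-(h * s)) := by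
    rw [← exp_add, ← exp_add]; congr 1; ring
  have := mul_le_mul_of_nonneg_left key e3.le
  refine le_trans this (le_of_eq ?_)
  linear_combination (dq P p H m q s) * e4 - I * e5

lemma pp5 (hG : GV P H (fun x y => (n : ℝ) * overlap n x y ^ p)) (m : ℕ) (q : ℕ → V n) (l s : ℝ)
    (hl : 0 ≤ l) : Qq P H m q s ≤ exp (l ^ 2 * n / 2 - l * s) * lq P H m l q := by
  unfold Qq lq
  have hM := measurable_mx m (fun i ω => H (q i) ω) fun i => hG.meas _
  have hI := int_exp_mx hG m l q
  have : P.real {ω | s < mx m (fun i => H (q i) ω)} ≤ exp (-(l * s)) * ∫ ω, exp (l * mx m (fun i => H (q i) ω)) ∂P := by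
    rw [← integral_indicator_one (measurableSet_lt measurable_const hM), ← integral_const_mul]
    refine integral_mono ((integrable_const (1 : ℝ)).indicator (measurableSet_lt measurable_const hM)) (hI.const_mul _) fun ω => ?_
    simp only [Set.indicator_apply, Set.mem_setOf_eq]
    rw [← exp_add]
    split_ifs with h
    · exact one_le_exp (by nlinarith)
    · positivity
  refine this.trans (le_of_eq ?_)
  rw [← mul_assoc, ← exp_add]; congr 2; ring

/-! averaged quantities -/
variable (P p H) in
noncomputable def QM (m : ℕ) (L : ℝ) : ℝ := Ew n m (fun q => Qq P H m q L)
variable (P p H) in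
noncomputable def GM (m : ℕ) (s : ℝ) : ℝ := Ew n m (fun q => dq P p H m q s)

lemma Lam_eq (m : ℕ) (l : ℝ) : Lam P H m l = Ew n m (lq P H m l) := rfl

lemma QM_le (hG : GV P H (fun x y => (n : ℝ) * overlap n x y ^ p)) (m : ℕ) (L s : ℝ) :
    QM P H m L ≤ GM P p H m s * tl n L + QM P H m s := by
  unfold QM GM
  rw [← Ew_mul_right, ← Ew_add]
  exact Ew_mono _ _ fun q _ => pp1 hG m q L s

lemma QM_ge (hG : GV P H (fun x y => (n : ℝ) * overlap n x y ^ p)) (m : ℕ) (L : ℝ) :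
    GM P p H m L * tl n L ≤ QM P H m L := by
  unfold QM GM
  rw [← Ew_mul_right]
  exact Ew_mono _ _ fun q _ => pp2 hG m q L

lemma GM_le_Lam (hn : n ≠ 0) (hG : GV P H (fun x y => (n : ℝ) * overlap n x y ^ p)) (m : ℕ) (l s : ℝ)
    (hs : s ≤ l * n) : GM P p H m s * (1 - exp (-((l * n - s) ^ 2 / (2 * n)))) ≤ Lam P H m l := by
  rw [Lam_eq]; unfold GM
  rw [← Ew_mul_right]
  exact Ew_mono _ _ fun q _ => pp3 hn hG m q l s hs

lemma Lam_le_GM (hG : GV P H (fun x y => (n : ℝ) * overlap n x y ^ p)) (m : ℕ) (l s h : ℝ)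
    (h0 : 0 ≤ h) :
    Lam P H m l ≤ GM P p H m s + exp (l * h * n + h ^ 2 * n / 2 - h * s) * Lam P H m (l + h) := by
  rw [Lam_eq, Lam_eq]; unfold GM
  rw [← Ew_mul_left, ← Ew_add]
  exact Ew_mono _ _ fun q _ => pp4 hG m q l s h h0

lemma QM_markov (hG : GV P H (fun x y => (n : ℝ) * overlap n x y ^ p)) (m : ℕ) (l s : ℝ)
    (hl : 0 ≤ l) : QM P H m s ≤ exp (l ^ 2 * n / 2 - l * s) * Lam P H m l := by
  rw [Lam_eq]; unfold QM
  rw [← Ew_mul_left]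
  exact Ew_mono _ _ fun q _ => pp5 hG m q l s hl

lemma GM_mono (m : ℕ) : Monotone (GM P p H m) := fun s s' h => by
  unfold GM
  exact Ew_mono _ _ fun q _ => dq_mono m q h
end Transfer


/-! ### asymptotic parameters -/

lemma nrp_top {a : ℝ} (ha : 0 < a) : Tendsto (fun n : ℕ => (n : ℝ) ^ a) atTop atTop :=
  (tendsto_rpow_atTop ha).comp tendsto_natCast_atTop_atTop

lemma nrp_zero {a : ℝ} (ha : a < 0) : Tendsto (fun n : ℕ => (n : ℝ) ^ a) atTop (nhds 0) := by
  have := (tendsto_rpow_neg_atTop (neg_pos.2 ha)).comp (tendsto_natCast_atTop_atTop (R := ℝ))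
  rw [neg_neg] at this
  exact this

lemma poly_exp {a K : ℝ} (A : ℝ) (ha : 0 < a) (hK : 0 < K) :
    Tendsto (fun n : ℕ => (n : ℝ) ^ A * exp (-(K * (n : ℝ) ^ a))) atTop (nhds 0) := by
  have h := (tendsto_rpow_mul_exp_neg_mul_atTop_nhds_zero (A / a) K hK).comp (nrp_top ha)
  refine h.congr fun n => ?_
  simp only [Function.comp]
  rw [← rpow_mul (Nat.cast_nonneg n)]
  congr 2
  · field_simp
  · ring

lemma log_rpow {a : ℝ} (ha : 0 < a) : Tendsto (fun n : ℕ => log n / (n : ℝ) ^ a) atTop (nhds 0) := by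
  have := (isLittleO_log_rpow_atTop ha).tendsto_div_nhds_zero
  exact this.comp tendsto_natCast_atTop_atTop

noncomputable def bb (c : ℝ) : ℝ := (1 - 2 * c) / 4
noncomputable def mm (c : ℝ) (n : ℕ) : ℕ := ⌈(n : ℝ) ^ (2 * c + bb c)⌉₊
noncomputable def Lv (c : ℝ) (n : ℕ) (v : ℝ) : ℝ := γseq c n * n + log v / γseq c n
noncomputable def Sn (c : ℝ) (n : ℕ) (t : ℝ) : ℝ := aseq c n * t / mm c n

section par
variable {c : ℝ} (hc0 : 0 < c) (hc1 : c < 1 / 2)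

lemma ev_pos : ∀ᶠ n : ℕ in atTop, 0 < (n : ℝ) := by
  filter_upwards [eventually_gt_atTop 0] with n hn; exact_mod_cast hn

lemma gm_pos {n : ℕ} (hn : 0 < (n : ℝ)) : 0 < γseq c n := rpow_pos_of_pos hn _

lemma gm_sq {n : ℕ} (hn : 0 < (n : ℝ)) : γseq c n ^ 2 * n = (n : ℝ) ^ (1 - 2 * c) := by
  unfold γseq
  rw [← rpow_natCast, ← rpow_mul hn.le]
  nth_rewrite 2 [← rpow_one (n : ℝ)]
  rw [← rpow_add hn]; congr 1; push_cast; ring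

lemma bb_pos (hc1 : c < 1 / 2) : 0 < bb c := by unfold bb; linarith

lemma gm_zero (hc0 : 0 < c) : Tendsto (fun n => γseq c n) atTop (nhds 0) := nrp_zero (by linarith)

lemma w_top (hc1 : c < 1 / 2) : Tendsto (fun n : ℕ => γseq c n ^ 2 * n) atTop atTop := by
  refine (nrp_top (show 0 < 1 - 2 * c by linarith)).congr' ?_
  filter_upwards [ev_pos] with n hn
  exact (gm_sq hn).symm

lemma mm_ge (n : ℕ) : (n : ℝ) ^ (2 * c + bb c) ≤ mm c n := Nat.le_ceil _

lemma mm_le {n : ℕ} (hc0 : 0 < c) (hc1 : c < 1 / 2) (hn : 0 < n) : (mm c n : ℝ) ≤ 2 * (n : ℝ) ^ (2 * c + bb c) := by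
  have h1 : (mm c n : ℝ) < (n : ℝ) ^ (2 * c + bb c) + 1 := Nat.ceil_lt_add_one (by positivity)
  have h2 : 1 ≤ (n : ℝ) ^ (2 * c + bb c) := one_le_rpow (by exact_mod_cast hn) (by have := bb_pos hc1; linarith)
  linarith

lemma mm_pos {n : ℕ} (hn : 0 < n) : (0 : ℝ) < mm c n :=
  lt_of_lt_of_le (rpow_pos_of_pos (by exact_mod_cast hn) _) (mm_ge n)

lemma gm_mm {n : ℕ} (hn : 0 < (n : ℝ)) : (n : ℝ) ^ bb c ≤ γseq c n ^ 2 * mm c n := by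
  have : (n : ℝ) ^ bb c = γseq c n ^ 2 * (n : ℝ) ^ (2 * c + bb c) := by
    unfold γseq
    rw [← rpow_natCast, ← rpow_mul hn.le, ← rpow_add hn]; congr 1; push_cast; ring
  rw [this]; gcongr; exact mm_ge n

lemma mm_div (hc0 : 0 < c) (hc1 : c < 1 / 2) : Tendsto (fun n : ℕ => (mm c n : ℝ) / n) atTop (nhds 0) := by
  have h := (nrp_zero (show 2 * c + bb c - 1 < 0 by unfold bb; linarith)).const_mul 2
  rw [mul_zero] at h
  refine squeeze_zero' (Eventually.of_forall fun n => by positivity) ?_ h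
  filter_upwards [eventually_gt_atTop 0] with n hn
  have hn' : (0 : ℝ) < n := by exact_mod_cast hn
  rw [rpow_sub hn', rpow_one, div_le_iff₀ hn']
  have := mm_le hc0 hc1 hn
  field_simp
  linarith

lemma mm_top (hc0 : 0 < c) (hc1 : c < 1 / 2) : Tendsto (fun n : ℕ => (mm c n : ℝ)) atTop atTop :=
  tendsto_atTop_mono (fun n => mm_ge n) (nrp_top (by have := bb_pos hc1; linarith))

lemma log_mm (hc0 : 0 < c) (hc1 : c < 1 / 2) {a : ℝ} (ha : 0 < a) :
    Tendsto (fun n : ℕ => log (mm c n + 1) / (n : ℝ) ^ a) atTop (nhds 0) := by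
  have h := (((nrp_top ha).inv_tendsto_atTop.const_mul (log 3)).add (log_rpow ha))
  simp only [mul_zero, add_zero] at h
  refine squeeze_zero' ?_ ?_ h
  · filter_upwards with n
    exact div_nonneg (log_nonneg (by simp)) (by positivity)
  · filter_upwards [eventually_gt_atTop 0, (mm_div hc0 hc1).eventually (gt_mem_nhds one_pos)] with n hn h1
    have hn' : (0 : ℝ) < n := by exact_mod_cast hn
    have hn1 : (1 : ℝ) ≤ n := by exact_mod_cast hn
    rw [div_lt_one hn'] at h1
    have : log (mm c n + 1) ≤ log 3 + log n := by
      rw [← log_mul (by norm_num) hn'.ne']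
      exact log_le_log (by positivity) (by linarith)
    calc _ ≤ (log 3 + log n) / (n : ℝ) ^ a := by gcongr
      _ = _ := by rw [add_div]; simp [div_eq_mul_inv]

lemma dn_tend (p : ℕ) : Tendsto (fun n : ℕ => dn p n) atTop (nhds (2 * p)) := by
  have hd : HasDerivAt (fun x : ℝ => (1 - 2 * x) ^ p) (-(2 * p)) 0 := by
    have := (((hasDerivAt_id (0 : ℝ)).const_mul 2).const_sub 1).fun_pow p
    refine HasDerivAt.congr_deriv this ?_
    simp; ring
  have h := hd.tendsto_slope_zero_right
  have h2 : Tendsto (fun n : ℕ => ((n : ℝ))⁻¹) atTop (nhdsWithin 0 (Set.Ioi 0)) :=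
    tendsto_inv_atTop_nhdsGT_zero.comp tendsto_natCast_atTop_atTop
  have h3 := (h.comp h2).neg
  rw [neg_neg] at h3
  refine h3.congr fun n => ?_
  simp only [Function.comp, dn, smul_eq_mul, inv_inv, zero_add, mul_zero, sub_zero, one_pow]
  rw [div_eq_mul_inv]; ring

/-- Laplace functional asymptotics -/
lemma Lam_tend (hc0 : 0 < c) (hc1 : c < 1 / 2) {p : ℕ} (hp : 1 ≤ p)
    {Ω : Type*} [MeasurableSpace Ω] {P : Measure Ω} [IsProbabilityMeasure P]
    {H : (n : ℕ) → V n → Ω → ℝ} (hG : ∀ n, GV P (H n) (fun x y => (n : ℝ) * overlap n x y ^ p))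
    {k : ℝ} (hk : 0 < k) :
    Tendsto (fun n => Lam P (H n) (mm c n) (k * γseq c n) / (γseq c n ^ 2 * mm c n)) atTop
      (nhds (k ^ 2 * (2 * p))) := by
  have hb := bb_pos hc1
  -- upper
  have hU : Tendsto (fun n : ℕ => ((n : ℝ) ^ bb c)⁻¹ + log (mm c n + 1) / (n : ℝ) ^ (bb c / 2)
      + k ^ 2 * (2 * p * (n : ℝ) ^ (-(bb c / 2))) + k ^ 2 * (dn p n + 8 * p ^ 2 * ((mm c n : ℝ) / n))) atTop
      (nhds (0 + 0 + k ^ 2 * (2 * p * 0) + k ^ 2 * (2 * p + 8 * p ^ 2 * 0))) := by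
    refine (((nrp_top hb).inv_tendsto_atTop.add (log_mm hc0 hc1 (half_pos hb))).add
      (((nrp_zero (show -(bb c / 2) < 0 by linarith)).const_mul _).const_mul _)).add
      (((dn_tend p).add ((mm_div hc0 hc1).const_mul _)).const_mul _)
  have hg : Tendsto (fun n => k * γseq c n) atTop (nhds 0) := by simpa using (gm_zero hc0).const_mul k
  have hsq : Tendsto (fun n => √(k * γseq c n)) atTop (nhds 0) := by
    have := (continuous_sqrt.tendsto 0).comp hg
    rw [sqrt_zero] at this
    exact this
  have hL : Tendsto (fun n : ℕ => k ^ 2 * ((1 - √(k * γseq c n) / 2) * (dn p n - 8 * p ^ 2 * ((mm c n : ℝ) / n))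
      - k * γseq c n / 2 * (48 * exp (4 * p)))) atTop
      (nhds (k ^ 2 * ((1 - 0 / 2) * (2 * p - 8 * p ^ 2 * 0) - 0 / 2 * (48 * exp (4 * p))))) := by
    refine Tendsto.const_mul _ (Tendsto.sub (Tendsto.mul (tendsto_const_nhds.sub (hsq.div_const 2))
      ((dn_tend p).sub ((mm_div hc0 hc1).const_mul _))) ((hg.div_const 2).mul_const _))
  have e1 : (0 + 0 + k ^ 2 * (2 * p * 0) + k ^ 2 * (2 * p + 8 * p ^ 2 * 0) : ℝ) = k ^ 2 * (2 * p) := by ring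
  have e2 : (k ^ 2 * ((1 - 0 / 2) * (2 * p - 8 * p ^ 2 * 0) - 0 / 2 * (48 * exp (4 * p))) : ℝ) = k ^ 2 * (2 * p) := by ring
  rw [e1] at hU
  rw [e2] at hL
  refine tendsto_of_tendsto_of_tendsto_of_le_of_le' hL hU ?_ ?_
  · filter_upwards [eventually_gt_atTop 0, hg.eventually (gt_mem_nhds one_pos)] with n hn hl1
    have hn' : (0 : ℝ) < n := by exact_mod_cast hn
    have hγ := gm_pos (c := c) hn'
    have hl : 0 < k * γseq c n := by positivity
    have hm := mm_pos (c := c) hn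
    set l := k * γseq c n with hl_def
    set T := (√l)⁻¹ with hT
    have hsl : 0 < √l := sqrt_pos.2 hl
    have hss : √l * √l = l := mul_self_sqrt hl.le
    have hlT : l * T = √l := by rw [hT]; field_simp; rw [sq]; exact hss.symm
    have hs1 : √l ≤ 1 := by rw [sqrt_le_one]; exact hl1.le
    have hT2 : l ^ 2 / (2 * T ^ 2) = l ^ 3 / 2 := by
      have : T ^ 2 = l⁻¹ := by rw [hT, inv_pow, sq, hss]
      rw [this]; field_simp
    have := Lam_lower (P := P) (H := H n) hn.ne' hp (hG n) l hl.le hl1.le T (by positivity) (by rw [hlT]; linarith) (mm c n)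
    rw [hlT, hT2] at this
    rw [le_div_iff₀ (by positivity)]
    refine le_trans (le_of_eq ?_) this
    rw [hl_def]
    field_simp
  · filter_upwards [eventually_gt_atTop 0] with n hn
    have hn' : (0 : ℝ) < n := by exact_mod_cast hn
    have hγ := gm_pos (c := c) hn'
    have hm := mm_pos (c := c) hn
    set d := (n : ℝ) ^ (-(bb c / 2)) with hd
    have hd0 : 0 < d := by positivity
    have hl : 0 < k * γseq c n := by positivity
    have := Lam_upper (P := P) (H := H n) hn.ne' hp (hG n) (k * γseq c n) (d * (k * γseq c n)) hl.le (by positivity) (mm c n)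
    rw [div_le_iff₀ (by positivity)]
    refine this.trans ?_
    have h1 := gm_mm (c := c) hn'
    have h2 : d * (n : ℝ) ^ (bb c / 2) = 1 := by rw [hd, ← rpow_add hn']; simp
    have h3 : (n : ℝ) ^ bb c = (n : ℝ) ^ (bb c / 2) * (n : ℝ) ^ (bb c / 2) := by rw [← rpow_add hn']; congr 1; ring
    set N2 := (n : ℝ) ^ (bb c / 2) with hN2
    have hN : 0 < N2 := by positivity
    have hdN : d = N2⁻¹ := eq_inv_of_mul_eq_one_left h2
    have hlog : 0 ≤ log (mm c n + 1) := log_nonneg (by simp)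
    have a1 : 1 ≤ ((n : ℝ) ^ bb c)⁻¹ * (γseq c n ^ 2 * mm c n) := by
      rw [inv_mul_eq_div, le_div_iff₀ (by positivity)]; linarith
    have a2 : k * γseq c n * (log (mm c n + 1) / (d * (k * γseq c n))) ≤ log (mm c n + 1) / N2 * (γseq c n ^ 2 * mm c n) := by
      have : k * γseq c n * (log (mm c n + 1) / (d * (k * γseq c n))) = log (mm c n + 1) / N2 * (N2 * N2) := by
        rw [hdN]; field_simp
      rw [this, ← h3]
      gcongr
    have a3 : k * γseq c n * (2 * p * mm c n * (d * (k * γseq c n))) = k ^ 2 * (2 * p * d) * (γseq c n ^ 2 * mm c n) := by ring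
    have a4 : (k * γseq c n) ^ 2 * mm c n * (dn p n + 8 * p ^ 2 * mm c n / n) = k ^ 2 * (dn p n + 8 * p ^ 2 * (mm c n / n)) * (γseq c n ^ 2 * mm c n) := by ring
    rw [a4, mul_add (k * γseq c n), a3]
    linarith
end par


section C1
variable {c : ℝ}

lemma Lv_eq {n : ℕ} (hn : 0 < (n : ℝ)) (v : ℝ) :
    Lv c n v = γseq c n * n * (1 + log v / (γseq c n ^ 2 * n)) := by
  have := gm_pos (c := c) hn
  unfold Lv; field_simp

lemma r_tend (hc1 : c < 1 / 2) (a : ℝ) : Tendsto (fun n : ℕ => 1 + a / (γseq c n ^ 2 * n)) atTop (nhds 1) := by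
  have := (w_top hc1).const_div_atTop a
  simpa using this.const_add 1

lemma Lv_sq {n : ℕ} (hn : 0 < (n : ℝ)) (v : ℝ) :
    γseq c n ^ 2 * n / 2 + -(Lv c n v) ^ 2 / (2 * n) = -log v - (log v) ^ 2 / 2 / (γseq c n ^ 2 * n) := by
  have := gm_pos (c := c) hn
  unfold Lv; field_simp; ring

lemma tl_tend (hc0 : 0 < c) (hc1 : c < 1 / 2) {v : ℝ} (hv : 0 < v) :
    Tendsto (fun n => aseq c n * γseq c n ^ 2 * tl n (Lv c n v)) atTop (nhds v⁻¹) := by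
  have hr := r_tend hc1 (log v)
  have hE : Tendsto (fun n : ℕ => exp (-log v - (log v) ^ 2 / 2 / (γseq c n ^ 2 * n))) atTop (nhds v⁻¹) := by
    have h1 := ((w_top hc1).const_div_atTop ((log v) ^ 2 / 2)).const_sub (-log v)
    have h2 := (continuous_exp.tendsto _).comp h1
    have e : exp (-log v - 0) = v⁻¹ := by rw [sub_zero, exp_neg, exp_log hv]
    rw [e] at h2; exact h2
  have hU : Tendsto (fun n : ℕ => (1 + log v / (γseq c n ^ 2 * n))⁻¹ *
      exp (-log v - (log v) ^ 2 / 2 / (γseq c n ^ 2 * n))) atTop (nhds v⁻¹) := by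
    simpa using (hr.inv₀ one_ne_zero).mul hE
  have hw := w_top hc1
  have hq : Tendsto (fun n : ℕ => γseq c n ^ 2 * n * (1 + log v / (γseq c n ^ 2 * n)) ^ 2) atTop atTop := by
    refine hw.atTop_mul_pos one_pos ?_
    simpa using hr.pow 2
  have hL : Tendsto (fun n : ℕ => (1 + log v / (γseq c n ^ 2 * n))⁻¹ *
      (1 - (γseq c n ^ 2 * n * (1 + log v / (γseq c n ^ 2 * n)) ^ 2)⁻¹) *
      exp (-log v - (log v) ^ 2 / 2 / (γseq c n ^ 2 * n))) atTop (nhds v⁻¹) := by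
    simpa using ((hr.inv₀ one_ne_zero).mul (hq.inv_tendsto_atTop.const_sub 1)).mul hE
  have hev : ∀ᶠ n : ℕ in atTop, 0 < 1 + log v / (γseq c n ^ 2 * n) := hr.eventually (lt_mem_nhds one_pos)
  have ha : ∀ n : ℕ, 0 < (n : ℝ) → ∀ X, aseq c n * γseq c n ^ 2 * ((√(2 * π * n))⁻¹ * (X * exp (-(Lv c n v) ^ 2 / (2 * n))))
      = γseq c n * X * exp (-log v - (log v) ^ 2 / 2 / (γseq c n ^ 2 * n)) := by
    intro n hn X
    have := gm_pos (c := c) hn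
    rw [← Lv_sq hn, exp_add]
    unfold aseq
    have : √(2 * π * n) ≠ 0 := by positivity
    field_simp
  have hapos : ∀ n : ℕ, 0 ≤ aseq c n * γseq c n ^ 2 := fun n => by
    have : 0 ≤ γseq c n := by unfold γseq; positivity
    unfold aseq; positivity
  refine tendsto_of_tendsto_of_tendsto_of_le_of_le' hL hU ?_ ?_
  · filter_upwards [eventually_gt_atTop 0, hev, hq.eventually_ge_atTop 2] with n hn h1 h2
    have hn' : (0 : ℝ) < n := by exact_mod_cast hn
    have hγ := gm_pos (c := c) hn'
    have hLp : 0 < Lv c n v := by rw [Lv_eq hn']; positivity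
    set r := 1 + log v / (γseq c n ^ 2 * n) with hr_def
    have hLsq : Lv c n v ^ 2 = n * (γseq c n ^ 2 * n * r ^ 2) := by rw [Lv_eq hn']; ring
    have := mul_le_mul_of_nonneg_left (tl_lower hn.ne' hLp (by rw [hLsq]; nlinarith)) (hapos n)
    rw [ha n hn'] at this
    refine le_trans (le_of_eq ?_) this
    rw [hLsq, Lv_eq hn', ← hr_def]
    clear_value r
    have hr2 : γseq c n ^ 2 * n * r ^ 2 ≠ 0 := by positivity
    field_simp
  · filter_upwards [eventually_gt_atTop 0, hev] with n hn h1
    have hn' : (0 : ℝ) < n := by exact_mod_cast hn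
    have hγ := gm_pos (c := c) hn'
    have hLp : 0 < Lv c n v := by rw [Lv_eq hn']; positivity
    have := mul_le_mul_of_nonneg_left (tl_upper hn.ne' hLp) (hapos n)
    rw [ha n hn'] at this
    refine this.trans (le_of_eq ?_)
    rw [Lv_eq hn']
    field_simp

lemma an_exp (hc0 : 0 < c) (hc1 : c < 1 / 2) {d : ℝ} (hd : 0 < d) (A : ℝ) :
    Tendsto (fun n : ℕ => (n : ℝ) ^ A * (aseq c n * exp (-((1 + d) * (γseq c n ^ 2 * n) / 2)))) atTop (nhds 0) := by
  have h := ((poly_exp (A + 1 / 2 + c) (show 0 < 1 - 2 * c by linarith) (show 0 < d / 2 by linarith)).const_mul (√(2 * π)))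
  rw [mul_zero] at h
  refine h.congr' ?_
  filter_upwards [ev_pos] with n hn
  unfold aseq
  rw [gm_sq hn, sqrt_mul (show 0 ≤ 2 * π by positivity) (n : ℝ)]
  have e1 : (γseq c n)⁻¹ = (n : ℝ) ^ c := by unfold γseq; rw [← rpow_neg hn.le, neg_neg]
  rw [e1, rpow_add hn, rpow_add hn, sqrt_eq_rpow (n : ℝ)]
  have e2 : exp (-(d / 2 * (n : ℝ) ^ (1 - 2 * c))) = exp ((n : ℝ) ^ (1 - 2 * c) / 2) * exp (-((1 + d) * (n : ℝ) ^ (1 - 2 * c) / 2)) := by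
    rw [← exp_add]; congr 1; ring
  rw [e2]; ring

lemma small_exp (hc1 : c < 1 / 2) {d : ℝ} (hd : 0 < d) :
    Tendsto (fun n : ℕ => exp (-(d * (γseq c n ^ 2 * n)))) atTop (nhds 0) :=
  tendsto_exp_atBot.comp (tendsto_neg_atTop_atBot.comp ((w_top hc1).const_mul_atTop hd))

lemma tend_of_sandwich {f : ℕ → ℝ} {A : ℝ} (U L : ℝ → ℝ) (hU : ContinuousAt U 0) (hL : ContinuousAt L 0)
    (hU0 : U 0 = A) (hL0 : L 0 = A)
    (h1 : ∀ d, 0 < d → d < 1 / 4 → ∃ g : ℕ → ℝ, Tendsto g atTop (nhds (U d)) ∧ ∀ᶠ n in atTop, f n ≤ g n)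
    (h2 : ∀ d, 0 < d → d < 1 / 4 → ∃ g : ℕ → ℝ, Tendsto g atTop (nhds (L d)) ∧ ∀ᶠ n in atTop, g n ≤ f n) :
    Tendsto f atTop (nhds A) := by
  have hd4 : ∀ᶠ d : ℝ in nhdsWithin 0 (Set.Ioi 0), 0 < d ∧ d < 1 / 4 := by
    filter_upwards [Ioo_mem_nhdsGT (show (0 : ℝ) < 1 / 4 by norm_num)] with d hd using hd
  rw [tendsto_order]
  constructor
  · intro B hB
    have h : ∀ᶠ d in nhdsWithin 0 (Set.Ioi 0), B < L d :=
      (hL.tendsto.mono_left nhdsWithin_le_nhds).eventually (lt_mem_nhds (by rw [hL0]; exact hB))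
    obtain ⟨d, ⟨hd0, hd1⟩, hB⟩ := (hd4.and h).exists
    obtain ⟨g, hg, hle⟩ := h2 d hd0 hd1
    filter_upwards [hle, hg.eventually (lt_mem_nhds hB)] with n a b
    linarith
  · intro B hB
    have h : ∀ᶠ d in nhdsWithin 0 (Set.Ioi 0), U d < B :=
      (hU.tendsto.mono_left nhdsWithin_le_nhds).eventually (gt_mem_nhds (by rw [hU0]; exact hB))
    obtain ⟨d, ⟨hd0, hd1⟩, hB⟩ := (hd4.and h).exists
    obtain ⟨g, hg, hle⟩ := h1 d hd0 hd1
    filter_upwards [hle, hg.eventually (gt_mem_nhds hB)] with n a b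
    linarith

lemma tl_nonneg (n : ℕ) (L : ℝ) : 0 ≤ tl n L := measureReal_nonneg

lemma aseq_nonneg (n : ℕ) : 0 ≤ aseq c n := by
  have : 0 ≤ γseq c n := by unfold γseq; positivity
  unfold aseq; positivity

lemma QM_tend (hc0 : 0 < c) (hc1 : c < 1 / 2) {p : ℕ} (hp : 1 ≤ p)
    {Ω : Type*} [MeasurableSpace Ω] {P : Measure Ω} [IsProbabilityMeasure P]
    {H : (n : ℕ) → V n → Ω → ℝ} (hG : ∀ n, GV P (H n) (fun x y => (n : ℝ) * overlap n x y ^ p))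
    {v : ℝ} (hv : 0 < v) {t : ℝ} (ht : 0 < t) :
    Tendsto (fun n => Sn c n t * QM P (H n) (mm c n) (Lv c n v)) atTop (nhds (2 * p * t / v)) := by
  have hτ := tl_tend hc0 hc1 hv
  refine tend_of_sandwich (fun d => t * (v⁻¹ * ((1 + 2 * d) ^ 2 * (2 * p) / (1 - 0)) + 0))
    (fun d => t * (v⁻¹ * ((1 - 2 * d) ^ 2 * (2 * p) - 0 * ((1 - d) ^ 2 * (2 * p)))))
    (by fun_prop) (by fun_prop) (by field_simp; ring) (by field_simp; ring) ?_ ?_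
  · intro d hd0 hd1
    have hA := Lam_tend hc0 hc1 hp hG (show 0 < 1 + 2 * d by linarith)
    have hB := Lam_tend hc0 hc1 hp hG (show 0 < 1 + d by linarith)
    have hE := small_exp hc1 (show 0 < d ^ 2 / 2 by positivity)
    have hX := (an_exp hc0 hc1 (show 0 < 2 * d + d ^ 2 by positivity) 0).mul (hB.mul (((gm_zero hc0)).pow 2))
    simp only [rpow_zero, one_mul, zero_mul] at hX
    refine ⟨_, ((hτ.mul (hA.div (hE.const_sub 1) (by norm_num))).add hX).const_mul t, ?_⟩
    filter_upwards [eventually_gt_atTop 0] with n hn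
    have hn' : (0 : ℝ) < n := by exact_mod_cast hn
    have hγ := gm_pos (c := c) hn'
    have hm := mm_pos (c := c) hn
    set s := (1 + d) * γseq c n * n with hs
    have h1 := QM_le (hG n) (mm c n) (Lv c n v) s
    have h2 := QM_markov (hG n) (mm c n) ((1 + d) * γseq c n) s (by positivity)
    have h3 := GM_le_Lam hn.ne' (hG n) (mm c n) ((1 + 2 * d) * γseq c n) s (by rw [hs]; gcongr; linarith)
    have e1 : ((1 + 2 * d) * γseq c n * n - s) ^ 2 / (2 * n) = d ^ 2 / 2 * (γseq c n ^ 2 * n) := by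
      rw [hs]; field_simp; ring
    have e2 : ((1 + d) * γseq c n) ^ 2 * n / 2 - (1 + d) * γseq c n * s = -((1 + (2 * d + d ^ 2)) * (γseq c n ^ 2 * n) / 2) := by
      rw [hs]; ring
    rw [e1] at h3
    rw [e2] at h2
    have h4 : 0 < 1 - exp (-(d ^ 2 / 2 * (γseq c n ^ 2 * n))) := by
      rw [sub_pos, exp_lt_one_iff]; have : 0 < d ^ 2 / 2 * (γseq c n ^ 2 * n) := by positivity
      linarith
    rw [← le_div_iff₀ h4] at h3
    have hS : 0 ≤ Sn c n t := by unfold Sn; have := aseq_nonneg (c := c) n; positivity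
    calc _ ≤ Sn c n t * (Lam P (H n) (mm c n) ((1 + 2 * d) * γseq c n) / (1 - exp (-(d ^ 2 / 2 * (γseq c n ^ 2 * n)))) * tl n (Lv c n v)
          + exp (-((1 + (2 * d + d ^ 2)) * (γseq c n ^ 2 * n) / 2)) * Lam P (H n) (mm c n) ((1 + d) * γseq c n)) := by
          refine mul_le_mul_of_nonneg_left (h1.trans (add_le_add (mul_le_mul_of_nonneg_right h3 (tl_nonneg _ _)) h2)) hS
      _ = _ := by
          unfold Sn
          simp only [Pi.div_apply]
          set X := 1 - exp (-(d ^ 2 / 2 * (γseq c n ^ 2 * n)))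
          clear_value X
          set Y := exp (-((1 + (2 * d + d ^ 2)) * (γseq c n ^ 2 * n) / 2))
          set l1 := Lam P (H n) (mm c n) ((1 + 2 * d) * γseq c n)
          set l2 := Lam P (H n) (mm c n) ((1 + d) * γseq c n)
          field_simp
  · intro d hd0 hd1
    have hA := Lam_tend hc0 hc1 hp hG (show 0 < 1 - 2 * d by linarith)
    have hB := Lam_tend hc0 hc1 hp hG (show 0 < 1 - d by linarith)
    have hE := small_exp hc1 (show 0 < d ^ 2 / 2 by positivity)
    refine ⟨_, (hτ.mul (hA.sub (hE.mul hB))).const_mul t, ?_⟩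
    filter_upwards [eventually_gt_atTop 0, (r_tend hc1 (log v)).eventually (lt_mem_nhds (show 1 - d < 1 by linarith))] with n hn hr
    have hn' : (0 : ℝ) < n := by exact_mod_cast hn
    have hγ := gm_pos (c := c) hn'
    have hm := mm_pos (c := c) hn
    set s := (1 - d) * γseq c n * n with hs
    have hsL : s ≤ Lv c n v := by
      rw [Lv_eq hn', hs]
      have : 0 < γseq c n * n := by positivity
      nlinarith
    have h1 := QM_ge (hG n) (mm c n) (Lv c n v)
    have h2 := GM_mono (P := P) (p := p) (H := H n) (mm c n) hsL
    have h3 := Lam_le_GM (hG n) (mm c n) ((1 - 2 * d) * γseq c n) s (d * γseq c n) (by positivity)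
    have e1 : (1 - 2 * d) * γseq c n * (d * γseq c n) * n + (d * γseq c n) ^ 2 * n / 2 - d * γseq c n * s = -(d ^ 2 / 2 * (γseq c n ^ 2 * n)) := by
      rw [hs]; ring
    have e2 : (1 - 2 * d) * γseq c n + d * γseq c n = (1 - d) * γseq c n := by ring
    rw [e1, e2] at h3
    have hS : 0 ≤ Sn c n t := by unfold Sn; have := aseq_nonneg (c := c) n; positivity
    have h5 : (Lam P (H n) (mm c n) ((1 - 2 * d) * γseq c n) - exp (-(d ^ 2 / 2 * (γseq c n ^ 2 * n))) * Lam P (H n) (mm c n) ((1 - d) * γseq c n)) * tl n (Lv c n v) ≤ QM P (H n) (mm c n) (Lv c n v) :=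
      (mul_le_mul_of_nonneg_right (by linarith) (tl_nonneg _ _)).trans h1
    refine le_trans (le_of_eq ?_) (mul_le_mul_of_nonneg_left h5 hS)
    unfold Sn
    field_simp
end C1


/-! ### Part E1 : decoupling by added noise -/

lemma real_le_int {Ω : Type*} [MeasurableSpace Ω] {P : Measure Ω} [IsProbabilityMeasure P]
    {f : Ω → ℝ} (hf : Integrable f P) (h0 : ∀ ω, 0 ≤ f ω) {S : Set Ω} (hS : ∀ ω ∈ S, 1 ≤ f ω) :
    P.real S ≤ ∫ ω, f ω ∂P := by
  have := mul_meas_ge_le_integral_of_nonneg (ae_of_all P h0) hf 1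
  rw [one_mul] at this
  exact (measureReal_mono (fun ω hω => hS ω hω)).trans this

section Aug
variable {Ω Ω₂ : Type*} [MeasurableSpace Ω] [MeasurableSpace Ω₂] {P : Measure Ω} [IsProbabilityMeasure P]
  {Q : Measure Ω₂} [IsProbabilityMeasure Q]
  {I K : Type*} [Fintype I] [Fintype K] {X : I → Ω → ℝ} {Δ : I → I → ℝ}

lemma GV.prod {Y : K → Ω₂ → ℝ} {Δ' : K → K → ℝ} (h : GV P X Δ) (h' : GV Q Y Δ') :
    GV (P.prod Q) (Sum.elim (fun i ω => X i ω.1) (fun k ω => Y k ω.2))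
      (fun s s' => match s, s' with
        | Sum.inl i, Sum.inl j => Δ i j
        | Sum.inr k, Sum.inr l => Δ' k l
        | _, _ => 0) where
  meas s := by
    rcases s with i | k
    · exact (h.meas i).comp measurable_fst
    · exact (h'.meas k).comp measurable_snd
  law := by
    have m1 : Measurable (fun ω i => X i ω) := measurable_pi_lambda _ h.meas
    have m2 : Measurable (fun ω i => Y i ω) := measurable_pi_lambda _ h'.meas
    have hi := indepFun_prod (μ := P) (ν := Q) m1 m2
    have g1 : HasGaussianLaw (fun ω : Ω × Ω₂ => (fun i => X i ω.1)) (P.prod Q) := by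
      refine ⟨?_⟩
      have := h.law.isGaussian_map
      have e : (P.prod Q).map (fun ω : Ω × Ω₂ => (fun i => X i ω.1)) = P.map (fun ω i => X i ω) := by
        have e2 : (fun ω : Ω × Ω₂ => (fun i => X i ω.1)) = (fun ω i => X i ω) ∘ Prod.fst := rfl
        rw [e2, ← Measure.map_map m1 measurable_fst, Measure.map_fst_prod]; simp
      rw [e]; exact this
    have g2 : HasGaussianLaw (fun ω : Ω × Ω₂ => (fun i => Y i ω.2)) (P.prod Q) := by
      refine ⟨?_⟩
      have := h'.law.isGaussian_map
      have e : (P.prod Q).map (fun ω : Ω × Ω₂ => (fun i => Y i ω.2)) = Q.map (fun ω i => Y i ω) := by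
        have e2 : (fun ω : Ω × Ω₂ => (fun i => Y i ω.2)) = (fun ω i => Y i ω) ∘ Prod.snd := rfl
        rw [e2, ← Measure.map_map m2 measurable_snd, Measure.map_snd_prod]; simp
      rw [e]; exact this
    have g := IndepFun.hasGaussianLaw g1 g2 hi
    have := g.map_fun (ContinuousLinearMap.pi fun s : I ⊕ K => Sum.elim
      (fun i => (ContinuousLinearMap.proj (R := ℝ) (φ := fun _ : I => ℝ) i).comp (ContinuousLinearMap.fst ℝ (I → ℝ) (K → ℝ)))
      (fun k => (ContinuousLinearMap.proj (R := ℝ) (φ := fun _ : K => ℝ) k).comp (ContinuousLinearMap.snd ℝ (I → ℝ) (K → ℝ))) s)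
    refine this.congr (ae_of_all _ fun ω => ?_)
    funext s
    rcases s with i | k <;> rfl
  mean s := by
    rcases s with i | k
    · have := integral_fun_fst (μ := P) (ν := Q) (f := X i)
      simp only [Sum.elim_inl]
      rw [this, h.mean]; simp
    · have := integral_fun_snd (μ := P) (ν := Q) (f := Y k)
      simp only [Sum.elim_inr]
      rw [this, h'.mean]; simp
  cov s s' := by
    rcases s with i | k <;> rcases s' with j | l
    · have := integral_fun_fst (μ := P) (ν := Q) (f := fun ω => X i ω * X j ω)
      simp only [Sum.elim_inl]
      rw [this, h.cov]; simp
    · have := integral_prod_mul (μ := P) (ν := Q) (X i) (Y l)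
      simp only [Sum.elim_inl, Sum.elim_inr]
      rw [this, h.mean]; simp
    · have := integral_prod_mul (μ := P) (ν := Q) (X j) (Y k)
      simp only [Sum.elim_inl, Sum.elim_inr]
      simp_rw [mul_comm (Y k _)]
      rw [this, h.mean]; simp
    · have := integral_fun_snd (μ := P) (ν := Q) (f := fun ω => Y k ω * Y l ω)
      simp only [Sum.elim_inr]
      rw [this, h'.cov]; simp

lemma gauss_pi (K : Type*) [Fintype K] [DecidableEq K] :
    GV (Measure.pi fun _ : K => gaussianReal 0 1) (fun k ω => ω k) (fun k l => if k = l then 1 else 0) := by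
  have hlaw : ∀ k : K, HasGaussianLaw (fun ω : K → ℝ => ω k) (Measure.pi fun _ : K => gaussianReal 0 1) := by
    intro k
    refine ⟨?_⟩
    have := (measurePreserving_eval (fun _ : K => gaussianReal 0 1) k).map_eq
    have e : (fun ω : K → ℝ => ω k) = Function.eval k := rfl
    rw [e, this]; infer_instance
  have hind : iIndepFun (fun k (ω : K → ℝ) => ω k) (Measure.pi fun _ : K => gaussianReal 0 1) :=
    iIndepFun_pi (X := fun _ x => x) (fun i => aemeasurable_id)
  have hmean : ∀ k : K, ∫ ω, ω k ∂(Measure.pi fun _ : K => gaussianReal 0 1) = 0 := by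
    intro k
    have := (measurePreserving_eval (fun _ : K => gaussianReal 0 1) k)
    have h3 := integral_map (μ := Measure.pi fun _ : K => gaussianReal 0 1) (φ := Function.eval k)
      (f := fun x : ℝ => x) (measurable_pi_apply k).aemeasurable (by fun_prop)
    rw [this.map_eq, integral_id_gaussianReal] at h3
    exact h3.symm
  refine ⟨fun k => measurable_pi_apply k, iIndepFun.hasGaussianLaw hlaw hind, hmean, fun k l => ?_⟩
  split_ifs with hkl
  · subst hkl
    have := (measurePreserving_eval (fun _ : K => gaussianReal 0 1) k)
    have h3 := integral_map (μ := Measure.pi fun _ : K => gaussianReal 0 1) (φ := Function.eval k)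
      (f := fun x : ℝ => x * x) (measurable_pi_apply k).aemeasurable (by fun_prop)
    rw [this.map_eq] at h3
    have h4 := variance_of_integral_eq_zero (μ := gaussianReal 0 1) (X := fun x => x) (by fun_prop) (by simp)
    have h5 := variance_fun_id_gaussianReal (μ := 0) (v := 1)
    rw [h5] at h4
    rw [show (∫ ω, ω k * ω k ∂(Measure.pi fun _ : K => gaussianReal 0 1)) = _ from h3.symm]
    simp_rw [← sq]; rw [← h4]; simp
  · have := (hind.indepFun hkl).integral_fun_mul_eq_mul_integral (measurable_pi_apply k).aestronglyMeasurable (measurable_pi_apply l).aestronglyMeasurable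
    rw [this, hmean]; simp
end Aug


lemma mS_ex (L : ℝ) (C : Type*) [Fintype C] : MeasurableSet {z : C → ℝ | ∃ a, L < z a} := by
  have : {z : C → ℝ | ∃ a, L < z a} = ⋃ a, {z | L < z a} := by ext; simp
  rw [this]
  exact MeasurableSet.iUnion fun a => measurableSet_lt measurable_const (measurable_pi_apply a)

section DecAbs
variable {Ω : Type*} [MeasurableSpace Ω] {P : Measure Ω} [IsProbabilityMeasure P]
  {I K A B : Type*} [Fintype I] [Fintype K] [DecidableEq K] [Fintype A] [Fintype B]
  {X : I → Ω → ℝ} {Δ : I → I → ℝ}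

/-- probability that a perturbed maximum exceeds a level -/
lemma pert_tail (hX : GV P X Δ) (f : A → I) (mU : A → K → ℝ) {κ N l h τ L : ℝ}
    (hκ : ∀ a, ∑ k, mU a k * mU a k ≤ κ) (hN : ∀ i, Δ i i ≤ N) (hl : 0 ≤ l) (hh : 0 ≤ h) :
    (P.prod (Measure.pi fun _ : K => gaussianReal 0 1)).real
        {ω | ∃ a, L - τ < X (f a) ω.1 + ∑ k, mU a k * ω.2 k}
      ≤ P.real {ω | ∃ a, L - 2 * τ < X (f a) ω} +
        Fintype.card A * exp (l ^ 2 * N / 2 - l * (L - τ) - h * τ + (l + h) ^ 2 * κ / 2) := by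
  classical
  set Q := (Measure.pi fun _ : K => gaussianReal 0 1) with hQ
  have hsub : {ω : Ω × (K → ℝ) | ∃ a, L - τ < X (f a) ω.1 + ∑ k, mU a k * ω.2 k} ⊆
      ({ω : Ω | ∃ a, L - 2 * τ < X (f a) ω} ×ˢ Set.univ) ∪
      ⋃ a ∈ (univ : Finset A), {ω : Ω × (K → ℝ) | L - τ < X (f a) ω.1 + ∑ k, mU a k * ω.2 k ∧ τ < ∑ k, mU a k * ω.2 k} := by
    rintro ω ⟨a, ha⟩
    by_cases h1 : L - 2 * τ < X (f a) ω.1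
    · left; exact ⟨⟨a, h1⟩, trivial⟩
    · right
      simp only [Set.mem_iUnion]
      refine ⟨a, mem_univ a, ha, ?_⟩
      push Not at h1
      linarith
  refine (measureReal_mono hsub).trans ((measureReal_union_le _ _).trans (add_le_add ?_ ?_))
  · rw [measureReal_prod_prod]; simp
  · refine (measureReal_biUnion_finset_le _ _).trans ?_
    rw [← nsmul_eq_mul, ← card_univ]
    refine sum_le_card_nsmul _ _ _ fun a _ => ?_
    have hU := (gauss_pi K).lin (fun _ : Unit => mU a)
    have i1 := hX.int_exp (f a) l
    have i2 := hU.int_exp () (l + h)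
    have i3 := i1.mul_prod i2
    have e3 := integral_prod_mul (μ := P) (ν := Q) (fun ω => exp (l * X (f a) ω)) (fun z => exp ((l + h) * ∑ k, mU a k * z k))
    have e4 := hU.exp_eq () (l + h)
    rw [hX.exp_eq, e4] at e3
    have := real_le_int (P := P.prod Q) (i3.mul_const (exp (- l * (L - τ) - h * τ))) (fun ω => by positivity)
      (S := {ω : Ω × (K → ℝ) | L - τ < X (f a) ω.1 + ∑ k, mU a k * ω.2 k ∧ τ < ∑ k, mU a k * ω.2 k}) ?_
    · refine this.trans ?_
      rw [integral_mul_const, e3, ← exp_add, ← exp_add]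
      apply exp_le_exp.mpr
      have := hN (f a)
      have h4 : (∑ i, ∑ i', mU a i * mU a i' * if i = i' then (1 : ℝ) else 0) ≤ κ := by
        simpa using hκ a
      have h5 := mul_le_mul_of_nonneg_left this (sq_nonneg l)
      have h6 := mul_le_mul_of_nonneg_left h4 (sq_nonneg (l + h))
      linarith
    · rintro ω ⟨h1, h2⟩
      rw [← exp_add, ← exp_add]
      apply one_le_exp
      have h3 := mul_nonneg hl (sub_nonneg.mpr h1.le)
      have h4 := mul_nonneg hh (sub_nonneg.mpr h2.le)
      linarith

lemma dec_abs (hX : GV P X Δ) (f : A → I) (g : B → I) (mU : A → K → ℝ) (mV : B → K → ℝ)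
    {κ N l h τ L : ℝ}
    (h0 : ∀ a b, Δ (f a) (g b) + ∑ k, mU a k * mV b k = 0)
    (hκU : ∀ a, ∑ k, mU a k * mU a k ≤ κ) (hκV : ∀ b, ∑ k, mV b k * mV b k ≤ κ)
    (hN : ∀ i, Δ i i ≤ N) (hl : 0 ≤ l) (hh : 0 ≤ h) :
    (1 - (Fintype.card A + Fintype.card B) * exp (- h * τ + h ^ 2 * κ / 2)) *
      P.real {ω | (∃ a, L < X (f a) ω) ∧ ∃ b, L < X (g b) ω}
      ≤ (P.real {ω | ∃ a, L - 2 * τ < X (f a) ω} +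
        Fintype.card A * exp (l ^ 2 * N / 2 - l * (L - τ) - h * τ + (l + h) ^ 2 * κ / 2)) *
        (P.real {ω | ∃ b, L - 2 * τ < X (g b) ω} +
        Fintype.card B * exp (l ^ 2 * N / 2 - l * (L - τ) - h * τ + (l + h) ^ 2 * κ / 2)) := by
  classical
  set Q := (Measure.pi fun _ : K => gaussianReal 0 1) with hQ
  have hZ := hX.prod (gauss_pi K)
  set M : A ⊕ B → I ⊕ K → ℝ := Sum.elim (fun a => Sum.elim (Pi.single (f a) 1) (mU a))
    (fun b => Sum.elim (Pi.single (g b) 1) (mV b)) with hM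
  have hW := hZ.lin M
  have eX : (fun j (ω : Ω × (K → ℝ)) => ∑ i, M j i * Sum.elim (fun i (ω : Ω × (K → ℝ)) => X i ω.1) (fun k ω => ω.2 k) i ω)
      = Sum.elim (fun a ω => X (f a) ω.1 + ∑ k, mU a k * ω.2 k)
      (fun b ω => X (g b) ω.1 + ∑ k, mV b k * ω.2 k) := by
    funext s ω
    rcases s with a | b <;> simp [hM, Pi.single_apply]
  rw [eX] at hW
  have hind := hW.indep (by
    intro a b
    have := h0 a b
    simp [hM, Pi.single_apply]
    simpa using this)
  -- product structure
  set E1 : Set Ω := {ω | (∃ a, L < X (f a) ω) ∧ ∃ b, L < X (g b) ω} with hE1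
  set E2 : Set (K → ℝ) := {z | (∀ a, -τ ≤ ∑ k, mU a k * z k) ∧ ∀ b, -τ ≤ ∑ k, mV b k * z k} with hE2
  have mlin : ∀ v : K → ℝ, Measurable (fun z : K → ℝ => ∑ k, v k * z k) := by
    intro v; fun_prop
  have hE2m : MeasurableSet E2 := by
    have : E2 = (⋂ a, {z | -τ ≤ ∑ k, mU a k * z k}) ∩ ⋂ b, {z | -τ ≤ ∑ k, mV b k * z k} := by
      ext z; simp [hE2]
    rw [this]
    exact (MeasurableSet.iInter fun a => measurableSet_le measurable_const (mlin _)).inter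
      (MeasurableSet.iInter fun a => measurableSet_le measurable_const (mlin _))
  have single : ∀ v : K → ℝ, ∑ k, v k * v k ≤ κ → Q.real {z | ∑ k, v k * z k < -τ} ≤ exp (- h * τ + h ^ 2 * κ / 2) := by
    intro v hv
    have hU := (gauss_pi K).lin (fun _ : Unit => v)
    have i2 := hU.int_exp () (-h)
    have := real_le_int (P := Q) (i2.mul_const (exp (- h * τ))) (fun ω => by positivity)
      (S := {z | ∑ k, v k * z k < -τ}) ?_
    · refine this.trans ?_
      rw [integral_mul_const, hU.exp_eq (), ← exp_add]
      apply exp_le_exp.mpr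
      have h4 : (∑ i, ∑ i', v i * v i' * if i = i' then (1 : ℝ) else 0) ≤ κ := by
        simpa using hv
      have h6 := mul_le_mul_of_nonneg_left h4 (sq_nonneg (-h))
      linarith
    · intro z hz
      rw [← exp_add]
      apply one_le_exp
      have hz' : ∑ k, v k * z k < -τ := hz
      have h4 := mul_nonneg hh (sub_nonneg.mpr hz'.le)
      linarith
  have hE2p : 1 - (Fintype.card A + Fintype.card B) * exp (- h * τ + h ^ 2 * κ / 2) ≤ Q.real E2 := by
    have hc : Q.real E2ᶜ ≤ (Fintype.card A + Fintype.card B) * exp (- h * τ + h ^ 2 * κ / 2) := by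
      have hsub : E2ᶜ ⊆ (⋃ a ∈ (univ : Finset A), {z | ∑ k, mU a k * z k < -τ}) ∪
          ⋃ b ∈ (univ : Finset B), {z | ∑ k, mV b k * z k < -τ} := by
        intro z hz
        simp only [hE2, Set.mem_compl_iff, Set.mem_setOf_eq, not_and_or, not_forall, not_le] at hz
        simpa using hz
      refine (measureReal_mono hsub).trans ((measureReal_union_le _ _).trans ?_)
      rw [add_mul]
      refine add_le_add ?_ ?_
      · refine (measureReal_biUnion_finset_le _ _).trans ?_
        rw [← nsmul_eq_mul, ← card_univ]
        exact sum_le_card_nsmul _ _ _ fun a _ => single _ (hκU a)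
      · refine (measureReal_biUnion_finset_le _ _).trans ?_
        rw [← nsmul_eq_mul, ← card_univ]
        exact sum_le_card_nsmul _ _ _ fun a _ => single _ (hκV a)
    have := probReal_add_probReal_compl (μ := Q) hE2m
    linarith
  have hmain : P.real E1 * Q.real E2 ≤
      (P.prod Q).real {ω | ∃ a, L - τ < X (f a) ω.1 + ∑ k, mU a k * ω.2 k} *
      (P.prod Q).real {ω | ∃ b, L - τ < X (g b) ω.1 + ∑ k, mV b k * ω.2 k} := by
    rw [← measureReal_prod_prod]
    have hpr := hind.measure_inter_preimage_eq_mul _ _ (mS_ex (L - τ) A) (mS_ex (L - τ) B)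
    have hpr' := congrArg ENNReal.toReal hpr
    rw [ENNReal.toReal_mul] at hpr'
    refine le_trans (measureReal_mono ?_) hpr'.le
    rintro ω ⟨⟨⟨a, ha⟩, ⟨b, hb⟩⟩, h2, h3⟩
    refine ⟨⟨a, ?_⟩, ⟨b, ?_⟩⟩
    · have := h2 a
      simp only
      linarith
    · have := h3 b
      simp only
      linarith
  have t1 := pert_tail (P := P) hX f mU (τ := τ) (L := L) hκU hN hl hh
  have t2 := pert_tail (P := P) hX g mV (τ := τ) (L := L) hκV hN hl hh
  calc _ ≤ Q.real E2 * P.real E1 := by gcongr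
    _ = P.real E1 * Q.real E2 := mul_comm _ _
    _ ≤ _ := hmain
    _ ≤ _ := by gcongr

end DecAbs


section TwoPath
variable {n : ℕ}

open Classical in
/-- coordinates touched by a path -/
noncomputable def touched (m : ℕ) (q : ℕ → V n) : Finset (Fin n) :=
  univ.filter fun c => ∃ i ≤ m, q i c ≠ q 0 c

lemma touched_card (q : ℕ → V n) (hq : IsW q) (m : ℕ) : (touched m q).card ≤ m := by
  classical
  induction m with
  | zero =>
    have : touched 0 q = ∅ := by
      ext c; simp [touched]
    rw [this]; simp
  | succ m ih =>
    have hsub : touched (m + 1) q ⊆ touched m q ∪ univ.filter (fun c => q m c ≠ q (m + 1) c) := by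
      intro c hc
      simp only [touched, mem_filter, mem_univ, true_and, mem_union] at hc ⊢
      obtain ⟨i, hi, h⟩ := hc
      rcases Nat.lt_or_ge m i with h1 | h1
      · have : i = m + 1 := by omega
        subst this
        by_cases h2 : q m c = q (m + 1) c
        · left; exact ⟨m, le_rfl, by rw [h2]; exact h⟩
        · right; exact h2
      · left; exact ⟨i, h1, h⟩
    have h2 : (univ.filter (fun c => q m c ≠ q (m + 1) c)).card ≤ 1 := hq m
    exact (card_le_card hsub).trans ((card_union_le _ _).trans (by omega))

lemma not_touched {m : ℕ} {q : ℕ → V n} {c : Fin n} (h : c ∉ touched m q) {i : ℕ} (hi : i ≤ m) : q i c = q 0 c := by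
  by_contra h2
  exact h (by simp only [touched, mem_filter, mem_univ, true_and]; exact ⟨i, hi, h2⟩)

lemma abs_sg (x : V n) (c : Fin n) : |sg x c| = 1 := by
  unfold sg; split_ifs <;> simp

/-- low dimensional vectors reproducing the overlaps -/
lemma vec_exist (hn : n ≠ 0) (m : ℕ) (q q' : ℕ → V n) (hq : IsW q) (hq' : IsW q') :
    ∃ a b : ℕ → Option (Fin n) → ℝ, (∀ i ≤ m, ∀ j ≤ m, ∑ k, a i k * b j k = overlap n (q i) (q' j)) ∧
      (∀ i, ∑ k, a i k * a i k ≤ |overlap n (q 0) (q' 0)| + 4 * m / n) ∧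
      (∀ i, ∑ k, b i k * b i k ≤ |overlap n (q 0) (q' 0)| + 4 * m / n) := by
  classical
  set S := touched m q ∪ touched m q' with hS
  have hn' : (0 : ℝ) < n := by exact_mod_cast Nat.pos_of_ne_zero hn
  have hScard : (S.card : ℝ) ≤ 2 * m := by
    have h0 : S.card ≤ _ := card_union_le (touched m q) (touched m q')
    have h1 := touched_card q hq m
    have h2 := touched_card q' hq' m
    have : S.card ≤ 2 * m := by omega
    exact_mod_cast this
  set T : ℝ := (∑ c ∈ Sᶜ, sg (q 0) c * sg (q' 0) c) / n with hT
  have hsplit : ∀ x y : V n, overlap n x y = (∑ c ∈ S, sg x c * sg y c) / n + (∑ c ∈ Sᶜ, sg x c * sg y c) / n := by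
    intro x y
    rw [overlap_eq hn, ← add_div, sum_add_sum_compl]
  have hTle : |T| ≤ |overlap n (q 0) (q' 0)| + 2 * m / n := by
    have h1 := hsplit (q 0) (q' 0)
    have h2 : |∑ c ∈ S, sg (q 0) c * sg (q' 0) c| ≤ 2 * m := by
      refine (abs_sum_le_sum_abs _ _).trans ?_
      simp only [abs_mul, abs_sg, mul_one, sum_const, nsmul_eq_mul]
      exact hScard
    have h3 : T = overlap n (q 0) (q' 0) - (∑ c ∈ S, sg (q 0) c * sg (q' 0) c) / n := by
      rw [h1]; ring
    rw [h3]
    refine (abs_sub _ _).trans ?_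
    rw [abs_div, abs_of_pos hn']
    gcongr
  have hsq : ∀ x : V n, ∑ c ∈ S, (sg x c / √n) * (sg x c / √n) ≤ 2 * m / n := by
    intro x
    have : ∀ c, (sg x c / √n) * (sg x c / √n) = 1 / n := by
      intro c
      rw [div_mul_div_comm, sg_sq, Real.mul_self_sqrt hn'.le]
    simp only [this, sum_const, nsmul_eq_mul, mul_one_div]
    gcongr
  refine ⟨fun i k => k.elim (√|T|) (fun c => if c ∈ S then sg (q i) c / √n else 0),
    fun i k => k.elim (SignType.sign T * √|T|) (fun c => if c ∈ S then sg (q' i) c / √n else 0), ?_, ?_, ?_⟩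
  · intro i hi j hj
    rw [Fintype.sum_option]
    simp only [Option.elim]
    have h1 : ∀ c, ((if c ∈ S then sg (q i) c / √n else 0) * if c ∈ S then sg (q' j) c / √n else 0)
        = if c ∈ S then (sg (q i) c * sg (q' j) c) / n else 0 := by
      intro c
      split_ifs
      · rw [div_mul_div_comm, Real.mul_self_sqrt hn'.le]
      · simp
    simp_rw [h1]
    rw [sum_ite_mem, univ_inter, ← sum_div, hsplit]
    have h2 : ∑ c ∈ Sᶜ, sg (q i) c * sg (q' j) c = ∑ c ∈ Sᶜ, sg (q 0) c * sg (q' 0) c := by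
      refine sum_congr rfl fun c hc => ?_
      simp only [hS, mem_compl, mem_union, not_or] at hc
      unfold sg
      rw [not_touched hc.1 hi, not_touched hc.2 hj]
    rw [h2, ← hT]
    have h3 : √|T| * (SignType.sign T * √|T|) = T := by
      calc _ = SignType.sign T * (√|T| * √|T|) := by ring
        _ = SignType.sign T * |T| := by rw [Real.mul_self_sqrt (abs_nonneg _)]
        _ = T := sign_mul_abs T
    rw [h3]; ring
  · intro i
    rw [Fintype.sum_option]
    simp only [Option.elim]
    rw [Real.mul_self_sqrt (abs_nonneg _)]
    have h1 : ∀ c, ((if c ∈ S then sg (q i) c / √n else 0) * if c ∈ S then sg (q i) c / √n else 0)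
        = if c ∈ S then (sg (q i) c / √n) * (sg (q i) c / √n) else 0 := by
      intro c; split_ifs <;> simp
    simp_rw [h1]
    rw [sum_ite_mem, univ_inter]
    have := hsq (q i)
    have e : (4 * m / n : ℝ) = 2 * m / n + 2 * m / n := by ring
    rw [e]; linarith
  · intro i
    rw [Fintype.sum_option]
    simp only [Option.elim]
    have h0 : (SignType.sign T * √|T|) * (SignType.sign T * √|T|) ≤ |T| := by
      calc _ = ((SignType.sign T : ℝ) * SignType.sign T) * (√|T| * √|T|) := by ring
        _ = ((SignType.sign T : ℝ) * SignType.sign T) * |T| := by rw [Real.mul_self_sqrt (abs_nonneg _)]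
        _ ≤ 1 * |T| := by
          gcongr
          rcases SignType.sign T with _ | _ | _ <;> simp
        _ = _ := one_mul _
    have h1 : ∀ c, ((if c ∈ S then sg (q' i) c / √n else 0) * if c ∈ S then sg (q' i) c / √n else 0)
        = if c ∈ S then (sg (q' i) c / √n) * (sg (q' i) c / √n) else 0 := by
      intro c; split_ifs <;> simp
    simp_rw [h1]
    rw [sum_ite_mem, univ_inter]
    have := hsq (q' i)
    have e : (4 * m / n : ℝ) = 2 * m / n + 2 * m / n := by ring
    rw [e]; linarith

lemma sum_prod_pow {K : Type*} [Fintype K] (a b : K → ℝ) (p : ℕ) :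
    ∑ κ : Fin p → K, (∏ l, a (κ l)) * ∏ l, b (κ l) = (∑ k, a k * b k) ^ p := by
  classical
  rw [← Fin.prod_const, Finset.prod_univ_sum]
  simp [prod_mul_distrib]

variable {Ω : Type*} [MeasurableSpace Ω] {P : Measure Ω} [IsProbabilityMeasure P]
  {p : ℕ} {H : V n → Ω → ℝ}

lemma ex_fin_iff {m : ℕ} {f : ℕ → ℝ} {L : ℝ} : (∃ i : Fin (m + 1), L < f i) ↔ L < mx m f := by
  rw [lt_mx_iff]
  constructor
  · rintro ⟨i, h⟩; exact ⟨i, by omega, h⟩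
  · rintro ⟨i, hi, h⟩; exact ⟨⟨i, by omega⟩, h⟩

lemma two_path (hn : n ≠ 0) (hp : 2 ≤ p) (hG : GV P H (fun x y => (n : ℝ) * overlap n x y ^ p)) (m : ℕ)
    (q q' : ℕ → V n) (hq : IsW q) (hq' : IsW q') {L l h τ r : ℝ}
    (hr : |overlap n (q 0) (q' 0)| + 4 * m / n ≤ r) (hr1 : r ≤ 1) (hl : 0 ≤ l) (hh : 0 ≤ h) :
    (1 - 2 * (m + 1) * exp (- h * τ + h ^ 2 * (n * r ^ 2) / 2)) *
      P.real {ω | L < mx m (fun i => H (q i) ω) ∧ L < mx m (fun i => H (q' i) ω)}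
      ≤ (Qq P H m q (L - 2 * τ) +
        (m + 1) * exp (l ^ 2 * n / 2 - l * (L - τ) - h * τ + (l + h) ^ 2 * (n * r ^ 2) / 2)) *
        (Qq P H m q' (L - 2 * τ) +
        (m + 1) * exp (l ^ 2 * n / 2 - l * (L - τ) - h * τ + (l + h) ^ 2 * (n * r ^ 2) / 2)) := by
  classical
  obtain ⟨a, b, h1, h2, h3⟩ := vec_exist hn m q q' hq hq'
  have hn' : (0 : ℝ) < n := by exact_mod_cast Nat.pos_of_ne_zero hn
  have hr0 : 0 ≤ r := le_trans (by positivity) hr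
  have key : ∀ v : Option (Fin n) → ℝ, ∑ k, v k * v k ≤ |overlap n (q 0) (q' 0)| + 4 * m / n →
      (n : ℝ) * (∑ k, v k * v k) ^ p ≤ n * r ^ 2 := by
    intro v hv
    have h0 : 0 ≤ ∑ k, v k * v k := sum_nonneg fun k _ => mul_self_nonneg _
    gcongr
    calc _ ≤ r ^ p := by gcongr; exact hv.trans hr
      _ ≤ r ^ 2 := pow_le_pow_of_le_one hr0 hr1 hp
  have := dec_abs (P := P) hG (A := Fin (m + 1)) (B := Fin (m + 1)) (K := Fin p → Option (Fin n))
    (fun i => q i) (fun i => q' i) (fun i κ => - √n * ∏ l, a i (κ l)) (fun i κ => √n * ∏ l, b i (κ l))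
    (κ := n * r ^ 2) (N := n) (l := l) (h := h) (τ := τ) (L := L) ?_ ?_ ?_ ?_ hl hh
  · simp only [Fintype.card_fin] at this
    have e1 : ∀ (q : ℕ → V n) (L : ℝ), {ω | ∃ a : Fin (m + 1), L < H (q a) ω} = {ω | L < mx m (fun i => H (q i) ω)} := by
      intro q L; ext ω
      exact ex_fin_iff (f := fun i => H (q i) ω)
    have e2 : {ω | (∃ a : Fin (m + 1), L < H (q a) ω) ∧ ∃ b : Fin (m + 1), L < H (q' b) ω}
        = {ω | L < mx m (fun i => H (q i) ω) ∧ L < mx m (fun i => H (q' i) ω)} := by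
      ext ω
      exact and_congr (ex_fin_iff (f := fun i => H (q i) ω)) (ex_fin_iff (f := fun i => H (q' i) ω))
    rw [e1, e1, e2] at this
    unfold Qq
    push_cast at this
    convert this using 3
    ring
  · intro i j
    have e : ∀ κ : Fin p → Option (Fin n), - √n * (∏ l, a i (κ l)) * (√n * ∏ l, b j (κ l)) = - n * ((∏ l, a i (κ l)) * ∏ l, b j (κ l)) := by
      intro κ
      calc _ = - (√n * √n) * ((∏ l, a i (κ l)) * ∏ l, b j (κ l)) := by ring
        _ = _ := by rw [Real.mul_self_sqrt hn'.le]
    simp_rw [e]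
    rw [← mul_sum, sum_prod_pow, h1 i (by omega) j (by omega)]
    ring
  · intro i
    have e : ∀ κ : Fin p → Option (Fin n), - √n * (∏ l, a i (κ l)) * (- √n * ∏ l, a i (κ l)) = n * ((∏ l, a i (κ l)) * ∏ l, a i (κ l)) := by
      intro κ
      calc _ = (√n * √n) * ((∏ l, a i (κ l)) * ∏ l, a i (κ l)) := by ring
        _ = _ := by rw [Real.mul_self_sqrt hn'.le]
    simp_rw [e]
    rw [← mul_sum, sum_prod_pow]
    exact key _ (h2 i)
  · intro i
    have e : ∀ κ : Fin p → Option (Fin n), √n * (∏ l, b i (κ l)) * (√n * ∏ l, b i (κ l)) = n * ((∏ l, b i (κ l)) * ∏ l, b i (κ l)) := by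
      intro κ
      calc _ = (√n * √n) * ((∏ l, b i (κ l)) * ∏ l, b i (κ l)) := by ring
        _ = _ := by rw [Real.mul_self_sqrt hn'.le]
    simp_rw [e]
    rw [← mul_sum, sum_prod_pow]
    exact key _ (h3 i)
  · intro x
    simp [overlap_self]

end TwoPath


section Pairs
variable {n : ℕ}

lemma mgf_ov (y : V n) (u : ℝ) :
    ∑ x : V n, exp (u * ∑ c, sg x c * sg y c) = (2 * cosh u) ^ n := by
  classical
  have h1 : ∀ x : V n, exp (u * ∑ c, sg x c * sg y c) = ∏ c, exp (u * ((if x c then 1 else -1) * sg y c)) := by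
    intro x
    rw [mul_sum, exp_sum]; rfl
  simp_rw [h1]
  have h2 := Finset.prod_univ_sum (fun _ : Fin n => (univ : Finset Bool))
    (fun c b => exp (u * ((if b then 1 else -1) * sg y c)))
  rw [Fintype.piFinset_univ] at h2
  rw [← h2]
  have h3 : ∀ c : Fin n, ∑ b : Bool, exp (u * ((if b then 1 else -1) * sg y c)) = 2 * cosh u := by
    intro c
    rw [Fintype.sum_bool, cosh_eq]
    unfold sg
    by_cases hy : y c = true
    · simp [hy]; ring_nf
    · simp [hy]; ring_nf
  rw [prod_congr rfl fun c _ => h3 c]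
  simp

lemma exp_ov_avg (hn : n ≠ 0) (y : V n) :
    ∑ x : V n, exp (n * overlap n x y ^ 2 / 4) ≤ (2 * n + 1) * 2 ^ n := by
  have hn' : (0 : ℝ) < n := by exact_mod_cast Nat.pos_of_ne_zero hn
  have h1 : ∀ x : V n, exp (n * overlap n x y ^ 2 / 4) ≤
      ∑ k ∈ range (2 * n + 1), exp (((k : ℝ) - n) / (2 * n) * (∑ c, sg x c * sg y c)) * exp (- ((k : ℝ) - n) ^ 2 / (4 * n)) := by
    intro x
    have hS : ∑ c, sg x c * sg y c = n * overlap n x y := by rw [overlap_eq hn]; field_simp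
    have hd := hd_le x y
    set d := hammingDist x y with hd'
    have hS2 : n * overlap n x y = n - 2 * d := by unfold overlap; field_simp; rw [hd']
    have hmem : 2 * n - 2 * d ∈ range (2 * n + 1) := by rw [mem_range]; omega
    refine le_trans ?_ (single_le_sum (fun k _ => by positivity) hmem)
    rw [hS, hS2, ← exp_add]
    have hov : overlap n x y = (n - 2 * d) / n := by field_simp; linarith
    rw [hov]
    apply exp_le_exp.mpr
    have e : ((2 * n - 2 * d : ℕ) : ℝ) = 2 * n - 2 * d := by
      rw [Nat.cast_sub (by omega)]; push_cast; ring
    rw [e]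
    apply le_of_eq
    field_simp
    ring
  refine (sum_le_sum fun x _ => h1 x).trans ?_
  rw [sum_comm]
  simp_rw [← sum_mul, mgf_ov]
  have h2 : ∀ k ∈ range (2 * n + 1), (2 * cosh (((k : ℝ) - n) / (2 * n))) ^ n * exp (- ((k : ℝ) - n) ^ 2 / (4 * n)) ≤ 2 ^ n := by
    intro k _
    rw [mul_pow, mul_assoc]
    apply mul_le_of_le_one_right (by positivity)
    calc _ ≤ (exp ((((k : ℝ) - n) / (2 * n)) ^ 2 / 2)) ^ n * exp (- ((k : ℝ) - n) ^ 2 / (4 * n)) := by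
          gcongr
          exact cosh_le_exp_half_sq _
      _ = exp (- (((k : ℝ) - n) ^ 2 / (8 * n))) := by
          rw [← exp_nat_mul, ← exp_add]
          congr 1
          field_simp
          ring
      _ ≤ 1 := by
          apply exp_le_one_iff.mpr
          have : 0 ≤ ((k : ℝ) - n) ^ 2 / (8 * n) := by positivity
          linarith
  refine (sum_le_sum h2).trans ?_
  simp

lemma ov_close (hn : n ≠ 0) (m : ℕ) (q q' : ℕ → V n) (hq : IsW q) (hq' : IsW q') (i j : ℕ) (hi : i ≤ m) (hj : j ≤ m) :
    overlap n (q i) (q' j) ^ 2 ≤ 2 * overlap n (q 0) (q' 0) ^ 2 + 32 * (m / n : ℝ) ^ 2 := by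
  have hn' : (0 : ℝ) < n := by exact_mod_cast Nat.pos_of_ne_zero hn
  have h1 := hq.hd 0 i
  have h2 := hq'.hd 0 j
  simp only [zero_add] at h1 h2
  have t1 := hammingDist_triangle (q i) (q 0) (q' j)
  have t2 := hammingDist_triangle (q 0) (q' 0) (q' j)
  have t3 := hammingDist_triangle (q 0) (q i) (q' 0)
  have t4 := hammingDist_triangle (q i) (q' j) (q' 0)
  rw [hammingDist_comm (q i) (q 0)] at t1
  rw [hammingDist_comm (q' j) (q' 0)] at t4
  have u1 : hammingDist (q i) (q' j) ≤ hammingDist (q 0) (q' 0) + 2 * m := by omega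
  have u2 : hammingDist (q 0) (q' 0) ≤ hammingDist (q i) (q' j) + 2 * m := by omega
  have u1' : (hammingDist (q i) (q' j) : ℝ) ≤ hammingDist (q 0) (q' 0) + 2 * m := by exact_mod_cast u1
  have u2' : (hammingDist (q 0) (q' 0) : ℝ) ≤ hammingDist (q i) (q' j) + 2 * m := by exact_mod_cast u2
  have e : |overlap n (q i) (q' j) - overlap n (q 0) (q' 0)| ≤ 4 * (m / n) := by
    unfold overlap
    have : 1 - 2 * (hammingDist (q i) (q' j) : ℝ) / n - (1 - 2 * (hammingDist (q 0) (q' 0) : ℝ) / n)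
       = (2 * (hammingDist (q 0) (q' 0) - hammingDist (q i) (q' j) : ℝ)) / n := by ring
    rw [this, abs_div, abs_of_pos hn', ← mul_div_assoc]
    gcongr
    rw [abs_le]; constructor <;> linarith
  have e2 : (overlap n (q i) (q' j) - overlap n (q 0) (q' 0)) ^ 2 ≤ (4 * (m / n : ℝ)) ^ 2 := by
    rw [← sq_abs]; gcongr
  nlinarith [sq_nonneg (overlap n (q i) (q' j) - 2 * overlap n (q 0) (q' 0))]

variable {Ω : Type*} [MeasurableSpace Ω] {P : Measure Ω} [IsProbabilityMeasure P]
  {p : ℕ} {H : V n → Ω → ℝ}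

lemma pair_exp (hG : GV P H (fun x y => (n : ℝ) * overlap n x y ^ p)) (x y : V n) (s : ℝ) :
    Integrable (fun ω => exp (s * (H x ω + H y ω))) P ∧
    ∫ ω, exp (s * (H x ω + H y ω)) ∂P = exp (s ^ 2 * n * (1 + overlap n x y ^ p)) := by
  have h1 := hG.reindex (fun b : Bool => if b then x else y)
  have e1 : ∀ ω, ∑ b : Bool, s * H (if b then x else y) ω = s * (H x ω + H y ω) := by
    intro ω; simp [mul_add]
  have i := h1.int_exp_lin (fun _ => s)
  have e := h1.exp_lin (fun _ => s)
  simp only [e1] at i e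
  refine ⟨i, e.trans ?_⟩
  congr 1
  simp [overlap_self, overlap_comm y x]
  ring

lemma pair_tail (hG : GV P H (fun x y => (n : ℝ) * overlap n x y ^ p)) (x y : V n) (s L : ℝ) (hs : 0 ≤ s) :
    P.real {ω | L < H x ω ∧ L < H y ω} ≤ exp (s ^ 2 * n * (1 + overlap n x y ^ p) - 2 * s * L) := by
  obtain ⟨i, e⟩ := pair_exp (P := P) hG x y s
  have := real_le_int (P := P) (i.mul_const (exp (- 2 * s * L))) (fun ω => by positivity)
    (S := {ω | L < H x ω ∧ L < H y ω}) ?_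
  · refine this.trans ?_
    rw [integral_mul_const, e, ← exp_add]
    apply le_of_eq; congr 1; ring
  · rintro ω ⟨h1, h2⟩
    rw [← exp_add]
    apply one_le_exp
    nlinarith [mul_nonneg hs (sub_nonneg.mpr h1.le), mul_nonneg hs (sub_nonneg.mpr h2.le)]

lemma bad_pair (hn : n ≠ 0) (hp : 2 ≤ p) (hG : GV P H (fun x y => (n : ℝ) * overlap n x y ^ p)) (m : ℕ)
    (q q' : ℕ → V n) (hq : IsW q) (hq' : IsW q') (L s : ℝ) (hs : 0 ≤ s) :
    P.real {ω | L < mx m (fun i => H (q i) ω) ∧ L < mx m (fun i => H (q' i) ω)} ≤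
      (m + 1) ^ 2 * exp (s ^ 2 * n * (1 + (2 * overlap n (q 0) (q' 0) ^ 2 + 32 * (m / n : ℝ) ^ 2)) - 2 * s * L) := by
  have hsub : {ω | L < mx m (fun i => H (q i) ω) ∧ L < mx m (fun i => H (q' i) ω)} ⊆
      ⋃ z ∈ (range (m + 1) ×ˢ range (m + 1)), {ω | L < H (q z.1) ω ∧ L < H (q' z.2) ω} := by
    rintro ω ⟨h1, h2⟩
    obtain ⟨i, hi, h1⟩ := lt_mx_iff.mp h1
    obtain ⟨j, hj, h2⟩ := lt_mx_iff.mp h2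
    simp only [Set.mem_iUnion]
    exact ⟨(i, j), by simp; omega, h1, h2⟩
  refine (measureReal_mono hsub (measure_ne_top _ _)).trans ((measureReal_biUnion_finset_le _ _).trans ?_)
  refine (sum_le_card_nsmul _ _ (exp (s ^ 2 * n * (1 + (2 * overlap n (q 0) (q' 0) ^ 2 + 32 * (m / n : ℝ) ^ 2)) - 2 * s * L)) ?_).trans ?_
  · rintro ⟨i, j⟩ hz
    simp only [mem_product, mem_range] at hz
    refine (pair_tail hG (q i) (q' j) s L hs).trans ?_
    apply exp_le_exp.mpr
    have h1 := ov_close hn m q q' hq hq' i j (by omega) (by omega)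
    have h2 : overlap n (q i) (q' j) ^ p ≤ overlap n (q i) (q' j) ^ 2 := by
      calc _ ≤ |overlap n (q i) (q' j)| ^ p := by rw [← abs_pow]; exact le_abs_self _
        _ ≤ |overlap n (q i) (q' j)| ^ 2 := pow_le_pow_of_le_one (abs_nonneg _) (abs_overlap_le _ _) hp
        _ = _ := sq_abs _
    have := mul_le_mul_of_nonneg_left (h2.trans h1) (by positivity : 0 ≤ s ^ 2 * n)
    linarith
  · rw [card_product, card_range, nsmul_eq_mul]
    push_cast
    apply le_of_eq; ring
end Pairs


/-- fraction of blocks of the walk with an exceedance -/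
noncomputable def AA (n m : ℕ) (L : ℝ) (h : V n → ℝ) : ℝ :=
  Ew n m (fun q => if L < mx m (fun i => h (q i)) then 1 else 0)

section Second
variable {n : ℕ} {Ω : Type*} [MeasurableSpace Ω] {P : Measure Ω} [IsProbabilityMeasure P]
  {p : ℕ} {H : V n → Ω → ℝ}

lemma Ew_integrable (m : ℕ) (F : (ℕ → V n) → Ω → ℝ) (hF : ∀ q, Integrable (F q) P) :
    Integrable (fun ω => Ew n m (fun q => F q ω)) P := by
  unfold Ew
  exact (integrable_finsetSum _ fun κ _ => integrable_finsetSum _ fun x _ => hF _).div_const _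

lemma int_Ew (m : ℕ) (F : (ℕ → V n) → Ω → ℝ) (hF : ∀ q, Integrable (F q) P) :
    ∫ ω, Ew n m (fun q => F q ω) ∂P = Ew n m (fun q => ∫ ω, F q ω ∂P) := by
  unfold Ew
  rw [integral_div, integral_finsetSum _ fun κ _ => integrable_finsetSum _ fun x _ => hF _]
  congr 1
  refine sum_congr rfl fun κ _ => ?_
  rw [integral_finsetSum _ fun x _ => hF _]

lemma ind_aux {S : Set Ω} (hS : MeasurableSet S) (f : Ω → ℝ) (hf : ∀ ω, f ω = S.indicator 1 ω) :
    Integrable f P ∧ ∫ ω, f ω ∂P = P.real S := by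
  have : f = S.indicator 1 := funext hf
  rw [this]
  exact ⟨(integrable_const (1 : ℝ)).indicator hS, integral_indicator_one hS⟩

lemma mS_mx (hH : ∀ x, Measurable (H x)) (m : ℕ) (q : ℕ → V n) (L : ℝ) :
    MeasurableSet {ω | L < mx m (fun i => H (q i) ω)} :=
  measurableSet_lt measurable_const (measurable_mx m (fun i => H (q i)) fun i => hH _)

lemma AA_mean (hH : ∀ x, Measurable (H x)) (m : ℕ) (L : ℝ) :
    Integrable (fun ω => AA n m L (fun x => H x ω)) P ∧
    ∫ ω, AA n m L (fun x => H x ω) ∂P = QM P H m L := by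
  have h : ∀ q : ℕ → V n, _ := fun q => ind_aux (P := P) (mS_mx hH m q L)
    (fun ω => if L < mx m (fun i => H (q i) ω) then 1 else 0) (fun ω => by simp [Set.indicator])
  refine ⟨Ew_integrable m _ fun q => (h q).1, ?_⟩
  unfold AA
  rw [int_Ew m _ fun q => (h q).1]
  unfold QM Qq
  congr 1; funext q
  exact (h q).2

lemma AA_sq (hH : ∀ x, Measurable (H x)) (m : ℕ) (L : ℝ) :
    Integrable (fun ω => AA n m L (fun x => H x ω) ^ 2) P ∧
    ∫ ω, AA n m L (fun x => H x ω) ^ 2 ∂P = Ew n m (fun q => Ew n m (fun q' =>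
      P.real {ω | L < mx m (fun i => H (q i) ω) ∧ L < mx m (fun i => H (q' i) ω)})) := by
  have e : ∀ ω, AA n m L (fun x => H x ω) ^ 2 = Ew n m (fun q => Ew n m (fun q' =>
      if L < mx m (fun i => H (q i) ω) ∧ L < mx m (fun i => H (q' i) ω) then 1 else 0)) := by
    intro ω
    unfold AA
    rw [sq, ← Ew_mul_right]
    congr 1; funext q
    rw [← Ew_mul_left]
    congr 1; funext q'
    by_cases h1 : L < mx m (fun i => H (q i) ω) <;> by_cases h2 : L < mx m (fun i => H (q' i) ω) <;> simp [h1, h2]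
  have h : ∀ q q' : ℕ → V n, _ := fun q q' => ind_aux (P := P) ((mS_mx hH m q L).inter (mS_mx hH m q' L))
    (fun ω => if L < mx m (fun i => H (q i) ω) ∧ L < mx m (fun i => H (q' i) ω) then 1 else 0)
    (fun ω => by simp [Set.indicator])
  have i2 : ∀ q : ℕ → V n, Integrable (fun ω => Ew n m (fun q' =>
      if L < mx m (fun i => H (q i) ω) ∧ L < mx m (fun i => H (q' i) ω) then (1 : ℝ) else 0)) P :=
    fun q => Ew_integrable m _ fun q' => (h q q').1
  simp_rw [e]
  refine ⟨Ew_integrable m _ i2, ?_⟩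
  rw [int_Ew m _ i2]
  congr 1; funext q
  rw [int_Ew m _ fun q' => (h q q').1]
  congr 1; funext q'
  exact (h q q').2

lemma second_moment (hn : n ≠ 0) (hp : 2 ≤ p) (hG : GV P H (fun x y => (n : ℝ) * overlap n x y ^ p)) (m : ℕ)
    {L l h τ r r0 s e1 η : ℝ} (h0 : 0 ≤ r0)
    (hr : r0 + 4 * m / n ≤ r) (hr1 : r ≤ 1) (hl : 0 ≤ l) (hh : 0 ≤ h) (hs : 0 ≤ s) (hs2 : s ^ 2 ≤ 1 / 16)
    (he1 : (m + 1) * exp (l ^ 2 * n / 2 - l * (L - τ) - h * τ + (l + h) ^ 2 * (n * r ^ 2) / 2) ≤ e1)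
    (hη : 2 * (m + 1) * exp (- h * τ + h ^ 2 * (n * r ^ 2) / 2) ≤ η) (hη1 : η < 1) :
    ∫ ω, AA n m L (fun x => H x ω) ^ 2 ∂P ≤ (QM P H m (L - 2 * τ) + e1) ^ 2 / (1 - η) +
      (m + 1) ^ 2 * exp (s ^ 2 * n * (1 + 32 * (m / n : ℝ) ^ 2) - 2 * s * L - n * r0 ^ 2 / 8) * (2 * n + 1) := by
  rw [(AA_sq hG.meas m L).2]
  set C := (m + 1 : ℝ) ^ 2 * exp (s ^ 2 * n * (1 + 32 * (m / n : ℝ) ^ 2) - 2 * s * L - n * r0 ^ 2 / 8) with hC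
  have hn' : (0 : ℝ) < n := by exact_mod_cast Nat.pos_of_ne_zero hn
  have he0 : 0 ≤ e1 := le_trans (by positivity) he1
  have hQ0 : ∀ q, 0 ≤ Qq P H m q (L - 2 * τ) := fun q => measureReal_nonneg
  have key : ∀ q q' : ℕ → V n, IsW q → IsW q' →
      P.real {ω | L < mx m (fun i => H (q i) ω) ∧ L < mx m (fun i => H (q' i) ω)} ≤
      (Qq P H m q (L - 2 * τ) + e1) * (Qq P H m q' (L - 2 * τ) + e1) / (1 - η) +
      C * exp (n * overlap n (q' 0) (q 0) ^ 2 / 4) := by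
    intro q q' hq hq'
    have hpos1 : 0 ≤ (Qq P H m q (L - 2 * τ) + e1) * (Qq P H m q' (L - 2 * τ) + e1) / (1 - η) := by
      have := hQ0 q; have := hQ0 q'
      have : 0 < 1 - η := by linarith
      positivity
    rw [overlap_comm (q' 0)]
    by_cases hR : |overlap n (q 0) (q' 0)| ≤ r0
    · refine le_add_of_le_of_nonneg ?_ (by positivity)
      rw [le_div_iff₀ (by linarith), mul_comm]
      have := two_path hn hp hG m q q' hq hq' (L := L) (l := l) (h := h) (τ := τ) (r := r)
        (by linarith) hr1 hl hh
      refine le_trans ?_ (this.trans ?_)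
      · apply mul_le_mul_of_nonneg_right _ measureReal_nonneg
        linarith
      · have := hQ0 q; have := hQ0 q'
        gcongr
    · refine le_add_of_nonneg_of_le hpos1 ?_
      push Not at hR
      refine (bad_pair hn hp hG m q q' hq hq' L s hs).trans ?_
      rw [hC, mul_assoc ((m + 1 : ℝ) ^ 2), ← exp_add]
      gcongr
      have h1 : r0 ^ 2 ≤ overlap n (q 0) (q' 0) ^ 2 := by
        rw [← sq_abs (overlap n (q 0) (q' 0))]; gcongr
      have h2 : s ^ 2 * (n * overlap n (q 0) (q' 0) ^ 2) ≤ 1 / 16 * (n * overlap n (q 0) (q' 0) ^ 2) := by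
        gcongr
      have h3 : n * r0 ^ 2 ≤ n * overlap n (q 0) (q' 0) ^ 2 := by gcongr
      linarith
  have step : ∀ q : ℕ → V n, IsW q → Ew n m (fun q' => P.real {ω | L < mx m (fun i => H (q i) ω) ∧ L < mx m (fun i => H (q' i) ω)}) ≤
      (Qq P H m q (L - 2 * τ) + e1) * ((QM P H m (L - 2 * τ) + e1) / (1 - η)) + C * (2 * n + 1) := by
    intro q hq
    refine (Ew_mono _ _ fun q' hq' => key q q' hq hq').trans ?_
    rw [Ew_add, Ew_mul_left, Ew_zero_coord hn (fun x => exp (n * overlap n x (q 0) ^ 2 / 4))]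
    refine add_le_add (le_of_eq ?_) ?_
    · simp_rw [mul_div_assoc]
      rw [Ew_mul_left]
      simp_rw [div_eq_mul_inv]
      rw [Ew_mul_right, Ew_add, Ew_const hn]
      rfl
    · have := exp_ov_avg hn (q 0)
      have hC0 : 0 ≤ C := by positivity
      gcongr
      rw [div_le_iff₀ (by positivity)]
      exact this
  refine (Ew_mono _ _ step).trans ?_
  rw [Ew_add, Ew_const hn, Ew_mul_right, Ew_add, Ew_const hn]
  apply le_of_eq
  unfold QM
  ring
end Second


section pe6
variable {c : ℝ}

lemma Sn_nonneg {t : ℝ} (ht : 0 < t) (n : ℕ) : 0 ≤ Sn c n t := by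
  have := aseq_nonneg (c := c) n
  unfold Sn; positivity

lemma gm_inv_le (hc1 : c < 1 / 2) {n : ℕ} (hn : 1 ≤ (n : ℝ)) : (γseq c n)⁻¹ ≤ n := by
  unfold γseq
  rw [← rpow_neg (by linarith), neg_neg]
  calc (n : ℝ) ^ c ≤ (n : ℝ) ^ (1 : ℝ) := rpow_le_rpow_of_exponent_le hn (by linarith)
    _ = n := rpow_one _

lemma aseq_le (hc1 : c < 1 / 2) {n : ℕ} (hn : 1 ≤ (n : ℝ)) :
    aseq c n * exp (-(γseq c n ^ 2 * n / 2)) ≤ 3 * n ^ 2 := by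
  have h1 : √(2 * π * n) ≤ 3 * n := by
    rw [sqrt_le_left (by positivity)]
    have := pi_lt_d2
    nlinarith
  have h2 := gm_inv_le hc1 hn
  have h3 : 0 < (γseq c n)⁻¹ := inv_pos.2 (gm_pos (by linarith))
  unfold aseq
  rw [mul_assoc, ← exp_add, add_neg_cancel, exp_zero, mul_one]
  calc √(2 * π * n) * (γseq c n)⁻¹ ≤ (3 * n) * n := by gcongr
    _ = _ := by ring

lemma Sn_exp_le (hc1 : c < 1 / 2) {t : ℝ} (ht : 0 < t) {n : ℕ} (hn : 1 ≤ (n : ℝ)) :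
    Sn c n t * ((mm c n + 1) * exp (-(γseq c n ^ 2 * n / 2))) ≤ 6 * t * n ^ 2 := by
  have h1 := aseq_le hc1 hn
  have hm1 : 1 ≤ (mm c n : ℝ) := by
    have := mm_pos (c := c) (n := n) (by exact_mod_cast (by linarith : (0:ℝ) < n))
    exact_mod_cast (by exact_mod_cast this : 0 < mm c n)
  have h2 : ((mm c n : ℝ) + 1) / mm c n ≤ 2 := by
    rw [div_le_iff₀ (by linarith)]; linarith
  have := aseq_nonneg (c := c) n
  calc Sn c n t * ((mm c n + 1) * exp (-(γseq c n ^ 2 * n / 2)))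
      = (aseq c n * exp (-(γseq c n ^ 2 * n / 2))) * t * (((mm c n : ℝ) + 1) / mm c n) := by
        unfold Sn; ring
    _ ≤ (3 * n ^ 2) * t * 2 := by gcongr
    _ = _ := by ring

lemma gm_nr0 {n : ℕ} (hn : 0 < (n : ℝ)) : (n : ℝ) * ((n : ℝ) ^ (-(1 - c) / 2)) ^ 2 = (n : ℝ) ^ c := by
  rw [← rpow_natCast, ← rpow_mul hn.le]
  nth_rewrite 1 [← rpow_one (n : ℝ)]
  rw [← rpow_add hn]; congr 1; push_cast; ring

lemma gm_mmsq (hc0 : 0 < c) (hc1 : c < 1 / 2) {n : ℕ} (hn : 0 < n) :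
    γseq c n ^ 2 * n * ((mm c n : ℝ) / n) ^ 2 ≤ 4 * (n : ℝ) ^ (-(2 * bb c)) := by
  have hn' : (0 : ℝ) < n := by exact_mod_cast hn
  have h1 := mm_le (c := c) hc0 hc1 hn
  have e : (4 : ℝ) * (n : ℝ) ^ (-(2 * bb c)) = γseq c n ^ 2 * n * (2 * (n : ℝ) ^ (2 * c + bb c) / n) ^ 2 := by
    rw [gm_sq hn', div_pow, mul_pow, ← rpow_natCast ((n : ℝ) ^ (2 * c + bb c)), ← rpow_mul hn'.le]
    rw [show ((n : ℝ) ^ 2) = (n : ℝ) ^ (2 : ℝ) by norm_num]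
    rw [show (2 : ℝ) ^ 2 = 4 by norm_num]
    rw [mul_div_assoc, ← rpow_sub hn', mul_left_comm, ← rpow_add hn']
    congr 2; unfold bb; push_cast; ring
  rw [e]
  gcongr

lemma hsq_bound (hc0 : 0 < c) (hc1 : c < 1 / 2) {n : ℕ} (hn : 0 < n) {σ : ℝ} (hs1 : σ ≤ c / 2) (hs2 : σ ≤ bb c) :
    (γseq c n * (n : ℝ) ^ σ) ^ 2 * (n * ((n : ℝ) ^ (-(1 - c) / 2) + 4 * mm c n / n) ^ 2) ≤ 130 := by
  have hn' : (0 : ℝ) < n := by exact_mod_cast hn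
  have hn1 : (1 : ℝ) ≤ n := by exact_mod_cast hn
  have h1 := gm_mmsq hc0 hc1 hn
  set r0 := (n : ℝ) ^ (-(1 - c) / 2)
  set q := (mm c n : ℝ) / n
  have h2 : γseq c n ^ 2 * (n * r0 ^ 2) = (n : ℝ) ^ (-c) := by
    rw [gm_nr0 hn']; unfold γseq
    rw [← rpow_natCast, ← rpow_mul hn'.le, ← rpow_add hn']; congr 1; push_cast; ring
  have e0 : r0 + 4 * (mm c n : ℝ) / n = r0 + 4 * q := by simp only [q]; ring
  have h3 : (r0 + 4 * q) ^ 2 ≤ 2 * r0 ^ 2 + 32 * q ^ 2 := by nlinarith [sq_nonneg (r0 - 4 * q)]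
  have e1 : ((n : ℝ) ^ σ) ^ 2 = (n : ℝ) ^ (2 * σ) := by
    rw [← rpow_natCast, ← rpow_mul hn'.le]; congr 1; push_cast; ring
  have h4 : (n : ℝ) ^ (2 * σ) * (n : ℝ) ^ (-c) ≤ 1 := by
    rw [← rpow_add hn']; exact rpow_le_one_of_one_le_of_nonpos hn1 (by linarith)
  have h5 : (n : ℝ) ^ (2 * σ) * (n : ℝ) ^ (-(2 * bb c)) ≤ 1 := by
    rw [← rpow_add hn']; exact rpow_le_one_of_one_le_of_nonpos hn1 (by linarith)
  have h6 : 0 < (n : ℝ) ^ (2 * σ) := rpow_pos_of_pos hn' _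
  rw [e0, mul_pow, e1]
  calc γseq c n ^ 2 * (n : ℝ) ^ (2 * σ) * (n * (r0 + 4 * q) ^ 2)
      ≤ γseq c n ^ 2 * (n : ℝ) ^ (2 * σ) * (n * (2 * r0 ^ 2 + 32 * q ^ 2)) := by gcongr
    _ = (n : ℝ) ^ (2 * σ) * (2 * (γseq c n ^ 2 * (n * r0 ^ 2)) + 32 * (γseq c n ^ 2 * n * q ^ 2)) := by ring
    _ ≤ (n : ℝ) ^ (2 * σ) * (2 * (n : ℝ) ^ (-c) + 32 * (4 * (n : ℝ) ^ (-(2 * bb c)))) := by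
        rw [h2]; gcongr
    _ = 2 * ((n : ℝ) ^ (2 * σ) * (n : ℝ) ^ (-c)) + 128 * ((n : ℝ) ^ (2 * σ) * (n : ℝ) ^ (-(2 * bb c))) := by ring
    _ ≤ 130 := by linarith

lemma Lv_shift {n : ℕ} (hn : 0 < (n : ℝ)) {v : ℝ} (hv : 0 < v) (d : ℝ) :
    Lv c n v - 2 * (d / γseq c n) = Lv c n (v * exp (-(2 * d))) := by
  have := gm_pos (c := c) hn
  unfold Lv
  rw [log_mul hv.ne' (exp_pos _).ne', log_exp]
  field_simp; ring

set_option maxHeartbeats 800000 in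
lemma AA_sq_upper (hc0 : 0 < c) (hc1 : c < 1 / 2) {p : ℕ} (hp : 2 ≤ p)
    {Ω : Type*} [MeasurableSpace Ω] {P : Measure Ω} [IsProbabilityMeasure P]
    {H : (n : ℕ) → V n → Ω → ℝ} (hG : ∀ n, GV P (H n) (fun x y => (n : ℝ) * overlap n x y ^ p))
    {v : ℝ} (hv : 0 < v) {t : ℝ} (ht : 0 < t) {d : ℝ} (hd : 0 < d) :
    ∃ g : ℕ → ℝ, Tendsto g atTop (nhds ((2 * p * t / (v * exp (-(2 * d)))) ^ 2)) ∧
      ∀ᶠ n in atTop, Sn c n t ^ 2 * ∫ ω, AA n (mm c n) (Lv c n v) (fun x => H n x ω) ^ 2 ∂P ≤ g n := by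
  obtain ⟨σ, hσ0, hs1, hs2⟩ : ∃ σ : ℝ, 0 < σ ∧ σ ≤ c / 2 ∧ σ ≤ bb c :=
    ⟨min (c / 2) (bb c), lt_min (by linarith) (bb_pos hc1), min_le_left _ _, min_le_right _ _⟩
  have hb := bb_pos hc1
  let E1 : ℕ → ℝ := fun n => 6 * t * exp (-log v + d + 260) * ((n : ℝ) ^ (2 : ℝ) * exp (-(d * (n : ℝ) ^ σ)))
  let η : ℕ → ℝ := fun n => 6 * exp 65 * ((n : ℝ) ^ (1 : ℝ) * exp (-(d * (n : ℝ) ^ σ)))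
  let Bd : ℕ → ℝ := fun n => 108 * t ^ 2 * exp (128 - 2 * log v) * ((n : ℝ) ^ (5 : ℝ) * exp (-((1 / 8) * (n : ℝ) ^ c)))
  have hE1 : Tendsto E1 atTop (nhds 0) := by
    have := (poly_exp 2 hσ0 hd).const_mul (6 * t * exp (-log v + d + 260))
    rwa [mul_zero] at this
  have hη : Tendsto η atTop (nhds 0) := by
    have := (poly_exp 1 hσ0 hd).const_mul (6 * exp 65)
    rwa [mul_zero] at this
  have hBd : Tendsto Bd atTop (nhds 0) := by
    have := (poly_exp 5 hc0 (show (0 : ℝ) < 1 / 8 by norm_num)).const_mul (108 * t ^ 2 * exp (128 - 2 * log v))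
    rwa [mul_zero] at this
  have hQ := QM_tend hc0 hc1 (show 1 ≤ p by omega) hG (show 0 < v * exp (-(2 * d)) by positivity) ht
  refine ⟨fun n => (Sn c n t * QM P (H n) (mm c n) (Lv c n (v * exp (-(2 * d)))) + E1 n) ^ 2 / (1 - η n) + Bd n, ?_, ?_⟩
  · have := (((hQ.add hE1).pow 2).div (hη.const_sub 1) (by norm_num)).add hBd
    simpa using this
  have hr1 : ∀ᶠ n : ℕ in atTop, (n : ℝ) ^ (-(1 - c) / 2) + 4 * mm c n / n < 1 := by
    have h := (nrp_zero (show -(1 - c) / 2 < 0 by linarith)).add ((mm_div hc0 hc1).const_mul 4)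
    simp only [mul_zero, add_zero] at h
    filter_upwards [h.eventually_lt_const (show (0 : ℝ) < 1 by norm_num)] with n hn
    rw [mul_div_assoc]; exact hn
  have hγ : ∀ᶠ n : ℕ in atTop, γseq c n < 1 / 4 := (gm_zero hc0).eventually_lt_const (by norm_num)
  filter_upwards [eventually_gt_atTop 0, hr1, hγ, hη.eventually_lt_const (show (0 : ℝ) < 1 by norm_num)] with n hn hr1 hγ hη1
  have hn' : (0 : ℝ) < n := by exact_mod_cast hn
  have hn1 : (1 : ℝ) ≤ n := by exact_mod_cast hn
  have hg := gm_pos (c := c) hn'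
  set γ := γseq c n with hγd
  have hτ := Lv_shift (c := c) hn' hv d
  have hsq := hsq_bound hc0 hc1 hn hs1 hs2
  have hnσ : 1 ≤ (n : ℝ) ^ σ := one_le_rpow hn1 hσ0.le
  have hSn := Sn_nonneg (c := c) ht n
  have hSe := Sn_exp_le hc1 ht hn1
  have hm0 : (mm c n : ℝ) ≤ 2 * n := by
    have h1 := mm_le (c := c) hc0 hc1 hn
    have h2 : (n : ℝ) ^ (2 * c + bb c) ≤ n := by
      calc (n : ℝ) ^ (2 * c + bb c) ≤ (n : ℝ) ^ (1 : ℝ) := rpow_le_rpow_of_exponent_le hn1 (by unfold bb; linarith)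
        _ = n := rpow_one _
    linarith
  have hmm := gm_mmsq hc0 hc1 hn
  have hnr := gm_nr0 (c := c) hn'
  rw [← hγd] at hτ hsq hSe hmm
  set r0 := (n : ℝ) ^ (-(1 - c) / 2) with hr0
  set r := r0 + 4 * mm c n / n with hr
  set L := Lv c n v with hL
  set h := γ * (n : ℝ) ^ σ with hh
  have hr0' : 0 ≤ r0 := by positivity
  have hhγ : γ ≤ h := by rw [hh]; exact le_mul_of_one_le_right hg.le hnσ
  have hγL : γ * L = γ ^ 2 * n + log v := by rw [hL]; unfold Lv; rw [← hγd]; field_simp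
  have hγτ : γ * (d / γ) = d := by field_simp
  have hhτ : h * (d / γ) = d * (n : ℝ) ^ σ := by rw [hh]; field_simp
  let e1 := (mm c n + 1) * exp (-(γ ^ 2 * n / 2) - log v + d + 260 - d * (n : ℝ) ^ σ)
  have k1 : ((mm c n : ℝ) + 1) * exp (γ ^ 2 * n / 2 - γ * (L - d / γ) - h * (d / γ) + (γ + h) ^ 2 * (n * r ^ 2) / 2) ≤ e1 := by
    apply mul_le_mul_of_nonneg_left _ (by positivity)
    apply exp_le_exp.2
    have q1 : (γ + h) ^ 2 * (n * r ^ 2) ≤ 4 * (h ^ 2 * (n * r ^ 2)) := by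
      rw [← mul_assoc 4]
      apply mul_le_mul_of_nonneg_right _ (by positivity)
      nlinarith
    rw [mul_sub, hγL, hγτ, hhτ]
    linarith
  have k2 : 2 * ((mm c n : ℝ) + 1) * exp (- h * (d / γ) + h ^ 2 * (n * r ^ 2) / 2) ≤ η n := by
    have q1 : exp (- h * (d / γ) + h ^ 2 * (n * r ^ 2) / 2) ≤ exp 65 * exp (-(d * (n : ℝ) ^ σ)) := by
      rw [← exp_add]; apply exp_le_exp.2; rw [neg_mul, hhτ]; linarith
    calc 2 * ((mm c n : ℝ) + 1) * exp (- h * (d / γ) + h ^ 2 * (n * r ^ 2) / 2)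
        ≤ 2 * (2 * n + n) * (exp 65 * exp (-(d * (n : ℝ) ^ σ))) := by gcongr
      _ = η n := by simp only [η, rpow_one]; ring
  have key := second_moment hn.ne' hp (hG n) (mm c n) (L := L) (l := γ) (h := h) (τ := d / γ) (r := r) (r0 := r0) (s := γ)
    (e1 := e1) (η := η n) hr0' le_rfl hr1.le hg.le (hg.le.trans hhγ) hg.le (by nlinarith) k1 k2 hη1
  rw [hτ] at key
  set Q := QM P (H n) (mm c n) (Lv c n (v * exp (-(2 * d))))
  have hQ0 : 0 ≤ Q := by
    refine Ew_nonneg _ fun q _ => measureReal_nonneg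
  have e10 : 0 ≤ e1 := by positivity
  have k3 : Sn c n t * e1 ≤ E1 n := by
    calc Sn c n t * e1 = Sn c n t * ((mm c n + 1) * exp (-(γ ^ 2 * n / 2))) * (exp (-log v + d + 260) * exp (-(d * (n : ℝ) ^ σ))) := by
          simp only [e1]
          rw [show -(γ ^ 2 * n / 2) - log v + d + 260 - d * (n : ℝ) ^ σ = -(γ ^ 2 * n / 2) + (-log v + d + 260 + -(d * (n : ℝ) ^ σ)) by ring,
            exp_add, exp_add (-log v + d + 260)]
          ring
      _ ≤ 6 * t * n ^ 2 * (exp (-log v + d + 260) * exp (-(d * (n : ℝ) ^ σ))) := by gcongr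
      _ = E1 n := by simp only [E1, rpow_two]; ring
  have k4 : Sn c n t ^ 2 * ((mm c n + 1) ^ 2 * exp (γ ^ 2 * n * (1 + 32 * (mm c n / n : ℝ) ^ 2) - 2 * γ * L - n * r0 ^ 2 / 8) * (2 * n + 1)) ≤ Bd n := by
    have q2 : (n : ℝ) ^ (-(2 * bb c)) ≤ 1 := rpow_le_one_of_one_le_of_nonpos hn1 (by linarith)
    have q1 : exp (γ ^ 2 * n * (1 + 32 * (mm c n / n : ℝ) ^ 2) - 2 * γ * L - n * r0 ^ 2 / 8) ≤
        exp (-(γ ^ 2 * n / 2)) ^ 2 * (exp (128 - 2 * log v) * exp (-((1 / 8) * (n : ℝ) ^ c))) := by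
      rw [← exp_nat_mul, ← exp_add, ← exp_add]; apply exp_le_exp.2
      rw [hnr, mul_assoc 2 γ L, hγL]
      push_cast
      linarith
    calc Sn c n t ^ 2 * ((mm c n + 1) ^ 2 * exp (γ ^ 2 * n * (1 + 32 * (mm c n / n : ℝ) ^ 2) - 2 * γ * L - n * r0 ^ 2 / 8) * (2 * n + 1))
        ≤ Sn c n t ^ 2 * ((mm c n + 1) ^ 2 * (exp (-(γ ^ 2 * n / 2)) ^ 2 * (exp (128 - 2 * log v) * exp (-((1 / 8) * (n : ℝ) ^ c)))) * (2 * n + n)) := by gcongr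
      _ = (Sn c n t * ((mm c n + 1) * exp (-(γ ^ 2 * n / 2)))) ^ 2 * (exp (128 - 2 * log v) * exp (-((1 / 8) * (n : ℝ) ^ c)) * (3 * n)) := by ring
      _ ≤ (6 * t * n ^ 2) ^ 2 * (exp (128 - 2 * log v) * exp (-((1 / 8) * (n : ℝ) ^ c)) * (3 * n)) := by gcongr
      _ = Bd n := by
          simp only [Bd]
          rw [show (n : ℝ) ^ (5 : ℝ) = (n : ℝ) ^ 5 by norm_cast]
          ring
  calc Sn c n t ^ 2 * ∫ ω, AA n (mm c n) L (fun x => H n x ω) ^ 2 ∂P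
      ≤ Sn c n t ^ 2 * ((Q + e1) ^ 2 / (1 - η n) +
        (mm c n + 1) ^ 2 * exp (γ ^ 2 * n * (1 + 32 * (mm c n / n : ℝ) ^ 2) - 2 * γ * L - n * r0 ^ 2 / 8) * (2 * n + 1)) := by gcongr
    _ = (Sn c n t * Q + Sn c n t * e1) ^ 2 / (1 - η n) + Sn c n t ^ 2 * ((mm c n + 1) ^ 2 * exp (γ ^ 2 * n * (1 + 32 * (mm c n / n : ℝ) ^ 2) - 2 * γ * L - n * r0 ^ 2 / 8) * (2 * n + 1)) := by ring
    _ ≤ (Sn c n t * Q + E1 n) ^ 2 / (1 - η n) + Bd n := by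
        have : 0 ≤ 1 - η n := by linarith
        gcongr

/-- L² convergence of the normalised block average. -/
lemma AA_L2 (hc0 : 0 < c) (hc1 : c < 1 / 2) {p : ℕ} (hp : 2 ≤ p)
    {Ω : Type*} [MeasurableSpace Ω] {P : Measure Ω} [IsProbabilityMeasure P]
    {H : (n : ℕ) → V n → Ω → ℝ} (hG : ∀ n, GV P (H n) (fun x y => (n : ℝ) * overlap n x y ^ p))
    {v : ℝ} (hv : 0 < v) {t : ℝ} (ht : 0 < t) :
    Tendsto (fun n => ∫ ω, (Sn c n t * AA n (mm c n) (Lv c n v) (fun x => H n x ω) - 2 * p * t / v) ^ 2 ∂P) atTop (nhds 0) := by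
  set κ := 2 * p * t / v with hκ
  have hQ := QM_tend hc0 hc1 (show 1 ≤ p by omega) hG hv ht
  have hexp : ∀ n, ∫ ω, (Sn c n t * AA n (mm c n) (Lv c n v) (fun x => H n x ω) - κ) ^ 2 ∂P =
      Sn c n t ^ 2 * ∫ ω, AA n (mm c n) (Lv c n v) (fun x => H n x ω) ^ 2 ∂P
        - 2 * κ * (Sn c n t * QM P (H n) (mm c n) (Lv c n v)) + κ ^ 2 := by
    intro n
    have h1 := AA_mean (P := P) (hG n).meas (mm c n) (Lv c n v)
    have h2 := (AA_sq (P := P) (hG n).meas (mm c n) (Lv c n v)).1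
    rw [← h1.2, ← integral_const_mul, ← integral_const_mul, ← integral_const_mul]
    rw [← integral_sub (h2.const_mul _) ((h1.1.const_mul _).const_mul _)]
    have : κ ^ 2 = ∫ _, κ ^ 2 ∂P := by simp
    rw [this]
    refine Eq.trans ?_ (integral_add ((h2.const_mul _).sub ((h1.1.const_mul _).const_mul _)) (integrable_const _))
    congr 1; ext ω; ring
  refine tend_of_sandwich (fun d => (2 * p * t / (v * exp (-(2 * d)))) ^ 2 - 2 * κ * κ + κ ^ 2) (fun _ => 0)
    ?_ continuousAt_const (by simp [hκ]; ring) rfl ?_ ?_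
  · have : ∀ d : ℝ, v * exp (-(2 * d)) ≠ 0 := fun d => by positivity
    fun_prop (disch := exact this _)
  · intro d hd _
    obtain ⟨g, hg, hle⟩ := AA_sq_upper hc0 hc1 hp hG hv ht hd
    refine ⟨fun n => g n - 2 * κ * (Sn c n t * QM P (H n) (mm c n) (Lv c n v)) + κ ^ 2,
      (hg.sub (hQ.const_mul _)).add_const _, ?_⟩
    filter_upwards [hle] with n hn
    rw [hexp]; linarith
  · intro d _ _
    exact ⟨fun _ => 0, tendsto_const_nhds, Eventually.of_forall fun n => integral_nonneg (μ := P) fun ω => sq_nonneg _⟩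
end pe6


section pf1
variable {n : ℕ}

def negV (x : V n) : V n := fun i => !x i

lemma negV_flip (c : Fin n) (x : V n) : negV (flipV c x) = flipV c (negV x) := by
  ext i
  by_cases h : i = c
  · subst h; simp [negV, flipV_same]
  · simp [negV, flipV_ne _ _ _ h]

lemma hd_negV (x y : V n) : hammingDist (negV x) y + hammingDist x y = n := by
  unfold hammingDist
  have : (univ.filter fun i => negV x i ≠ y i) = univ.filter fun i => ¬ (x i ≠ y i) := by
    refine filter_congr fun i _ => ?_
    simp only [negV]
    generalize x i = a; generalize y i = b; revert a b; decide
  rw [this, add_comm, card_filter_add_card_filter_not]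
  simp

lemma flip_step (hn : n ≠ 0) {s : ℝ} (h0 : 0 ≤ s) (h1 : s ≤ 1 / 4) (x y : V n) :
    (∑ c, exp (-(s * hammingDist (flipV c x) y))) / n ≤
      (1 - s / 4) * exp (-(s * hammingDist x y)) + exp (s - s * n / 4) := by
  have hn' : (0 : ℝ) < n := by exact_mod_cast Nat.pos_of_ne_zero hn
  set d := hammingDist x y with hd
  have hterm : ∀ c, exp (-(s * hammingDist (flipV c x) y)) =
      exp (-(s * d)) * (if x c ≠ y c then exp s else exp (-s)) := by
    intro c
    split_ifs with h
    · have := hd_flip_ne c x y h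
      rw [← exp_add]; congr 1; rw [hd, this]; push_cast; ring
    · have := hd_flip_eq c x y (by simpa using h)
      rw [← exp_add]; congr 1; rw [hd, this]; push_cast; ring
  simp_rw [hterm]
  rw [← mul_sum]
  by_cases hdn : (d : ℝ) ≤ n / 4
  · have hs : ∑ c, (if x c ≠ y c then exp s else exp (-s)) = n * exp (-s) + d * (exp s - exp (-s)) := by
      have : ∀ c, (if x c ≠ y c then exp s else exp (-s)) = exp (-s) + (if x c ≠ y c then (1 : ℝ) else 0) * (exp s - exp (-s)) := by
        intro c; split_ifs <;> ring
      simp_rw [this]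
      rw [sum_add_distrib, ← sum_mul, ← Finset.natCast_card_filter]
      simp [hd, hammingDist]
    have e1 : exp s ≤ 1 + s + s ^ 2 := by
      have := abs_le.1 (abs_exp_sub_one_sub_id_le (x := s) (by rw [abs_le]; constructor <;> linarith))
      linarith [this.2]
    have e2 : exp (-s) ≤ 1 - s + s ^ 2 := by
      have := abs_le.1 (abs_exp_sub_one_sub_id_le (x := -s) (by rw [abs_le]; constructor <;> linarith))
      have := this.2
      rw [neg_sq] at this
      linarith
    have e3 : exp (-s) ≤ exp s := exp_le_exp.2 (by linarith)
    have e4 : (n * exp (-s) + d * (exp s - exp (-s))) / n ≤ 1 - s / 4 := by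
      rw [div_le_iff₀ hn']
      have : d * (exp s - exp (-s)) ≤ n / 4 * (exp s - exp (-s)) := by
        apply mul_le_mul_of_nonneg_right hdn; linarith
      have h5 : 3 / 4 * exp (-s) + 1 / 4 * exp s ≤ 1 - s / 4 := by nlinarith
      nlinarith
    rw [hs, mul_div_assoc, mul_comm]
    have := mul_le_mul_of_nonneg_right e4 (exp_pos (-(s * d))).le
    linarith [exp_pos (s - s * n / 4)]
  · push Not at hdn
    have hs : ∑ c, (if x c ≠ y c then exp s else exp (-s)) ≤ ∑ _c : Fin n, exp s := by
      apply sum_le_sum; intro c _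
      split_ifs
      · exact le_rfl
      · exact exp_le_exp.2 (by linarith)
    have hs2 : (∑ c, (if x c ≠ y c then exp s else exp (-s))) / n ≤ exp s := by
      rw [div_le_iff₀ hn']; simpa [mul_comm] using hs
    have h6 : exp (-(s * d)) * exp s ≤ exp (s - s * n / 4) := by
      rw [← exp_add]; apply exp_le_exp.2; nlinarith
    have h7 : exp (-(s * d)) * ((∑ c, (if x c ≠ y c then exp s else exp (-s))) / n) ≤ exp (-(s * d)) * exp s := by gcongr
    rw [mul_div_assoc]
    have : 0 ≤ (1 - s / 4) * exp (-(s * d)) := mul_nonneg (by linarith) (exp_pos _).le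
    linarith

lemma walk_decay (hn : n ≠ 0) {s : ℝ} (h0 : 0 < s) (h1 : s ≤ 1 / 4) (T : V n → V n)
    (hT : ∀ c x, T (flipV c x) = flipV c (T x)) (k : ℕ) :
    Ew n k (fun q => exp (-(s * hammingDist (T (q 0)) (q k)))) ≤ exp (-(s * k / 4)) + 4 / s * exp (s - s * n / 4) := by
  have hn' : (0 : ℝ) < n := by exact_mod_cast Nat.pos_of_ne_zero hn
  have main : Ew n k (fun q => exp (-(s * hammingDist (T (q 0)) (q k)))) ≤ (1 - s / 4) ^ k + 4 / s * exp (s - s * n / 4) := by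
    induction k with
    | zero =>
      have : Ew n 0 (fun q => exp (-(s * hammingDist (T (q 0)) (q 0)))) ≤ Ew n 0 (fun _ => 1) := by
        apply Ew_mono; intro q _
        rw [exp_le_one_iff]; have : 0 ≤ s * (hammingDist (T (q 0)) (q 0) : ℝ) := by positivity
        linarith
      rw [Ew_const hn] at this
      have h2 : 0 ≤ 4 / s * exp (s - s * n / 4) := by positivity
      simp only [pow_zero]; linarith
    | succ k ih =>
      rw [Ew_succ, ← Ew_sum]
      have : (Ew n k fun q => ∑ c, exp (-(s * hammingDist (T (consP (flipV c (q 0)) q 0)) (consP (flipV c (q 0)) q (k + 1))))) / n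
          ≤ Ew n k (fun q => (1 - s / 4) * exp (-(s * hammingDist (T (q 0)) (q k))) + exp (s - s * n / 4)) := by
        rw [div_eq_mul_inv, ← Ew_mul_right]
        apply Ew_mono; intro q _
        simp only [consP, hT]
        rw [← div_eq_mul_inv]
        exact flip_step hn h0.le h1 _ _
      refine this.trans ?_
      rw [Ew_add, Ew_mul_left, Ew_const hn]
      have h3 : (1 - s / 4) * (Ew n k fun q => exp (-(s * hammingDist (T (q 0)) (q k)))) ≤
          (1 - s / 4) * ((1 - s / 4) ^ k + 4 / s * exp (s - s * n / 4)) := by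
        apply mul_le_mul_of_nonneg_left ih; linarith
      have h4 : (1 - s / 4) * (4 / s * exp (s - s * n / 4)) = 4 / s * exp (s - s * n / 4) - exp (s - s * n / 4) := by
        field_simp
      rw [pow_succ]
      linarith
  refine main.trans ?_
  gcongr
  calc (1 - s / 4) ^ k ≤ exp (-(s / 4)) ^ k := by
        apply pow_le_pow_left₀ (by linarith); exact one_sub_le_exp_neg _
    _ = exp (-(s * k / 4)) := by rw [← exp_nat_mul]; congr 1; ring

noncomputable def PP (n k : ℕ) (L : ℝ) (h : V n → ℝ) : ℝ :=
  Ew n k (fun q => if L < h (q 0) ∧ L < h (q k) then 1 else 0)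

lemma PP_nonneg (k : ℕ) (L : ℝ) (h : V n → ℝ) : 0 ≤ PP n k L h :=
  Ew_nonneg _ fun q _ => by split_ifs <;> simp

section
variable {Ω : Type*} [MeasurableSpace Ω] {P : Measure Ω} [IsProbabilityMeasure P]
  {p : ℕ} {H : V n → Ω → ℝ}

lemma ov_pow_le (hn : n ≠ 0) (hp : 1 ≤ p) (x y : V n) {g : ℝ} (hg : 0 ≤ g) :
    exp (-(g * n * (1 - overlap n x y ^ p) / 2)) ≤ exp (-(g * hammingDist x y)) + exp (-(g * hammingDist (negV x) y)) := by
  have hn' : (0 : ℝ) < n := by exact_mod_cast Nat.pos_of_ne_zero hn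
  have hab := abs_overlap_le x y
  have h1 : overlap n x y ^ p ≤ |overlap n x y| := by
    calc overlap n x y ^ p ≤ |overlap n x y ^ p| := le_abs_self _
      _ = |overlap n x y| ^ p := abs_pow _ _
      _ ≤ |overlap n x y| ^ 1 := pow_le_pow_of_le_one (abs_nonneg _) hab hp
      _ = _ := pow_one _
  have hneg : (hammingDist (negV x) y : ℝ) = n - hammingDist x y := by
    rw [eq_sub_iff_add_eq]; exact_mod_cast hd_negV x y
  have hov : n * overlap n x y = n - 2 * hammingDist x y := by unfold overlap; field_simp
  rcases le_total 0 (overlap n x y) with h | h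
  · rw [abs_of_nonneg h] at h1
    have : exp (-(g * n * (1 - overlap n x y ^ p) / 2)) ≤ exp (-(g * hammingDist x y)) := by
      apply exp_le_exp.2
      have h2 : n * overlap n x y ^ p ≤ n - 2 * hammingDist x y := by rw [← hov]; gcongr
      have := mul_le_mul_of_nonneg_left h2 hg
      nlinarith
    linarith [exp_pos (-(g * hammingDist (negV x) y))]
  · rw [abs_of_nonpos h] at h1
    have : exp (-(g * n * (1 - overlap n x y ^ p) / 2)) ≤ exp (-(g * hammingDist (negV x) y)) := by
      apply exp_le_exp.2
      have h2 : n * overlap n x y ^ p ≤ n * (- overlap n x y) := by gcongr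
      rw [mul_neg, hov] at h2
      have := mul_le_mul_of_nonneg_left h2 hg
      rw [hneg]
      nlinarith
    linarith [exp_pos (-(g * hammingDist x y))]

lemma PP_mean (hn : n ≠ 0) (hp : 1 ≤ p) (hG : GV P H (fun x y => (n : ℝ) * overlap n x y ^ p)) (k : ℕ) (L : ℝ)
    {γ : ℝ} (hγ : 0 < γ) (hγ1 : γ ^ 2 / 2 ≤ 1 / 4) :
    Integrable (fun ω => PP n k L (fun x => H x ω)) P ∧
    ∫ ω, PP n k L (fun x => H x ω) ∂P ≤ exp (γ ^ 2 * n / 2 - γ * L) *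
      (2 * (exp (-(γ ^ 2 * k / 8)) + 8 / γ ^ 2 * exp (1 / 4 - γ ^ 2 * n / 8))) := by
  have h : ∀ q : ℕ → V n, _ := fun q => ind_aux (P := P) (S := {ω | L < H (q 0) ω ∧ L < H (q k) ω})
    ((measurableSet_lt measurable_const (hG.meas _)).inter (measurableSet_lt measurable_const (hG.meas _)))
    (fun ω => if L < H (q 0) ω ∧ L < H (q k) ω then 1 else 0) (fun ω => by simp [Set.indicator])
  refine ⟨Ew_integrable k _ fun q => (h q).1, ?_⟩
  unfold PP
  rw [int_Ew k _ fun q => (h q).1]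
  set s := γ ^ 2 / 2 with hs
  have hs0 : 0 < s := by positivity
  have d1 := walk_decay hn hs0 hγ1 id (fun c x => rfl) k
  have d2 := walk_decay hn hs0 hγ1 negV negV_flip k
  have step : Ew n k (fun q => ∫ ω, (if L < H (q 0) ω ∧ L < H (q k) ω then (1 : ℝ) else 0) ∂P) ≤
      Ew n k (fun q => exp (γ ^ 2 * n / 2 - γ * L) * (exp (-(s * hammingDist (id (q 0)) (q k))) +
        exp (-(s * hammingDist (negV (q 0)) (q k))))) := by
    apply Ew_mono; intro q _
    rw [(h q).2]
    refine (pair_tail hG (q 0) (q k) (γ / 2) L (by positivity)).trans ?_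
    have := ov_pow_le hn hp (q 0) (q k) hs0.le
    calc exp ((γ / 2) ^ 2 * n * (1 + overlap n (q 0) (q k) ^ p) - 2 * (γ / 2) * L)
        = exp (γ ^ 2 * n / 2 - γ * L) * exp (-(s * n * (1 - overlap n (q 0) (q k) ^ p) / 2)) := by
          rw [← exp_add]; congr 1; rw [hs]; ring
      _ ≤ _ := by simp only [id]; gcongr
  refine step.trans ?_
  rw [Ew_mul_left, Ew_add]
  gcongr
  have f1 : exp (-(s * k / 4)) = exp (-(γ ^ 2 * k / 8)) := by congr 1; rw [hs]; ring
  have f2 : 4 / s * exp (s - s * n / 4) ≤ 8 / γ ^ 2 * exp (1 / 4 - γ ^ 2 * n / 8) := by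
    have : 4 / s = 8 / γ ^ 2 := by rw [hs]; field_simp; norm_num
    rw [this]
    refine mul_le_mul_of_nonneg_left (exp_le_exp.2 ?_) (by positivity)
    have : s * n / 4 = γ ^ 2 * n / 8 := by rw [hs]; ring
    linarith
  rw [f1] at d1 d2
  linarith
end
end pf1


section pf2
variable {n : ℕ}

open Classical in
noncomputable def HH (n θ : ℕ) (L : ℝ) (h : V n → ℝ) : ℝ :=
  Ew n θ (fun q => if ∃ j ∈ Icc 1 θ, L < h (q j) then 1 else 0)

noncomputable def blk (m : ℕ) (L : ℝ) (h : V n → ℝ) (q : ℕ → V n) : ℝ :=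
  if L < mx m (fun i => h (q i)) then 1 else 0

lemma blk_dep (m : ℕ) (L : ℝ) (h : V n → ℝ) : DepLe m (blk m L h) := by
  intro p q hpq
  unfold blk
  rw [mx_congr (fun i hi => by rw [hpq i hi])]

lemma blk_stat (hn : n ≠ 0) (m a N : ℕ) (haN : a + m ≤ N) (L : ℝ) (h : V n → ℝ) :
    Ew n N (fun q => blk m L h (shiftP a q)) = AA n m L h :=
  Ew_stat hn _ m a N haN (blk_dep m L h)

open Classical in
lemma HH_init (hn : n ≠ 0) (θ k : ℕ) (L : ℝ) (h : V n → ℝ) :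
    HH n θ L h = Ew n (θ + k) (fun q => if ∃ j ∈ Icc 1 θ, L < h (q j) then 1 else 0) := by
  unfold HH
  rw [Ew_init hn]
  intro p q hpq
  have : (∃ j ∈ Icc 1 θ, L < h (p j)) ↔ (∃ j ∈ Icc 1 θ, L < h (q j)) := by
    constructor <;> rintro ⟨j, hj, hl⟩ <;> refine ⟨j, hj, ?_⟩
    · rwa [← hpq j (mem_Icc.1 hj).2]
    · rwa [hpq j (mem_Icc.1 hj).2]
  beta_reduce
  by_cases hx : ∃ j ∈ Icc 1 θ, L < h (p j)
  · rw [if_pos hx, if_pos (this.1 hx)]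
  · rw [if_neg hx, if_neg (fun hh => hx (this.2 hh))]

lemma blk_nonneg (m : ℕ) (L : ℝ) (h : V n → ℝ) (q : ℕ → V n) : 0 ≤ blk m L h q := by
  unfold blk; split_ifs <;> simp

lemma HH_upper (hn : n ≠ 0) (θ m : ℕ) (L : ℝ) (h : V n → ℝ) :
    HH n θ L h ≤ ((θ / (m + 1) + 1 : ℕ) : ℝ) * AA n m L h := by
  rw [HH_init hn θ (m + 1)]
  have e : ((θ / (m + 1) + 1 : ℕ) : ℝ) * AA n m L h =
      Ew n (θ + (m + 1)) (fun q => ∑ i ∈ range (θ / (m + 1) + 1), blk m L h (shiftP (1 + i * (m + 1)) q)) := by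
    rw [Ew_sum]
    rw [sum_congr rfl fun i hi => blk_stat hn m (1 + i * (m + 1)) (θ + (m + 1)) ?_ L h]
    · simp
    · have h1 : i ≤ θ / (m + 1) := by rw [mem_range] at hi; omega
      have h2 := Nat.mul_le_mul_right (m + 1) h1
      have h3 := Nat.div_mul_le_self θ (m + 1)
      omega
  rw [e]
  apply Ew_mono
  intro q _
  split_ifs with hex
  · obtain ⟨j, hj, hl⟩ := hex
    rw [mem_Icc] at hj
    have hdm := Nat.div_add_mod' (j - 1) (m + 1)
    have hlt := Nat.mod_lt (j - 1) (show 0 < m + 1 by omega)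
    have hi : (j - 1) / (m + 1) ∈ range (θ / (m + 1) + 1) := by
      rw [mem_range]
      have : (j - 1) / (m + 1) ≤ θ / (m + 1) := Nat.div_le_div_right (by omega)
      omega
    refine le_trans ?_ (single_le_sum (f := fun i => blk m L h (shiftP (1 + i * (m + 1)) q)) (fun i _ => blk_nonneg m L h _) hi)
    unfold blk
    rw [if_pos]
    rw [lt_mx_iff]
    refine ⟨(j - 1) % (m + 1), by omega, ?_⟩
    unfold shiftP
    have : (j - 1) % (m + 1) + (1 + (j - 1) / (m + 1) * (m + 1)) = j := by omega
    rwa [this]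
  · exact sum_nonneg fun i _ => blk_nonneg m L h _

noncomputable def prI (k : ℕ) (L : ℝ) (h : V n → ℝ) (q : ℕ → V n) : ℝ :=
  if L < h (q 0) ∧ L < h (q k) then 1 else 0

lemma prI_nonneg (k : ℕ) (L : ℝ) (h : V n → ℝ) (q : ℕ → V n) : 0 ≤ prI k L h q := by
  unfold prI; split_ifs <;> simp

lemma prI_dep (k : ℕ) (L : ℝ) (h : V n → ℝ) : DepLe k (prI k L h) := by
  intro p q hpq
  unfold prI
  rw [hpq 0 (by omega), hpq k le_rfl]

lemma bonf (θ m g Nb : ℕ) (hNb : Nb * (m + 1 + g) ≤ θ) (L : ℝ) (h : V n → ℝ) (q : ℕ → V n)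
    [Decidable (∃ j ∈ Icc 1 θ, L < h (q j))] :
    ∑ i ∈ range Nb, blk m L h (shiftP (1 + i * (m + 1 + g)) q) -
      ∑ a ∈ Icc 1 θ, ∑ k ∈ Icc g θ, prI k L h (shiftP a q) ≤ if ∃ j ∈ Icc 1 θ, L < h (q j) then 1 else 0 := by
  classical
  have hp0 : ∀ a, 0 ≤ ∑ k ∈ Icc g θ, prI k L h (shiftP a q) := fun a => sum_nonneg fun k _ => prI_nonneg k L h _
  set S := (range Nb).filter (fun i => L < mx m (fun r => h (shiftP (1 + i * (m + 1 + g)) q r))) with hS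
  have hsum : ∑ i ∈ range Nb, blk m L h (shiftP (1 + i * (m + 1 + g)) q) = S.card := by
    unfold blk
    rw [hS, natCast_card_filter]
  rw [hsum]
  have hex : ∀ i, ∃ b, i ∈ S → 1 + i * (m + 1 + g) ≤ b ∧ b ≤ 1 + i * (m + 1 + g) + m ∧ L < h (q b) := by
    intro i
    by_cases hi : i ∈ S
    · rw [hS, mem_filter, lt_mx_iff] at hi
      obtain ⟨-, r, hr, hl⟩ := hi
      exact ⟨r + (1 + i * (m + 1 + g)), fun _ => ⟨by omega, by omega, hl⟩⟩
    · exact ⟨0, fun h => absurd h hi⟩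
  choose b hb using hex
  have hbθ : ∀ i ∈ S, b i ∈ Icc 1 θ := by
    intro i hi
    obtain ⟨h1, h2, -⟩ := hb i hi
    have h3 : i + 1 ≤ Nb := by rw [hS, mem_filter, mem_range] at hi; omega
    have h4 := Nat.mul_le_mul_right (m + 1 + g) h3
    rw [add_mul, one_mul] at h4
    rw [mem_Icc]; omega
  rcases S.eq_empty_or_nonempty with h0 | hne
  · rw [h0]
    have : 0 ≤ ∑ a ∈ Icc 1 θ, ∑ k ∈ Icc g θ, prI k L h (shiftP a q) := sum_nonneg fun a _ => hp0 a
    simp only [card_empty, Nat.cast_zero, zero_sub]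
    refine le_trans (neg_nonpos.2 this) ?_
    split_ifs <;> simp
  · set i0 := S.min' hne with hi0
    have hi0S : i0 ∈ S := min'_mem S hne
    rw [if_pos ⟨b i0, hbθ i0 hi0S, (hb i0 hi0S).2.2⟩]
    have hgap : ∀ i ∈ S, ∀ i' ∈ S, i < i' → b i + g < b i' := by
      intro i hi i' hi' hlt
      obtain ⟨-, h2, -⟩ := hb i hi
      obtain ⟨h1, -, -⟩ := hb i' hi'
      have h4 := Nat.mul_le_mul_right (m + 1 + g) (show i + 1 ≤ i' from hlt)
      rw [add_mul, one_mul] at h4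
      omega
    have hlt0 : ∀ i ∈ S.erase i0, i0 < i := by
      intro i hi
      rw [mem_erase] at hi
      exact lt_of_le_of_ne (min'_le S i hi.2) (Ne.symm hi.1)
    have hinj : Set.InjOn (fun i => b i - b i0) (S.erase i0) := by
      intro i hi i' hi' heq
      have g1 := hgap i0 hi0S i (mem_of_mem_erase hi) (hlt0 i hi)
      have g2 := hgap i0 hi0S i' (mem_of_mem_erase hi') (hlt0 i' hi')
      simp only at heq
      by_contra hne
      rcases lt_or_gt_of_ne hne with hl | hl
      · have := hgap i (mem_of_mem_erase hi) i' (mem_of_mem_erase hi') hl; omega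
      · have := hgap i' (mem_of_mem_erase hi') i (mem_of_mem_erase hi) hl; omega
    have hcard : (((S.erase i0).card : ℕ) : ℝ) ≤ ∑ k ∈ Icc g θ, prI k L h (shiftP (b i0) q) := by
      unfold prI
      rw [← natCast_card_filter]
      rw [Nat.cast_le]
      rw [← card_image_of_injOn hinj]
      apply card_le_card
      intro k hk
      rw [mem_image] at hk
      obtain ⟨i, hi, rfl⟩ := hk
      have g1 := hgap i0 hi0S i (mem_of_mem_erase hi) (hlt0 i hi)
      have g2 := hbθ i (mem_of_mem_erase hi)
      rw [mem_Icc] at g2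
      rw [mem_filter, mem_Icc]
      refine ⟨⟨by omega, by omega⟩, ?_, ?_⟩
      · simpa [shiftP] using (hb i0 hi0S).2.2
      · unfold shiftP
        rw [show b i - b i0 + b i0 = b i by omega]
        exact (hb i (mem_of_mem_erase hi)).2.2
    have h5 : ∑ k ∈ Icc g θ, prI k L h (shiftP (b i0) q) ≤ ∑ a ∈ Icc 1 θ, ∑ k ∈ Icc g θ, prI k L h (shiftP a q) :=
      single_le_sum (f := fun a => ∑ k ∈ Icc g θ, prI k L h (shiftP a q)) (fun a _ => hp0 a) (hbθ i0 hi0S)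
    have h6 : (S.card : ℝ) = (S.erase i0).card + 1 := by
      rw [← card_erase_add_one hi0S]; push_cast; ring
    linarith

noncomputable def BP (n g θ : ℕ) (L : ℝ) (h : V n → ℝ) : ℝ := θ * ∑ k ∈ Icc g θ, PP n k L h

lemma HH_lower (hn : n ≠ 0) (θ m g Nb : ℕ) (hNb : Nb * (m + 1 + g) ≤ θ) (L : ℝ) (h : V n → ℝ) :
    (Nb : ℝ) * AA n m L h - BP n g θ L h ≤ HH n θ L h := by
  rw [HH_init hn θ θ]
  have e1 : (Nb : ℝ) * AA n m L h =
      Ew n (θ + θ) (fun q => ∑ i ∈ range Nb, blk m L h (shiftP (1 + i * (m + 1 + g)) q)) := by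
    rw [Ew_sum]
    rw [sum_congr rfl fun i hi => blk_stat hn m (1 + i * (m + 1 + g)) (θ + θ) ?_ L h]
    · simp
    · have h3 : i + 1 ≤ Nb := by rw [mem_range] at hi; omega
      have h4 := Nat.mul_le_mul_right (m + 1 + g) h3
      rw [add_mul, one_mul] at h4
      omega
  have e2 : BP n g θ L h = Ew n (θ + θ) (fun q => ∑ a ∈ Icc 1 θ, ∑ k ∈ Icc g θ, prI k L h (shiftP a q)) := by
    rw [Ew_sum]
    have : ∀ a ∈ Icc 1 θ, Ew n (θ + θ) (fun q => ∑ k ∈ Icc g θ, prI k L h (shiftP a q)) = ∑ k ∈ Icc g θ, PP n k L h := by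
      intro a ha
      rw [Ew_sum]
      refine sum_congr rfl fun k hk => ?_
      rw [mem_Icc] at ha hk
      exact Ew_stat hn _ k a _ (by omega) (prI_dep k L h)
    rw [sum_congr rfl this]
    simp [BP]
  rw [e1, e2, ← Ew_sub]
  exact Ew_mono _ _ fun q _ => by
    classical
    convert bonf θ m g Nb hNb L h q
end pf2


section pg1
variable {n : ℕ}

noncomputable def wt (n m : ℕ) (xs : Fin (m + 1) → V n) : ℝ :=
  ((2 : ℝ) ^ n)⁻¹ * ∏ k : Fin m, (if hammingDist (xs k.castSucc) (xs k.succ) = 1 then (n : ℝ)⁻¹ else 0)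

lemma wt_nonneg (m : ℕ) (xs : Fin (m + 1) → V n) : 0 ≤ wt n m xs := by
  unfold wt
  refine mul_nonneg (by positivity) (prod_nonneg fun k _ => ?_)
  split_ifs <;> positivity

lemma flip_inj (x : V n) : Function.Injective (fun c => flipV c x) := by
  intro c d h
  by_contra hne
  have h1 := congrFun h c
  simp only at h1
  rw [flipV_same, flipV_ne d c x hne] at h1
  revert h1; cases x c <;> simp

lemma sum_nbr (x : V n) (G : V n → ℝ) :
    ∑ y, (if hammingDist y x = 1 then (n : ℝ)⁻¹ else 0) * G y = (∑ c, G (flipV c x)) / n := by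
  have h1 : (univ.filter fun y : V n => hammingDist y x = 1) = univ.image (fun c => flipV c x) := by
    ext y
    simp only [mem_filter, mem_univ, true_and, mem_image]
    constructor
    · intro h
      unfold hammingDist at h
      rw [card_eq_one] at h
      obtain ⟨c, hc⟩ := h
      refine ⟨c, ?_⟩
      ext i
      have hi : i ∈ (univ.filter fun i => y i ≠ x i) ↔ i = c := by rw [hc, mem_singleton]
      simp only [mem_filter, mem_univ, true_and] at hi
      by_cases hic : i = c
      · have := hi.2 hic
        subst hic
        rw [flipV_same]
        revert this; cases x i <;> cases y i <;> simp
      · rw [flipV_ne c i x hic]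
        by_contra hne
        exact hic (hi.1 (fun h => hne h.symm))
    · rintro ⟨c, rfl⟩
      exact hd_flip_self c x
  simp_rw [ite_mul, zero_mul]
  rw [← sum_filter, h1, sum_image (fun a _ b _ h => flip_inj x h), ← mul_sum, div_eq_inv_mul]

lemma law_sum (m : ℕ) (F : (Fin (m + 1) → V n) → ℝ) :
    ∑ xs, wt n m xs * F xs = Ew n m (fun q => F (fun k => q k)) := by
  induction m with
  | zero =>
    unfold wt Ew
    simp only [univ_eq_empty, prod_empty, mul_one, pow_zero, one_mul]
    rw [← (Equiv.funUnique (Fin 1) (V n)).symm.sum_comp]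
    rw [← mul_sum, div_eq_inv_mul]
    congr 1
    simp only [univ_unique, sum_singleton]
    refine sum_congr rfl fun x _ => ?_
    congr 1
  | succ m ih =>
    rw [Ew_succ]
    have key : ∀ (c : Fin n), Ew n m (fun q => F (fun k : Fin (m + 1 + 1) => consP (flipV c (q 0)) q k)) =
        ∑ xs, wt n m xs * F (Fin.cons (flipV c (xs 0)) xs) := by
      intro c
      rw [ih (fun xs => F (Fin.cons (flipV c (xs 0)) xs))]
      congr 1; funext q; congr 1; funext k
      refine Fin.cases ?_ (fun i => ?_) k
      · rfl
      · rfl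
    simp_rw [key]
    rw [sum_comm, sum_div, ← (Fin.consEquiv (fun _ => V n)).sum_comp, Fintype.sum_prod_type, sum_comm]
    refine sum_congr rfl fun xs _ => ?_
    rw [← mul_sum, mul_div_assoc, ← sum_nbr (xs 0) (fun y => F (Fin.cons y xs)), mul_sum]
    refine sum_congr rfl fun y _ => ?_
    unfold wt
    rw [Fin.prod_univ_succ]
    simp only [Fin.consEquiv, Equiv.coe_fn_mk, Fin.castSucc_zero, Fin.cons_zero, Fin.cons_succ, Fin.castSucc_succ]
    ring

section
variable {Ω' : Type*} [MeasurableSpace Ω'] {Pw : Measure Ω'} [IsProbabilityMeasure Pw]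
    {J : (n : ℕ) → ℕ → Ω' → V n} {e : ℕ → ℕ → Ω' → ℝ}

def cyl (J : (n : ℕ) → ℕ → Ω' → V n) (e : ℕ → ℕ → Ω' → ℝ) (n m : ℕ) (xs : Fin (m + 1) → V n) (ys : Fin (m + 1) → ℝ) : Set Ω' :=
  {ω' | (∀ k : Fin (m + 1), J n k ω' = xs k) ∧ (∀ k : Fin (m + 1), ys k < e n k ω')}

lemma cyl_meas (hJ : ∀ n i, Measurable (J n i)) (he : ∀ n i, Measurable (e n i)) (n m : ℕ) (xs : Fin (m + 1) → V n)
    (ys : Fin (m + 1) → ℝ) : MeasurableSet (cyl J e n m xs ys) := by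
  unfold cyl
  refine MeasurableSet.inter ?_ ?_
  · refine MeasurableSet.congr (s := ⋂ k : Fin (m + 1), {ω' | J n k ω' = xs k}) ?_ (by ext; simp; rfl)
    exact MeasurableSet.iInter fun k => hJ n k (measurableSet_singleton _)
  · refine MeasurableSet.congr (s := ⋂ k : Fin (m + 1), {ω' | ys k < e n k ω'}) ?_ (by ext; simp; rfl)
    exact MeasurableSet.iInter fun k => measurableSet_lt measurable_const (he n k)

lemma cyl_union (hlaw : WalkExpLaw Pw J e) (hJ : ∀ n i, Measurable (J n i)) (he : ∀ n i, Measurable (e n i)) (n m : ℕ)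
    (T : Finset (Fin (m + 1) → V n)) (ys : (Fin (m + 1) → V n) → Fin (m + 1) → ℝ) (hys : ∀ xs k, 0 ≤ ys xs k) :
    Pw.real (⋃ xs ∈ T, cyl J e n m xs (ys xs)) = ∑ xs ∈ T, wt n m xs * exp (-∑ k, ys xs k) := by
  rw [measureReal_biUnion_finset]
  · refine sum_congr rfl fun xs _ => ?_
    unfold Measure.real cyl
    rw [hlaw n m xs (ys xs) (hys xs)]
    have := wt_nonneg m xs
    unfold wt at this
    rw [ENNReal.toReal_mul, ENNReal.toReal_ofReal this, ENNReal.toReal_ofReal (exp_pos _).le]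
    rfl
  · intro xs _ xs' _ hne
    rw [Function.onFun, Set.disjoint_left]
    rintro ω' ⟨h1, -⟩ ⟨h2, -⟩
    exact hne (funext fun k => (h1 k).symm.trans (h2 k))
  · intro xs _; exact cyl_meas hJ he n m xs _

lemma e_pos (hlaw : WalkExpLaw Pw J e) (hJ : ∀ n i, Measurable (J n i)) (he : ∀ n i, Measurable (e n i)) {n : ℕ} (hn : n ≠ 0) (m : ℕ) :
    Pw.real (⋃ xs ∈ (univ : Finset (Fin (m + 1) → V n)), cyl J e n m xs (fun _ => 0))ᶜ = 0 := by
  rw [probReal_compl_eq_one_sub]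
  · rw [cyl_union hlaw hJ he n m univ (fun _ _ => 0) (fun _ _ => le_rfl)]
    have := law_sum (n := n) m (fun _ => 1)
    rw [Ew_const hn] at this
    simp only [sum_const_zero, neg_zero, exp_zero]
    linarith
  · exact Finset.measurableSet_biUnion _ fun xs _ => cyl_meas hJ he n m xs _

noncomputable def Bx (n θ : ℕ) (τ : V n → ℝ) : ℝ := (θ + 1) * ((∑ x, exp (-τ x)) / 2 ^ n)

open Classical in
lemma HH_sum (θ : ℕ) (L : ℝ) (h : V n → ℝ) :
    ∑ xs ∈ (univ.filter fun xs : Fin (θ + 1) → V n => ∃ j : Fin (θ + 1), 1 ≤ (j : ℕ) ∧ L < h (xs j)), wt n θ xs = HH n θ L h := by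
  rw [sum_filter]
  have : ∀ xs : Fin (θ + 1) → V n, (if ∃ j : Fin (θ + 1), 1 ≤ (j : ℕ) ∧ L < h (xs j) then wt n θ xs else 0) =
      wt n θ xs * (if ∃ j : Fin (θ + 1), 1 ≤ (j : ℕ) ∧ L < h (xs j) then 1 else 0) := by
    intro xs; split_ifs <;> simp
  simp_rw [this]
  rw [law_sum]
  unfold HH
  congr 1; funext q
  have : (∃ j : Fin (θ + 1), 1 ≤ (j : ℕ) ∧ L < h (q j)) ↔ ∃ j ∈ Icc 1 θ, L < h (q j) := by
    constructor
    · rintro ⟨j, h1, h2⟩; exact ⟨j, mem_Icc.2 ⟨h1, by omega⟩, h2⟩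
    · rintro ⟨j, h1, h2⟩; rw [mem_Icc] at h1; exact ⟨⟨j, by omega⟩, h1.1, h2⟩
  by_cases hx : ∃ j ∈ Icc 1 θ, L < h (q j)
  · rw [if_pos hx, if_pos (this.2 hx)]
  · rw [if_neg hx, if_neg (fun hh => hx (this.1 hh))]

lemma dyn_upper (hlaw : WalkExpLaw Pw J e) (hJ : ∀ n i, Measurable (J n i)) (he : ∀ n i, Measurable (e n i)) {n : ℕ} (hn : n ≠ 0)
    {θ : ℕ} (hθ : 0 < θ) {b C L : ℝ} (hb : 0 < b) (hC : 0 < C) (hL : exp (b * L) * (θ * n) ≤ C) (h : V n → ℝ) :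
    Pw.real {ω' | C < ∑ j ∈ Icc 1 θ, exp (b * h (J n j ω')) * e n j ω'} ≤
      HH n θ L h + Bx n θ (fun x => max n (C * exp (-(b * h x)) / θ)) := by
  classical
  set τ : V n → ℝ := fun x => max n (C * exp (-(b * h x)) / θ) with hτ
  have hτ0 : ∀ x, 0 ≤ τ x := fun x => le_max_of_le_left (Nat.cast_nonneg n)
  have hn' : (0 : ℝ) < n := by exact_mod_cast Nat.pos_of_ne_zero hn
  have hθ' : (0 : ℝ) < θ := by exact_mod_cast hθ
  set T := univ.filter fun xs : Fin (θ + 1) → V n => ∃ j : Fin (θ + 1), 1 ≤ (j : ℕ) ∧ L < h (xs j) with hT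
  set U1 := ⋃ xs ∈ T, cyl J e n θ xs (fun _ => 0)
  set U2 : Fin (θ + 1) → Set Ω' := fun j => ⋃ xs ∈ (univ : Finset (Fin (θ + 1) → V n)), cyl J e n θ xs (Pi.single j (τ (xs j)))
  set U3 := (⋃ xs ∈ (univ : Finset (Fin (θ + 1) → V n)), cyl J e n θ xs (fun _ => 0))ᶜ
  have hsub : {ω' | C < ∑ j ∈ Icc 1 θ, exp (b * h (J n j ω')) * e n j ω'} ⊆ (U1 ∪ ⋃ j ∈ (univ : Finset (Fin (θ + 1))), U2 j) ∪ U3 := by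
    intro ω' hω
    by_cases h3 : ω' ∈ U3
    · exact Or.inr h3
    left
    simp only [U3, Set.mem_compl_iff, not_not, Set.mem_iUnion] at h3
    obtain ⟨xs, -, hxs, hpos⟩ := h3
    by_cases hxT : xs ∈ T
    · left; simp only [U1, Set.mem_iUnion]; exact ⟨xs, hxT, hxs, hpos⟩
    right
    have hle : ∀ j : Fin (θ + 1), 1 ≤ (j : ℕ) → h (xs j) ≤ L := by
      intro j hj
      by_contra hlt
      exact hxT (by rw [hT, mem_filter]; exact ⟨mem_univ _, j, hj, not_le.1 hlt⟩)
    have hex : ∃ j ∈ Icc 1 θ, C / θ < exp (b * h (J n j ω')) * e n j ω' := by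
      by_contra hno
      push Not at hno
      have := sum_le_sum hno
      simp only [sum_const, Nat.card_Icc, nsmul_eq_mul] at this
      rw [show ((θ + 1 - 1 : ℕ) : ℝ) = θ by simp, mul_div_cancel₀ _ hθ'.ne'] at this
      exact absurd hω (not_lt.2 this)
    obtain ⟨j, hj, hlt⟩ := hex
    rw [mem_Icc] at hj
    let jf : Fin (θ + 1) := ⟨j, by omega⟩
    have hJj : J n j ω' = xs jf := hxs jf
    have hej : 0 < e n j ω' := hpos jf
    rw [hJj] at hlt
    simp only [Set.mem_iUnion, U2]
    refine ⟨jf, mem_univ _, xs, mem_univ _, hxs, ?_⟩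
    intro k
    by_cases hk : k = jf
    · subst hk
      rw [Pi.single_eq_same]
      show τ (xs jf) < e n j ω'
      rw [hτ]
      refine max_lt ?_ ?_
      · have h1 : exp (b * h (xs jf)) ≤ exp (b * L) := exp_le_exp.2 (by have := hle jf hj.1; gcongr)
        have h2 : exp (b * L) * n ≤ C / θ := by rw [le_div_iff₀ hθ']; linarith
        have h3 : exp (b * h (xs jf)) * e n j ω' ≤ exp (b * L) * e n j ω' := by gcongr
        have h4 : exp (b * L) * n < exp (b * L) * e n j ω' := by linarith
        exact lt_of_mul_lt_mul_left h4 (exp_pos _).le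
      · rw [exp_neg]
        have h5 : C * (exp (b * h (xs jf)))⁻¹ / θ = (C / θ) / exp (b * h (xs jf)) := by field_simp
        rw [h5, div_lt_iff₀ (exp_pos _)]; linarith
    · rw [Pi.single_eq_of_ne hk]; exact hpos k
  have m1 : Pw.real U1 = HH n θ L h := by
    rw [cyl_union hlaw hJ he n θ T (fun _ _ => 0) (fun _ _ => le_rfl), ← HH_sum]
    simp only [sum_const_zero, neg_zero, exp_zero, mul_one]
    exact sum_congr (by rw [hT]) fun _ _ => rfl
  have m2 : ∀ j, Pw.real (U2 j) = (∑ x, exp (-τ x)) / 2 ^ n := by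
    intro j
    rw [cyl_union hlaw hJ he n θ univ (fun xs => Pi.single j (τ (xs j))) ?_]
    · have : ∀ xs : Fin (θ + 1) → V n, wt n θ xs * exp (-∑ k, (Pi.single j (τ (xs j)) : Fin (θ + 1) → ℝ) k) = wt n θ xs * (fun xs => exp (-τ (xs j))) xs := by
        intro xs; rw [sum_pi_single', if_pos (mem_univ j)]
      rw [sum_congr rfl fun xs _ => this xs, law_sum, ← Ew_zero_coord (N := 0) hn (fun x => exp (-τ x))]
      rw [← Ew_stat hn (fun q => exp (-τ (q 0))) 0 j θ (by omega) (fun p q hpq => by simp only [hpq 0 le_rfl])]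
      congr 1; funext q; simp [shiftP]
    · intro xs k
      by_cases hk : k = j
      · subst hk; rw [Pi.single_eq_same]; exact hτ0 _
      · rw [Pi.single_eq_of_ne hk]
  have m3 : Pw.real U3 = 0 := e_pos hlaw hJ he hn θ
  calc _ ≤ Pw.real ((U1 ∪ ⋃ j ∈ (univ : Finset (Fin (θ + 1))), U2 j) ∪ U3) := measureReal_mono hsub (measure_ne_top _ _)
    _ ≤ Pw.real (U1 ∪ ⋃ j ∈ (univ : Finset (Fin (θ + 1))), U2 j) + Pw.real U3 := measureReal_union_le _ _
    _ ≤ Pw.real U1 + Pw.real (⋃ j ∈ (univ : Finset (Fin (θ + 1))), U2 j) + Pw.real U3 := by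
        gcongr; exact measureReal_union_le _ _
    _ ≤ Pw.real U1 + ∑ j, Pw.real (U2 j) + Pw.real U3 := by
        gcongr; exact measureReal_biUnion_finset_le _ _
    _ = _ := by rw [m1, m3, sum_congr rfl fun j _ => m2 j]; simp [Bx]

lemma dyn_lower (hlaw : WalkExpLaw Pw J e) (hJ : ∀ n i, Measurable (J n i)) (he : ∀ n i, Measurable (e n i)) {n : ℕ} (hn : n ≠ 0)
    {θ : ℕ} {b C L : ℝ} (hb : 0 < b) (hL : C ≤ exp (b * L) / n) (h : V n → ℝ) :
    exp (-(1 / n : ℝ)) * HH n θ L h ≤ Pw.real {ω' | C < ∑ j ∈ Icc 1 θ, exp (b * h (J n j ω')) * e n j ω'} := by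
  classical
  have hn' : (0 : ℝ) < n := by exact_mod_cast Nat.pos_of_ne_zero hn
  set T := univ.filter fun xs : Fin (θ + 1) → V n => ∃ j : Fin (θ + 1), 1 ≤ (j : ℕ) ∧ L < h (xs j) with hT
  have hex : ∀ xs : Fin (θ + 1) → V n, ∃ j : Fin (θ + 1), xs ∈ T → 1 ≤ (j : ℕ) ∧ L < h (xs j) := by
    intro xs
    by_cases hx : xs ∈ T
    · obtain ⟨j, hj⟩ := (mem_filter.1 hx).2
      exact ⟨j, fun _ => hj⟩
    · exact ⟨0, fun h => absurd h hx⟩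
  choose js hjs using hex
  have m1 := cyl_union hlaw hJ he n θ T (fun xs => Pi.single (js xs) (1 / n : ℝ)) (by
    intro xs k
    by_cases hk : k = js xs
    · rw [hk, Pi.single_eq_same]; positivity
    · rw [Pi.single_eq_of_ne hk])
  have m2 : ∑ xs ∈ T, wt n θ xs * exp (-∑ k, (Pi.single (js xs) (1 / n : ℝ) : Fin (θ + 1) → ℝ) k) = exp (-(1 / n : ℝ)) * HH n θ L h := by
    rw [← HH_sum, mul_sum]
    refine sum_congr (by rw [hT]) fun xs _ => ?_
    rw [sum_pi_single']; simp only [mem_univ, if_true, mul_comm]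
  rw [← m2, ← m1]
  refine measureReal_mono ?_ (measure_ne_top _ _)
  intro ω' hω
  simp only [Set.mem_iUnion] at hω
  obtain ⟨xs, hxT, hxs, hys⟩ := hω
  obtain ⟨hj1, hjL⟩ := hjs xs hxT
  have hpos : ∀ k : Fin (θ + 1), 0 < e n k ω' := by
    intro k
    refine lt_of_le_of_lt ?_ (hys k)
    by_cases hk : k = js xs
    · rw [hk, Pi.single_eq_same]; positivity
    · rw [Pi.single_eq_of_ne hk]
  have hej := hys (js xs)
  rw [Pi.single_eq_same] at hej
  have hmem : ((js xs : Fin (θ + 1)) : ℕ) ∈ Icc 1 θ := mem_Icc.2 ⟨hj1, by omega⟩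
  have h1 : exp (b * h (J n (js xs) ω')) * e n (js xs) ω' ≤ ∑ j ∈ Icc 1 θ, exp (b * h (J n j ω')) * e n j ω' :=
    single_le_sum (f := fun j => exp (b * h (J n j ω')) * e n j ω') (fun j hj => by
      rw [mem_Icc] at hj
      have := hpos ⟨j, by omega⟩
      exact mul_nonneg (exp_pos _).le this.le) hmem
  refine lt_of_lt_of_le ?_ h1
  rw [hxs]
  have h2 : exp (b * L) ≤ exp (b * h (xs (js xs))) := exp_le_exp.2 (by gcongr)
  calc C ≤ exp (b * L) * (1 / n) := by rw [mul_one_div]; exact hL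
    _ ≤ exp (b * h (xs (js xs))) * (1 / n) := by gcongr
    _ < exp (b * h (xs (js xs))) * e n (js xs) ω' := mul_lt_mul_of_pos_left hej (exp_pos _)
end
end pg1


section pg2
variable {c : ℝ}

noncomputable def gg (c : ℝ) (n : ℕ) : ℕ := ⌈(n : ℝ) ^ (2 * c + bb c / 2)⌉₊

lemma gg_ge (n : ℕ) : (n : ℝ) ^ (2 * c + bb c / 2) ≤ gg c n := Nat.le_ceil _

lemma gm_gg {n : ℕ} (hn : 0 < (n : ℝ)) : (n : ℝ) ^ (bb c / 2) ≤ γseq c n ^ 2 * gg c n := by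
  have : (n : ℝ) ^ (bb c / 2) = γseq c n ^ 2 * (n : ℝ) ^ (2 * c + bb c / 2) := by
    unfold γseq
    rw [← rpow_natCast, ← rpow_mul hn.le, ← rpow_add hn]; congr 1; push_cast; ring
  rw [this]; gcongr; exact gg_ge n

lemma gg_mm (hc0 : 0 < c) (hc1 : c < 1 / 2) : Tendsto (fun n : ℕ => (1 + gg c n : ℝ) / mm c n) atTop (nhds 0) := by
  have hb := bb_pos hc1
  have h := (nrp_zero (show -(bb c / 2) < 0 by linarith)).const_mul 3
  rw [mul_zero] at h
  refine squeeze_zero' (Eventually.of_forall fun n => by positivity) ?_ h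
  filter_upwards [eventually_gt_atTop 0] with n hn
  have hn' : (0 : ℝ) < n := by exact_mod_cast hn
  have h1 : (gg c n : ℝ) < (n : ℝ) ^ (2 * c + bb c / 2) + 1 := Nat.ceil_lt_add_one (by positivity)
  have h2 : 1 ≤ (n : ℝ) ^ (2 * c + bb c / 2) := one_le_rpow (by exact_mod_cast hn) (by linarith)
  rw [div_le_iff₀ (mm_pos hn)]
  calc (1 + gg c n : ℝ) ≤ 3 * (n : ℝ) ^ (2 * c + bb c / 2) := by linarith
    _ = 3 * (n : ℝ) ^ (-(bb c / 2)) * (n : ℝ) ^ (2 * c + bb c) := by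
        rw [mul_assoc, ← rpow_add hn']; congr 2; ring
    _ ≤ _ := by gcongr; exact mm_ge n

lemma th_cast (n : ℕ) : ((θseq n : ℕ) : ℝ) = 3 * (n : ℝ) ^ 2 := by unfold θseq; push_cast; ring

lemma k_th_le {t : ℝ} (ht : 0 < t) (n : ℕ) : (kseq c n t : ℝ) * θseq n ≤ aseq c n * t := by
  have h : kseq c n t * θseq n ≤ ⌊aseq c n * t⌋₊ := Nat.div_mul_le_self _ _
  calc (kseq c n t : ℝ) * θseq n ≤ (⌊aseq c n * t⌋₊ : ℝ) := by exact_mod_cast h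
    _ ≤ _ := Nat.floor_le (mul_nonneg (aseq_nonneg n) ht.le)

lemma k_le {t : ℝ} (ht : 0 < t) {n : ℕ} (hn : 0 < n) : (kseq c n t : ℝ) ≤ aseq c n * t := by
  refine le_trans ?_ (k_th_le ht n)
  have : (1 : ℝ) ≤ θseq n := by
    have : 1 ≤ θseq n := by unfold θseq; nlinarith
    exact_mod_cast this
  nlinarith [Nat.cast_nonneg (α := ℝ) (kseq c n t)]

lemma k_th_ge {t : ℝ} {n : ℕ} (hn : 0 < n) : aseq c n * t - (1 + θseq n) ≤ (kseq c n t : ℝ) * θseq n := by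
  have hθ : 0 < θseq n := by unfold θseq; positivity
  have h : ⌊aseq c n * t⌋₊ < θseq n * (⌊aseq c n * t⌋₊ / θseq n + 1) := Nat.lt_mul_div_succ _ hθ
  have h1 : aseq c n * t < (⌊aseq c n * t⌋₊ : ℝ) + 1 := Nat.lt_floor_add_one _
  have h2 : (⌊aseq c n * t⌋₊ : ℝ) < θseq n * ((kseq c n t : ℝ) + 1) := by
    unfold kseq; exact_mod_cast h
  linarith

lemma cnt_upper (hc0 : 0 < c) (hc1 : c < 1 / 2) {t : ℝ} (ht : 0 < t) :
    ∃ ρ : ℕ → ℝ, Tendsto ρ atTop (nhds 1) ∧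
      ∀ᶠ n in atTop, (kseq c n t : ℝ) * ((θseq n / (mm c n + 1) + 1 : ℕ) : ℝ) ≤ ρ n * Sn c n t := by
  refine ⟨fun n => 1 + (mm c n : ℝ) / n, by simpa using (mm_div hc0 hc1).const_add 1, ?_⟩
  filter_upwards [eventually_gt_atTop 0] with n hn
  have hn' : (0 : ℝ) < n := by exact_mod_cast hn
  have hn1 : (1 : ℝ) ≤ n := by exact_mod_cast hn
  have hm := mm_pos (c := c) hn
  have hk := k_th_le (c := c) ht n
  have h1 : ((θseq n / (mm c n + 1) : ℕ) : ℝ) ≤ θseq n / mm c n := by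
    refine le_trans Nat.cast_div_le ?_
    push_cast
    gcongr; linarith
  have hk2 : (kseq c n t : ℝ) * n ≤ aseq c n * t := by
    refine le_trans ?_ hk
    gcongr
    unfold θseq; nlinarith
  unfold Sn
  push_cast
  calc (kseq c n t : ℝ) * (((θseq n / (mm c n + 1) : ℕ) : ℝ) + 1) ≤ (kseq c n t : ℝ) * (θseq n / mm c n + 1) := by gcongr
    _ = ((kseq c n t : ℝ) * θseq n + (kseq c n t : ℝ) * n * (mm c n / n)) / mm c n := by field_simp
    _ ≤ (aseq c n * t + aseq c n * t * (mm c n / n)) / mm c n := by gcongr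
    _ = _ := by ring

lemma aseq_ge (hc0 : 0 < c) {n : ℕ} (hn : 1 ≤ (n : ℝ)) : exp (γseq c n ^ 2 * n / 2) ≤ aseq c n := by
  have h1 : 1 ≤ √(2 * π * n) := by
    rw [one_le_sqrt]
    nlinarith [pi_gt_three]
  have h2 : 1 ≤ (γseq c n)⁻¹ := by
    unfold γseq
    rw [← rpow_neg (by linarith), neg_neg]
    exact one_le_rpow hn hc0.le
  unfold aseq
  have : 1 ≤ √(2 * π * n) * (γseq c n)⁻¹ := by nlinarith
  nlinarith [exp_pos (γseq c n ^ 2 * n / 2)]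

lemma th_a (hc0 : 0 < c) (hc1 : c < 1 / 2) {t : ℝ} (ht : 0 < t) :
    Tendsto (fun n : ℕ => (1 + θseq n : ℝ) / (aseq c n * t)) atTop (nhds 0) := by
  have h := (poly_exp 2 (show 0 < 1 - 2 * c by linarith) (show (0 : ℝ) < 1 / 2 by norm_num)).const_mul (4 / t)
  rw [mul_zero] at h
  refine squeeze_zero' (Eventually.of_forall fun n => ?_) ?_ h
  · have := aseq_nonneg (c := c) n
    positivity
  filter_upwards [eventually_gt_atTop 0] with n hn
  have hn' : (0 : ℝ) < n := by exact_mod_cast hn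
  have hn1 : (1 : ℝ) ≤ n := by exact_mod_cast hn
  have ha := aseq_ge (c := c) hc0 hn1
  rw [th_cast, rpow_two, ← gm_sq hn', exp_neg]
  calc (1 + 3 * (n : ℝ) ^ 2) / (aseq c n * t) ≤ (4 * (n : ℝ) ^ 2) / (exp (γseq c n ^ 2 * n / 2) * t) := by
        gcongr; nlinarith
    _ = _ := by
        rw [show 1 / 2 * (γseq c n ^ 2 * n) = γseq c n ^ 2 * n / 2 by ring]
        field_simp

lemma cnt_lower (hc0 : 0 < c) (hc1 : c < 1 / 2) {t : ℝ} (ht : 0 < t) :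
    ∃ ρ : ℕ → ℝ, Tendsto ρ atTop (nhds 1) ∧
      ∀ᶠ n in atTop, ρ n * Sn c n t ≤ (kseq c n t : ℝ) * ((θseq n / (mm c n + 1 + gg c n) : ℕ) : ℝ) := by
  refine ⟨fun n => (1 - (1 + θseq n : ℝ) / (aseq c n * t)) * (1 + (1 + gg c n : ℝ) / mm c n)⁻¹ - (mm c n : ℝ) / n, ?_, ?_⟩
  · have h := ((((th_a hc0 hc1 ht).const_sub 1).mul (((gg_mm hc0 hc1).const_add 1).inv₀ (by norm_num))).sub (mm_div hc0 hc1))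
    simpa using h
  filter_upwards [eventually_gt_atTop 0] with n hn
  have hn' : (0 : ℝ) < n := by exact_mod_cast hn
  have hn1 : (1 : ℝ) ≤ n := by exact_mod_cast hn
  have hm := mm_pos (c := c) hn
  have hk := k_th_le (c := c) ht n
  have hk3 := k_th_ge (c := c) (t := t) hn
  have ha : 0 < aseq c n := lt_of_lt_of_le (exp_pos _) (aseq_ge hc0 hn1)
  have hg : (0 : ℝ) < mm c n + 1 + gg c n := by positivity
  have h1 : (θseq n : ℝ) / (mm c n + 1 + gg c n) - 1 ≤ ((θseq n / (mm c n + 1 + gg c n) : ℕ) : ℝ) := by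
    have h := Nat.lt_mul_div_succ (θseq n) (show 0 < mm c n + 1 + gg c n by omega)
    have h' : (θseq n : ℝ) < (mm c n + 1 + gg c n) * (((θseq n / (mm c n + 1 + gg c n) : ℕ) : ℝ) + 1) := by
      exact_mod_cast h
    rw [sub_le_iff_le_add, div_le_iff₀ hg]
    linarith
  have hk2 : (kseq c n t : ℝ) * n ≤ aseq c n * t := by
    refine le_trans ?_ hk
    gcongr
    unfold θseq; nlinarith
  have hk4 : (kseq c n t : ℝ) ≤ aseq c n * t / n := by rwa [le_div_iff₀ hn']
  calc _ = (aseq c n * t - (1 + θseq n)) / (mm c n + 1 + gg c n) - aseq c n * t / n := by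
        unfold Sn; field_simp
        try ring
    _ ≤ (kseq c n t : ℝ) * θseq n / (mm c n + 1 + gg c n) - kseq c n t := by gcongr
    _ = (kseq c n t : ℝ) * ((θseq n : ℝ) / (mm c n + 1 + gg c n) - 1) := by ring
    _ ≤ _ := by gcongr

lemma thr_upper (hc0 : 0 < c) {β : ℕ → ℝ} {β₀ : ℝ} (hβ₀ : 0 < β₀) (hβ : ∀ n : ℕ, β₀ ≤ β n) {u v : ℝ} (hv : 0 < v) (hvu : v < u) :
    ∀ᶠ n : ℕ in atTop, exp (β n * Lv c n v) * (θseq n * n) ≤ cseq c β n * u ^ (β n / γseq c n) := by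
  have hl : Tendsto (fun n : ℕ => (1 / β₀) * (3 * (log n / (n : ℝ) ^ c) + log 3 * γseq c n)) atTop (nhds 0) := by
    have := (((_root_.log_rpow hc0).const_mul 3).add ((gm_zero hc0).const_mul (log 3))).const_mul (1 / β₀)
    simpa using this
  have hd : 0 < log u - log v := sub_pos.2 (log_lt_log hv hvu)
  filter_upwards [eventually_gt_atTop 0, hl.eventually (gt_mem_nhds hd)] with n hn hlt
  have hn' : (0 : ℝ) < n := by exact_mod_cast hn
  have hγ := gm_pos (c := c) hn'
  have hb : 0 < β n := lt_of_lt_of_le hβ₀ (hβ n)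
  have e1 : (θseq n : ℝ) * n = exp (log 3 + 3 * log n) := by
    rw [exp_add, exp_log (by norm_num), show (3 : ℝ) * log n = ((3 : ℕ) : ℝ) * log n by norm_num, exp_nat_mul, exp_log hn', th_cast]; ring
  have e2 : log n / (n : ℝ) ^ c = log n * γseq c n := by unfold γseq; rw [rpow_neg hn'.le]; rfl
  rw [e2] at hlt
  have hlog : 0 ≤ log (n : ℝ) := log_natCast_nonneg n
  have h3 : 0 ≤ log (3 : ℝ) := log_nonneg (by norm_num)
  have key : (log 3 + 3 * log n) * γseq c n ≤ β n * (log u - log v) := by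
    have h4 : (log 3 + 3 * log n) * γseq c n < β₀ * (log u - log v) := by
      have := mul_lt_mul_of_pos_left hlt hβ₀
      rw [← mul_assoc, mul_one_div_cancel hβ₀.ne'] at this
      linarith
    nlinarith [hβ n]
  rw [e1, ← exp_add, cseq, rpow_def_of_pos (hv.trans hvu), ← exp_add, exp_le_exp, Lv]
  have : (log 3 + 3 * log n) ≤ β n * (log u - log v) / γseq c n := by rwa [le_div_iff₀ hγ]
  calc _ ≤ β n * (γseq c n * n + log v / γseq c n) + β n * (log u - log v) / γseq c n := by gcongr
    _ = _ := by ring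

lemma thr_lower (hc0 : 0 < c) {β : ℕ → ℝ} {β₀ : ℝ} (hβ₀ : 0 < β₀) (hβ : ∀ n : ℕ, β₀ ≤ β n) {u v : ℝ} (hu : 0 < u) (hvu : u < v) :
    ∀ᶠ n : ℕ in atTop, cseq c β n * u ^ (β n / γseq c n) ≤ exp (β n * Lv c n v) / n := by
  have hl : Tendsto (fun n : ℕ => (1 / β₀) * (log n / (n : ℝ) ^ c)) atTop (nhds 0) := by
    have := ((_root_.log_rpow hc0)).const_mul (1 / β₀)
    simpa using this
  have hd : 0 < log v - log u := sub_pos.2 (log_lt_log hu hvu)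
  filter_upwards [eventually_gt_atTop 0, hl.eventually (gt_mem_nhds hd)] with n hn hlt
  have hn' : (0 : ℝ) < n := by exact_mod_cast hn
  have hγ := gm_pos (c := c) hn'
  have hb : 0 < β n := lt_of_lt_of_le hβ₀ (hβ n)
  have e2 : log n / (n : ℝ) ^ c = log n * γseq c n := by unfold γseq; rw [rpow_neg hn'.le]; rfl
  rw [e2] at hlt
  have key : log n * γseq c n ≤ β n * (log v - log u) := by
    have h4 : log n * γseq c n < β₀ * (log v - log u) := by
      have := mul_lt_mul_of_pos_left hlt hβ₀
      rwa [← mul_assoc, mul_one_div_cancel hβ₀.ne', one_mul] at this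
    nlinarith [hβ n]
  rw [le_div_iff₀ hn', cseq, rpow_def_of_pos hu, ← exp_add]
  nth_rewrite 2 [← exp_log hn']
  rw [← exp_add, exp_le_exp, Lv]
  have : log n ≤ β n * (log v - log u) / γseq c n := by rwa [le_div_iff₀ hγ]
  calc _ ≤ γseq c n * β n * n + log u * (β n / γseq c n) + β n * (log v - log u) / γseq c n := by gcongr
    _ = _ := by ring
end pg2


section pg3
variable {c : ℝ}
  {Ω : Type*} [MeasurableSpace Ω] {P : Measure Ω} [IsProbabilityMeasure P] {p : ℕ}
    {H : (n : ℕ) → V n → Ω → ℝ}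

lemma BP_nonneg (n g θ : ℕ) (L : ℝ) (h : V n → ℝ) : 0 ≤ BP n g θ L h :=
  mul_nonneg (Nat.cast_nonneg _) (sum_nonneg fun k _ => PP_nonneg k L h)

set_option maxHeartbeats 800000 in
lemma BP_tend (hc0 : 0 < c) (hc1 : c < 1 / 2) (hp : 2 ≤ p)
    (hG : ∀ n, GV P (H n) (fun x y => (n : ℝ) * overlap n x y ^ p))
    {v : ℝ} (hv : 0 < v) {t : ℝ} (ht : 0 < t) :
    (∀ᶠ n in atTop, Integrable (fun ω => (kseq c n t : ℝ) * BP n (gg c n) (θseq n) (Lv c n v) (fun x => H n x ω)) P) ∧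
    Tendsto (fun n => ∫ ω, (kseq c n t : ℝ) * BP n (gg c n) (θseq n) (Lv c n v) (fun x => H n x ω) ∂P) atTop (nhds 0) := by
  have hb := bb_pos hc1
  have hγev : ∀ᶠ n : ℕ in atTop, γseq c n < 1 / 2 := (gm_zero hc0).eventually (gt_mem_nhds (by norm_num))
  have hev : ∀ᶠ n : ℕ in atTop, n ≠ 0 ∧ 0 < γseq c n ∧ γseq c n ^ 2 / 2 ≤ 1 / 4 := by
    filter_upwards [eventually_gt_atTop 0, hγev] with n hn h
    have := gm_pos (c := c) (n := n) (by exact_mod_cast hn)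
    exact ⟨hn.ne', this, by nlinarith⟩
  have hInt : ∀ᶠ n in atTop, Integrable (fun ω => (kseq c n t : ℝ) * BP n (gg c n) (θseq n) (Lv c n v) (fun x => H n x ω)) P := by
    filter_upwards [hev] with n ⟨h1, h2, h3⟩
    unfold BP
    exact ((integrable_finset_sum _ fun k _ => (PP_mean h1 (by omega) (hG n) k (Lv c n v) h2 h3).1).const_mul _).const_mul _
  refine ⟨hInt, ?_⟩
  have hlim := (((poly_exp 6 (show 0 < bb c / 2 by linarith) (show (0 : ℝ) < 1 / 8 by norm_num)).add
    ((poly_exp 8 (show 0 < 1 - 2 * c by linarith) (show (0 : ℝ) < 1 / 8 by norm_num)).const_mul (8 * exp (1 / 4)))).const_mul (72 * t / v))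
  rw [mul_zero, add_zero, mul_zero] at hlim
  refine squeeze_zero' (Eventually.of_forall fun n => integral_nonneg fun ω =>
    mul_nonneg (Nat.cast_nonneg _) (BP_nonneg _ _ _ _ _)) ?_ hlim
  filter_upwards [hev] with n ⟨hn, hγ, hγ2⟩
  have hn0 : 0 < n := Nat.pos_of_ne_zero hn
  have hn' : (0 : ℝ) < n := by exact_mod_cast hn0
  have hn1 : (1 : ℝ) ≤ n := by exact_mod_cast hn0
  unfold BP
  rw [integral_const_mul, integral_const_mul, integral_finset_sum _ fun k _ => (PP_mean hn (by omega) (hG n) k (Lv c n v) hγ hγ2).1]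
  have hgi := gm_inv_le (c := c) hc1 hn1
  have hgi2 : 8 / γseq c n ^ 2 ≤ 8 * (n : ℝ) ^ 2 := by
    rw [div_eq_mul_inv, ← inv_pow]
    have : 0 < (γseq c n)⁻¹ := inv_pos.2 hγ
    gcongr
  set W := exp (-(1 / 8 * (n : ℝ) ^ (bb c / 2))) + 8 * (n : ℝ) ^ 2 * (exp (1 / 4) * exp (-(1 / 8 * (n : ℝ) ^ (1 - 2 * c)))) with hW
  set E := exp (-(γseq c n ^ 2 * n / 2)) / v with hE
  have hE0 : 0 < E := by positivity
  have hW0 : 0 < W := by positivity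
  have hk : ∀ k ∈ Icc (gg c n) (θseq n), ∫ ω, PP n k (Lv c n v) (fun x => H n x ω) ∂P ≤ E * (2 * W) := by
    intro k hk
    rw [mem_Icc] at hk
    refine le_trans (PP_mean hn (by omega) (hG n) k (Lv c n v) hγ hγ2).2 ?_
    have e1 : exp (γseq c n ^ 2 * n / 2 - γseq c n * Lv c n v) = E := by
      have : γseq c n ^ 2 * n / 2 - γseq c n * Lv c n v = -(γseq c n ^ 2 * n / 2) - log v := by
        unfold Lv; field_simp; ring
      rw [hE, this, exp_sub, exp_log hv]
    rw [e1]
    have h1 : exp (-(γseq c n ^ 2 * k / 8)) ≤ exp (-(1 / 8 * (n : ℝ) ^ (bb c / 2))) := by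
      apply exp_le_exp.2
      have := gm_gg (c := c) hn'
      have h2 : γseq c n ^ 2 * gg c n ≤ γseq c n ^ 2 * k := by
        have : (gg c n : ℝ) ≤ k := by exact_mod_cast hk.1
        gcongr
      linarith
    have h2 : exp (1 / 4 - γseq c n ^ 2 * n / 8) = exp (1 / 4) * exp (-(1 / 8 * (n : ℝ) ^ (1 - 2 * c))) := by
      rw [← exp_add, ← gm_sq hn']; congr 1; ring
    rw [h2, hW]
    gcongr
  have hs := sum_le_sum hk
  rw [sum_const, nsmul_eq_mul] at hs
  have hcard : ((Icc (gg c n) (θseq n)).card : ℝ) ≤ 4 * (n : ℝ) ^ 2 := by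
    rw [Nat.card_Icc]
    have : θseq n + 1 - gg c n ≤ 4 * n ^ 2 := by unfold θseq; have : 1 ≤ n ^ 2 := Nat.one_le_pow _ _ hn0; omega
    exact_mod_cast this
  have hkE : (kseq c n t : ℝ) * E ≤ 3 * n ^ 2 * t / v := by
    have h1 := k_le (c := c) ht hn0
    have h2 := aseq_le hc1 hn1
    calc (kseq c n t : ℝ) * E ≤ aseq c n * t * E := by gcongr
      _ = (aseq c n * exp (-(γseq c n ^ 2 * n / 2))) * t / v := by rw [hE]; ring
      _ ≤ _ := by gcongr
  calc _ ≤ (kseq c n t : ℝ) * (θseq n * (4 * (n : ℝ) ^ 2 * (E * (2 * W)))) := by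
        gcongr
        refine hs.trans ?_
        gcongr
    _ = ((kseq c n t : ℝ) * E) * (θseq n * (4 * (n : ℝ) ^ 2 * (2 * W))) := by ring
    _ ≤ (3 * n ^ 2 * t / v) * (θseq n * (4 * (n : ℝ) ^ 2 * (2 * W))) := by gcongr
    _ = _ := by
      rw [th_cast, hW, show (n : ℝ) ^ (6 : ℝ) = (n : ℝ) ^ 6 by exact_mod_cast rpow_natCast (n : ℝ) 6,
        show (n : ℝ) ^ (8 : ℝ) = (n : ℝ) ^ 8 by exact_mod_cast rpow_natCast (n : ℝ) 8]
      ring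

lemma exp_exp_le {a z : ℝ} (ha : 0 < a) (ha1 : a ≤ 1) : exp (-(exp z / 2)) ≤ 2 * exp (-(a * z)) := by
  rcases le_total z 0 with hz | hz
  · have h1 : 1 ≤ exp (-(a * z)) := one_le_exp (by nlinarith)
    have h2 : exp (-(exp z / 2)) ≤ 1 := exp_le_one_iff.2 (by have := exp_pos z; linarith)
    linarith
  · have h1 : exp (-z) ≤ exp (-(a * z)) := exp_le_exp.2 (by nlinarith)
    have h2 : exp z / 2 ≤ exp (exp z / 2) := by linarith [add_one_le_exp (exp z / 2)]
    have h3 : exp (-(exp z / 2)) ≤ 2 * exp (-z) := by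
      rw [exp_neg, exp_neg]
      rw [← div_eq_mul_inv, inv_eq_one_div, div_le_div_iff₀ (exp_pos _) (exp_pos _)]
      linarith
    linarith

noncomputable def XB (c : ℝ) (n : ℕ) (t u : ℝ) (h : V n → ℝ) : ℝ :=
  (kseq c n t : ℝ) * (θseq n + 1) * (exp (-(n / 2 : ℝ)) * (2 * (exp (-(γseq c n ^ 2 * n)) / u * θseq n))) *
    ((∑ x, exp (γseq c n * h x)) / 2 ^ n)

lemma XB_bound (hc0 : 0 < c) {β : ℕ → ℝ} {β₀ : ℝ} (hβ₀ : 0 < β₀) (hβ : ∀ n : ℕ, β₀ ≤ β n)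
    {u : ℝ} (hu : 0 < u) {t : ℝ} (ht : 0 < t) :
    ∀ᶠ n : ℕ in atTop, ∀ h : V n → ℝ,
      (kseq c n t : ℝ) * Bx n (θseq n) (fun x => max n (cseq c β n * u ^ (β n / γseq c n) * exp (-(β n * h x)) / θseq n)) ≤ XB c n t u h := by
  have hγev : ∀ᶠ n : ℕ in atTop, γseq c n < β₀ := (gm_zero hc0).eventually (gt_mem_nhds hβ₀)
  filter_upwards [eventually_gt_atTop 0, hγev] with n hn hγβ h
  have hn' : (0 : ℝ) < n := by exact_mod_cast hn
  have hn1 : (1 : ℝ) ≤ n := by exact_mod_cast hn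
  have hγ := gm_pos (c := c) hn'
  have hb : 0 < β n := lt_of_lt_of_le hβ₀ (hβ n)
  have ha : 0 < γseq c n / β n := by positivity
  have ha1 : γseq c n / β n ≤ 1 := by rw [div_le_one hb]; exact hγβ.le.trans (hβ n)
  have hθ : (1 : ℝ) ≤ θseq n := by rw [th_cast]; nlinarith
  unfold Bx XB
  rw [mul_assoc ((kseq c n t : ℝ)), mul_assoc ((kseq c n t : ℝ)), mul_assoc ((θseq n : ℝ) + 1)]
  refine mul_le_mul_of_nonneg_left (mul_le_mul_of_nonneg_left ?_ (by positivity)) (Nat.cast_nonneg _)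
  rw [mul_div_assoc', mul_sum]
  refine div_le_div_of_nonneg_right (sum_le_sum fun x _ => ?_) (by positivity)
  set z := γseq c n * β n * n + log u * (β n / γseq c n) - β n * h x - log (θseq n) with hz
  have ez : cseq c β n * u ^ (β n / γseq c n) * exp (-(β n * h x)) / θseq n = exp z := by
    rw [hz, exp_sub, exp_log (by linarith), exp_sub, exp_add, cseq, rpow_def_of_pos hu, exp_neg]; rfl
  beta_reduce
  rw [ez]
  have h1 : exp (-max (n : ℝ) (exp z)) ≤ exp (-(n / 2 : ℝ)) * exp (-(exp z / 2)) := by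
    rw [← exp_add]
    apply exp_le_exp.2
    have := le_max_left (n : ℝ) (exp z)
    have := le_max_right (n : ℝ) (exp z)
    linarith
  have h2 := exp_exp_le (z := z) ha ha1
  have h3 : exp (-(γseq c n / β n * z)) ≤ exp (-(γseq c n ^ 2 * n)) / u * θseq n * exp (γseq c n * h x) := by
    have e : exp (-(γseq c n ^ 2 * n)) / u * θseq n * exp (γseq c n * h x) = exp (-(γseq c n ^ 2 * n) - log u + log (θseq n) + γseq c n * h x) := by
      rw [exp_add, exp_add, exp_sub, exp_log hu, exp_log (by linarith)]
    rw [e]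
    apply exp_le_exp.2
    have e2 : γseq c n / β n * z = γseq c n ^ 2 * n + log u - γseq c n * h x - γseq c n / β n * log (θseq n) := by
      rw [hz]; field_simp
    rw [e2]
    have : γseq c n / β n * log (θseq n) ≤ 1 * log (θseq n) := mul_le_mul_of_nonneg_right ha1 (log_nonneg hθ)
    linarith
  calc _ ≤ exp (-(n / 2 : ℝ)) * exp (-(exp z / 2)) := h1
    _ ≤ exp (-(n / 2 : ℝ)) * (2 * (exp (-(γseq c n ^ 2 * n)) / u * θseq n * exp (γseq c n * h x))) := by
        refine mul_le_mul_of_nonneg_left (h2.trans ?_) (exp_pos _).le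
        linarith
    _ = _ := by ring

lemma XB_nonneg {u : ℝ} (hu : 0 < u) {t : ℝ} (n : ℕ) (h : V n → ℝ) : 0 ≤ XB c n t u h := by
  unfold XB; positivity

lemma XB_tend (hc1 : c < 1 / 2)
    (hG : ∀ n, GV P (H n) (fun x y => (n : ℝ) * overlap n x y ^ p))
    {u : ℝ} (hu : 0 < u) {t : ℝ} (ht : 0 < t) :
    (∀ n, Integrable (fun ω => XB c n t u (fun x => H n x ω)) P) ∧
    Tendsto (fun n => ∫ ω, XB c n t u (fun x => H n x ω) ∂P) atTop (nhds 0) := by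
  have hi : ∀ n, Integrable (fun ω => ∑ x, exp (γseq c n * H n x ω)) P := fun n =>
    integrable_finset_sum _ fun x _ => (hG n).int_exp x _
  refine ⟨fun n => ((hi n).div_const _).const_mul _, ?_⟩
  have hlim := (poly_exp 6 one_pos (show (0 : ℝ) < 1 / 2 by norm_num)).const_mul (72 * t / u)
  rw [mul_zero] at hlim
  refine squeeze_zero' (Eventually.of_forall fun n => integral_nonneg fun ω => XB_nonneg hu n _) ?_ hlim
  filter_upwards [eventually_gt_atTop 0] with n hn
  have hn' : (0 : ℝ) < n := by exact_mod_cast hn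
  have hn1 : (1 : ℝ) ≤ n := by exact_mod_cast hn
  unfold XB
  rw [integral_const_mul, integral_div, integral_finset_sum _ fun x _ => (hG n).int_exp x _]
  have e1 : ∀ x, ∫ ω, exp (γseq c n * H n x ω) ∂P = exp (γseq c n ^ 2 * n / 2) := by
    intro x
    rw [(hG n).exp_eq, overlap_self, one_pow, mul_one]
  rw [sum_congr rfl fun x _ => e1 x, sum_const, nsmul_eq_mul]
  have e2 : ((univ : Finset (V n)).card : ℝ) = 2 ^ n := by simp [card_univ]
  rw [e2, mul_div_cancel_left₀ _ (by positivity)]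
  have h1 := k_le (c := c) ht hn
  have h2 := aseq_le (c := c) hc1 hn1
  have e3 : exp (-(γseq c n ^ 2 * n)) * exp (γseq c n ^ 2 * n / 2) = exp (-(γseq c n ^ 2 * n / 2)) := by
    rw [← exp_add]; congr 1; ring
  have hθ : (θseq n + 1 : ℝ) ≤ 4 * n ^ 2 := by rw [th_cast]; nlinarith
  calc _ = ((kseq c n t : ℝ) * exp (-(γseq c n ^ 2 * n / 2))) * ((θseq n + 1) * (exp (-(n / 2 : ℝ)) * (2 / u * θseq n))) := by
        rw [← e3]; ring
    _ ≤ ((aseq c n * t) * exp (-(γseq c n ^ 2 * n / 2))) * ((θseq n + 1) * (exp (-(n / 2 : ℝ)) * (2 / u * θseq n))) := by gcongr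
    _ = (aseq c n * exp (-(γseq c n ^ 2 * n / 2))) * (t * (θseq n + 1) * (exp (-(n / 2 : ℝ)) * (2 / u * θseq n))) := by ring
    _ ≤ (3 * n ^ 2) * (t * (4 * n ^ 2) * (exp (-(n / 2 : ℝ)) * (2 / u * θseq n))) := by gcongr
    _ = _ := by
      rw [th_cast, rpow_one, show (n : ℝ) ^ (6 : ℝ) = (n : ℝ) ^ 6 by exact_mod_cast rpow_natCast (n : ℝ) 6,
        show (1 / 2 * n : ℝ) = n / 2 by ring]
      ring
end pg3


section ph

lemma mk_tend {Ω : Type*} [MeasurableSpace Ω] {P : Measure Ω} [IsProbabilityMeasure P]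
    {X : ℕ → Ω → ℝ} (h0 : ∀ n ω, 0 ≤ X n ω) (hi : ∀ᶠ n in atTop, Integrable (X n) P)
    (hl : Tendsto (fun n => ∫ ω, X n ω ∂P) atTop (nhds 0)) {δ : ℝ} (hδ : 0 < δ) :
    Tendsto (fun n => P.real {ω | δ < X n ω}) atTop (nhds 0) := by
  have h := hl.div_const δ
  rw [zero_div] at h
  refine squeeze_zero' (Eventually.of_forall fun n => measureReal_nonneg) ?_ h
  filter_upwards [hi] with n hn
  rw [← integral_div]
  refine real_le_int (hn.div_const δ) (fun ω => div_nonneg (h0 n ω) hδ.le) fun ω hω => ?_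
  rw [one_le_div hδ]; exact le_of_lt hω

lemma AA_nonneg' {n : ℕ} (m : ℕ) (L : ℝ) (h : V n → ℝ) : 0 ≤ AA n m L h :=
  Ew_nonneg _ fun q _ => by split_ifs <;> simp

lemma AA_prob {c : ℝ} (hc0 : 0 < c) (hc1 : c < 1 / 2) {p : ℕ} (hp : 2 ≤ p)
    {Ω : Type*} [MeasurableSpace Ω] {P : Measure Ω} [IsProbabilityMeasure P]
    {H : (n : ℕ) → V n → Ω → ℝ} (hG : ∀ n, GV P (H n) (fun x y => (n : ℝ) * overlap n x y ^ p))
    {v : ℝ} (hv : 0 < v) {t : ℝ} (ht : 0 < t) {δ : ℝ} (hδ : 0 < δ) :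
    Tendsto (fun n => P.real {ω | δ ^ 2 < (Sn c n t * AA n (mm c n) (Lv c n v) (fun x => H n x ω) - 2 * p * t / v) ^ 2}) atTop (nhds 0) := by
  refine mk_tend (fun n ω => sq_nonneg _) (Eventually.of_forall fun n => ?_) (AA_L2 hc0 hc1 hp hG hv ht) (by positivity)
  have h1 := (AA_mean (P := P) (H := H n) (hG n).meas (mm c n) (Lv c n v)).1
  have h2 := (AA_sq (P := P) (H := H n) (hG n).meas (mm c n) (Lv c n v)).1
  refine (((h2.const_mul (Sn c n t ^ 2)).sub (h1.const_mul (2 * Sn c n t * (2 * p * t / v)))).add (integrable_const ((2 * p * t / v) ^ 2))).congr (ae_of_all _ fun ω => ?_)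
  simp only [Pi.add_apply, Pi.sub_apply]; ring

end ph

set_option maxHeartbeats 2000000 in
theorem nu_tendsto_in_probability
    (p : ℕ) (hp : 2 ≤ p) (c : ℝ) (hc0 : 0 < c) (hc1 : c < 1 / 2)
    (β : ℕ → ℝ) (β₀ : ℝ) (hβ₀ : 0 < β₀) (hβ : ∀ n : ℕ, β₀ ≤ β n)
    (B : ℝ) (hB : ∀ n : ℕ, γseq c n * β n ≤ B)
    {Ω : Type*} [MeasurableSpace Ω] (Pe : Measure Ω) [IsProbabilityMeasure Pe]
    (H : (n : ℕ) → V n → Ω → ℝ) (hHmeas : ∀ n x, Measurable (H n x))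
    (hH : ∀ n : ℕ, IsCenteredGaussianVector Pe (H n)
      (fun x y => (n : ℝ) * overlap n x y ^ p))
    {Ω' : Type*} [MeasurableSpace Ω'] (Pw : Measure Ω') [IsProbabilityMeasure Pw]
    (J : (n : ℕ) → ℕ → Ω' → V n) (e : ℕ → ℕ → Ω' → ℝ)
    (hJmeas : ∀ n i, Measurable (J n i)) (hemeas : ∀ n i, Measurable (e n i))
    (hlaw : WalkExpLaw Pw J e) :
    ∀ u : ℝ, 0 < u → ∀ t : ℝ, 0 < t → ∀ ε : ℝ, 0 < ε →
      Tendsto (fun n =>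
          Pe {ω | ε < |nuSum Pw J e c β n t u (fun x => H n x ω) - 2 * p * t / u|})
        atTop (nhds 0) := by
  intro u hu t ht ε hε
  have hp0 : (0 : ℝ) < p := by exact_mod_cast (by omega : 0 < p)
  have hG : ∀ n, GV Pe (H n) (fun x y => (n : ℝ) * overlap n x y ^ p) := by
    intro n
    refine GV.of_cgv (hHmeas n) (hH n) (fun x y => by rw [overlap_comm]) ?_
    intro a
    rcases Nat.eq_zero_or_pos n with h0 | h0
    · subst h0; simp
    · exact rho_psd p h0.ne' a
  obtain ⟨l, hl⟩ : ∃ l : ℝ, l = 2 * p * t / u := ⟨_, rfl⟩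
  have hl0 : 0 < l := by rw [hl]; positivity
  obtain ⟨ε', hε', hε1, hε2⟩ : ∃ ε' : ℝ, 0 < ε' ∧ ε' ≤ ε / 2 ∧ ε' < l :=
    ⟨min (ε / 2) (l / 2), by positivity, min_le_left _ _, lt_of_le_of_lt (min_le_right _ _) (by linarith)⟩
  obtain ⟨v1, hv1⟩ : ∃ v : ℝ, v = 2 * p * t / (l + ε') := ⟨_, rfl⟩
  obtain ⟨v2, hv2⟩ : ∃ v : ℝ, v = 2 * p * t / (l - ε') := ⟨_, rfl⟩
  have hd2 : 0 < l - ε' := by linarith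
  have hv10 : 0 < v1 := by rw [hv1]; positivity
  have hv20 : 0 < v2 := by rw [hv2]; positivity
  have hul : u = 2 * p * t / l := by rw [hl]; field_simp
  have hv1u : v1 < u := by
    rw [hv1, hul]
    exact div_lt_div_of_pos_left (by positivity) hl0 (by linarith)
  have hv2u : u < v2 := by
    rw [hv2, hul]
    exact div_lt_div_of_pos_left (by positivity) hd2 (by linarith)
  have hl1 : 2 * p * t / v1 = l + ε' := by rw [hv1]; field_simp
  have hl2 : 2 * p * t / v2 = l - ε' := by rw [hv2]; field_simp
  obtain ⟨ρ1, hρ1, hρ1'⟩ := cnt_upper (c := c) hc0 hc1 ht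
  obtain ⟨ρ2, hρ2, hρ2'⟩ := cnt_lower (c := c) hc0 hc1 ht
  set δ := min (ε / 8) ((l - ε') / 2) with hδdef
  have hδ : 0 < δ := by positivity
  have hδ1 : δ ≤ ε / 8 := min_le_left _ _
  have hδ2 : δ ≤ (l - ε') / 2 := min_le_right _ _
  have T1 := AA_prob hc0 hc1 hp hG hv10 ht hδ
  have T2 := AA_prob hc0 hc1 hp hG hv20 ht hδ
  have T3 := mk_tend (fun n ω => XB_nonneg hu n _) (Eventually.of_forall (XB_tend (c := c) hc1 hG hu ht).1) (XB_tend (c := c) hc1 hG hu ht).2 hδ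
  have T4 := mk_tend (fun n ω => mul_nonneg (Nat.cast_nonneg _) (BP_nonneg _ _ _ _ _)) (BP_tend hc0 hc1 hp hG hv20 ht).1 (BP_tend hc0 hc1 hp hG hv20 ht).2 hδ
  have TT := ((T1.add T2).add T3).add T4
  simp only [add_zero] at TT
  -- deterministic eventual bounds
  have D1 : ∀ᶠ n in atTop, ρ1 n * (l + ε' + δ) + δ < l + ε := by
    have h := (hρ1.mul_const (l + ε' + δ)).add_const δ
    exact h.eventually (gt_mem_nhds (by linarith))
  have D1' : ∀ᶠ n in atTop, 0 < ρ1 n := hρ1.eventually (lt_mem_nhds one_pos)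
  have D2' : ∀ᶠ n in atTop, 0 < ρ2 n := hρ2.eventually (lt_mem_nhds one_pos)
  have D2 : ∀ᶠ n : ℕ in atTop, l - ε < exp (-(1 / n : ℝ)) * (ρ2 n * (l - ε' - δ) - δ) := by
    have he : Tendsto (fun n : ℕ => exp (-(1 / n : ℝ))) atTop (nhds 1) := by
      have := (continuous_exp.tendsto (-0)).comp (tendsto_one_div_atTop_nhds_zero_nat (𝕜 := ℝ)).neg
      rw [neg_zero, exp_zero] at this
      exact this
    have h := he.mul ((hρ2.mul_const (l - ε' - δ)).sub_const δ)
    exact h.eventually (lt_mem_nhds (by linarith))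
  have hle : ∀ᶠ n in atTop, Pe.real {ω | ε < |nuSum Pw J e c β n t u (fun x => H n x ω) - 2 * p * t / u|} ≤ 
      Pe.real {ω | δ ^ 2 < (Sn c n t * AA n (mm c n) (Lv c n v1) (fun x => H n x ω) - 2 * p * t / v1) ^ 2} +
      Pe.real {ω | δ ^ 2 < (Sn c n t * AA n (mm c n) (Lv c n v2) (fun x => H n x ω) - 2 * p * t / v2) ^ 2} +
      Pe.real {ω | δ < XB c n t u (fun x => H n x ω)} +
      Pe.real {ω | δ < (kseq c n t : ℝ) * BP n (gg c n) (θseq n) (Lv c n v2) (fun x => H n x ω)} := by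
    filter_upwards [D1, D1', D2, D2', hρ1', hρ2', eventually_gt_atTop 0, thr_upper hc0 hβ₀ hβ hv10 hv1u,
      thr_lower hc0 hβ₀ hβ hu hv2u, XB_bound hc0 hβ₀ hβ hu ht] with n d1 d1' d2 d2' r1 r2 hn tu tl xb
    refine le_trans (measureReal_mono (s₂ := (({ω | δ ^ 2 < (Sn c n t * AA n (mm c n) (Lv c n v1) (fun x => H n x ω) - 2 * p * t / v1) ^ 2} ∪
      {ω | δ ^ 2 < (Sn c n t * AA n (mm c n) (Lv c n v2) (fun x => H n x ω) - 2 * p * t / v2) ^ 2}) ∪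
      {ω | δ < XB c n t u (fun x => H n x ω)}) ∪
      {ω | δ < (kseq c n t : ℝ) * BP n (gg c n) (θseq n) (Lv c n v2) (fun x => H n x ω)}) ?_ (measure_ne_top _ _)) ?_
    swap
    · refine (measureReal_union_le _ _).trans (add_le_add_left ?_ _)
      refine (measureReal_union_le _ _).trans (add_le_add_left ?_ _)
      exact measureReal_union_le _ _
    intro ω hω
    by_contra hcon
    simp only [Set.mem_union, Set.mem_setOf_eq, not_or, not_lt] at hcon hω
    obtain ⟨⟨⟨g1, g2⟩, g3⟩, g4⟩ := hcon
    rw [hl1] at g1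
    rw [hl2] at g2
    have g1' := (abs_le_of_sq_le_sq' g1 hδ.le).2
    have g2' := (abs_le_of_sq_le_sq' g2 hδ.le).1
    generalize hh : (fun x => H n x ω) = h at *
    have hk0 : (0 : ℝ) ≤ kseq c n t := Nat.cast_nonneg _
    have hθ : 0 < θseq n := by unfold θseq; positivity
    have hC : 0 < cseq c β n * u ^ (β n / γseq c n) := by unfold cseq; positivity
    have hb : 0 < β n := lt_of_lt_of_le hβ₀ (hβ n)
    have U1 := dyn_upper hlaw hJmeas hemeas hn.ne' hθ hb hC tu h
    have U2 := HH_upper hn.ne' (θseq n) (mm c n) (Lv c n v1) h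
    have L1 := dyn_lower hlaw hJmeas hemeas hn.ne' (θ := θseq n) hb tl h
    have L2 := HH_lower hn.ne' (θseq n) (mm c n) (gg c n) (θseq n / (mm c n + 1 + gg c n)) (Nat.div_mul_le_self _ _) (Lv c n v2) h
    have hA1 := AA_nonneg' (mm c n) (Lv c n v1) h
    have hA2 := AA_nonneg' (mm c n) (Lv c n v2) h
    have hup : nuSum Pw J e c β n t u h < l + ε := by
      calc nuSum Pw J e c β n t u h ≤ (kseq c n t : ℝ) * (HH n (θseq n) (Lv c n v1) h + Bx n (θseq n) (fun x => max n (cseq c β n * u ^ (β n / γseq c n) * exp (-(β n * h x)) / θseq n))) :=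
            mul_le_mul_of_nonneg_left U1 hk0
        _ ≤ (kseq c n t : ℝ) * (((θseq n / (mm c n + 1) + 1 : ℕ) : ℝ) * AA n (mm c n) (Lv c n v1) h) + δ := by
            rw [mul_add]
            exact add_le_add (mul_le_mul_of_nonneg_left U2 hk0) ((xb h).trans g3)
        _ ≤ (ρ1 n * Sn c n t) * AA n (mm c n) (Lv c n v1) h + δ := by
            rw [← mul_assoc]
            exact add_le_add_left (mul_le_mul_of_nonneg_right r1 hA1) _
        _ = ρ1 n * (Sn c n t * AA n (mm c n) (Lv c n v1) h) + δ := by ring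
        _ ≤ ρ1 n * (l + ε' + δ) + δ := by
            refine add_le_add_left (mul_le_mul_of_nonneg_left ?_ d1'.le) _
            linarith
        _ < _ := d1
    have hlo : l - ε < nuSum Pw J e c β n t u h := by
      refine lt_of_lt_of_le d2 ?_
      calc exp (-(1 / n : ℝ)) * (ρ2 n * (l - ε' - δ) - δ) ≤ exp (-(1 / n : ℝ)) * (ρ2 n * (Sn c n t * AA n (mm c n) (Lv c n v2) h) - (kseq c n t : ℝ) * BP n (gg c n) (θseq n) (Lv c n v2) h) := by
            refine mul_le_mul_of_nonneg_left (sub_le_sub (mul_le_mul_of_nonneg_left ?_ d2'.le) g4) (exp_pos _).le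
            linarith
        _ ≤ exp (-(1 / n : ℝ)) * ((kseq c n t : ℝ) * HH n (θseq n) (Lv c n v2) h) := by
            refine mul_le_mul_of_nonneg_left ?_ (exp_pos _).le
            have q1 := mul_le_mul_of_nonneg_left L2 hk0
            have q2 := mul_le_mul_of_nonneg_right r2 hA2
            nlinarith
        _ = (kseq c n t : ℝ) * (exp (-(1 / n : ℝ)) * HH n (θseq n) (Lv c n v2) h) := by ring
        _ ≤ _ := mul_le_mul_of_nonneg_left L1 hk0
    rw [← hl] at hω
    exact absurd hω (not_lt.2 (abs_le.2 ⟨by linarith, by linarith⟩))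
  have hreal := squeeze_zero' (Eventually.of_forall fun n => measureReal_nonneg) hle TT
  have := ENNReal.tendsto_ofReal hreal
  rw [ENNReal.ofReal_zero] at this
  refine this.congr fun n => ?_
  exact ofReal_measureReal (measure_ne_top _ _)
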